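/- arXiv:1010.2230 — 2 statements merged into one kernel-verified Lean document; each statement's English description precedes it below -/
import Mathlib

section
/- There exists a sequence (L_e)_{e∈ℕ} of sets and a set D ≤_T ∅'' such that: every finite join L_0 ⊕ L_1 ⊕ ⋯ ⊕ L_e is low; L_e ≤_T D for every e; and the class {L_e : e ∈ ℕ} is not Δ⁰₂ null, i.e., for every ∅'-computable martingale M there is an e such that M does not succeed on L_e and L_e is infinite. -/
/-!
Preamble: oracle computability, Turing reducibility, the jump, martingales,
and Martin-Löf randomness, developed from scratch.
-/

open scoped Classical

/-- The characteristic function of a set of naturals. -/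
noncomputable def chi (A : Set ℕ) : ℕ → ℕ :=
  fun n => if n ∈ A then 1 else 0

/-- Partial functions recursive in a (total) oracle `O : ℕ → ℕ`.
This mirrors `Nat.Partrec`, with an additional constructor for the oracle. -/
inductive RecIn (O : ℕ → ℕ) : (ℕ →. ℕ) → Prop
  | oracle : RecIn O (fun n => Part.some (O n))
  | zero : RecIn O (fun _ => Part.some 0)
  | succ : RecIn O (fun n => Part.some (n + 1))
  | left : RecIn O (fun n => Part.some (Nat.unpair n).1)
  | right : RecIn O (fun n => Part.some (Nat.unpair n).2)
  | pair {f g} : RecIn O f → RecIn O g → RecIn O (fun n => Nat.pair <$> f n <*> g n)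
  | comp {f g} : RecIn O f → RecIn O g → RecIn O (fun n => g n >>= f)
  | prec {f g} :
      RecIn O f → RecIn O g →
      RecIn O
        (Nat.unpaired fun a n =>
          n.rec (f a) fun y IH => do
            let i ← IH
            g (Nat.pair a (Nat.pair y i)))
  | rfind {f} :
      RecIn O f →
      RecIn O (fun a => Nat.rfind fun n => (fun m => m = 0) <$> f (Nat.pair a n))

/-- Codes for oracle machines. -/
inductive OCode : Type
  | zero : OCode
  | succ : OCode
  | left : OCode
  | right : OCode
  | oracle : OCode
  | pair : OCode → OCode → OCode
  | comp : OCode → OCode → OCode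
  | prec : OCode → OCode → OCode
  | rfind' : OCode → OCode

/-- Evaluation of oracle codes relative to a total oracle. -/
def evalo (O : ℕ → ℕ) : OCode → ℕ →. ℕ
  | .zero => fun _ => Part.some 0
  | .succ => fun n => Part.some (n + 1)
  | .left => fun n => Part.some (Nat.unpair n).1
  | .right => fun n => Part.some (Nat.unpair n).2
  | .oracle => fun n => Part.some (O n)
  | .pair cf cg => fun n => Nat.pair <$> evalo O cf n <*> evalo O cg n
  | .comp cf cg => fun n => evalo O cg n >>= evalo O cf
  | .prec cf cg =>
      Nat.unpaired fun a n =>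
        n.rec (evalo O cf a) fun y IH => do
          let i ← IH
          evalo O cg (Nat.pair a (Nat.pair y i))
  | .rfind' cf =>
      Nat.unpaired fun a m =>
        (Nat.rfind fun n => (fun x => x = 0) <$> evalo O cf (Nat.pair a (n + m))).map (· + m)

/-- A surjective listing of oracle codes. -/
def ofNatOCode : ℕ → OCode
  | 0 => .zero
  | 1 => .succ
  | 2 => .left
  | 3 => .right
  | 4 => .oracle
  | n + 5 =>
    have hm : n.div2.div2 < n + 5 := by
      rw [Nat.div2_val, Nat.div2_val]
      exact lt_of_le_of_lt (le_trans (Nat.div_le_self _ _) (Nat.div_le_self _ _))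
        (Nat.lt_succ_of_le (Nat.le_add_right _ 4))
    have _m1 : n.div2.div2.unpair.1 < n + 5 :=
      lt_of_le_of_lt (Nat.unpair_left_le _) hm
    have _m2 : n.div2.div2.unpair.2 < n + 5 :=
      lt_of_le_of_lt (Nat.unpair_right_le _) hm
    match n.bodd, n.div2.bodd with
    | false, false => .pair (ofNatOCode n.div2.div2.unpair.1) (ofNatOCode n.div2.div2.unpair.2)
    | false, true  => .comp (ofNatOCode n.div2.div2.unpair.1) (ofNatOCode n.div2.div2.unpair.2)
    | true , false => .prec (ofNatOCode n.div2.div2.unpair.1) (ofNatOCode n.div2.div2.unpair.2)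
    | true , true  => .rfind' (ofNatOCode n.div2.div2)

/-- `Phi O e` is the `e`-th partial `O`-computable function `Φ_e^O`. -/
def Phi (O : ℕ → ℕ) (e : ℕ) : ℕ →. ℕ := evalo O (ofNatOCode e)

/-- The Turing jump `A'` of a set `A`. -/
noncomputable def jump (A : Set ℕ) : Set ℕ := {e | (Phi (chi A) e e).Dom}

/-- The halting set `∅'`. -/
noncomputable def K : Set ℕ := jump ∅

/-- Turing reducibility between sets: `TRed B A` means `B ≤_T A`. -/
noncomputable def TRed (B A : Set ℕ) : Prop :=
  RecIn (chi A) (fun n => Part.some (chi B n))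

/-- The effective join of two sets. -/
def join (A B : Set ℕ) : Set ℕ :=
  {n | (∃ a ∈ A, n = 2 * a) ∨ (∃ b ∈ B, n = 2 * b + 1)}

/-- A set is low if its jump is Turing reducible to `∅'`. -/
noncomputable def Low (L : Set ℕ) : Prop := TRed (jump L) K

/-- The function `f : α → β` presented as an oracle on `ℕ`, via the encodings. -/
def fnOracle {α β : Type} [Encodable α] [Encodable β] (f : α → β) : ℕ → ℕ :=
  fun n => Encodable.encode ((Encodable.decode (α := α) n).map f)

/-- `FRed f A` means the function `f` is Turing reducible to the set `A`. -/
noncomputable def FRed {α β : Type} [Encodable α] [Encodable β] (f : α → β) (A : Set ℕ) : Prop :=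
  RecIn (chi A) (fun n => Part.some (fnOracle f n))

/-- `FFRed g f` means the function `g` is Turing reducible to the function `f`. -/
def FFRed {α β γ δ : Type} [Encodable α] [Encodable β] [Encodable γ] [Encodable δ]
    (g : γ → δ) (f : α → β) : Prop :=
  RecIn (fnOracle f) (fun n => Part.some (fnOracle g n))

/-- A martingale: a nonnegative rational-valued function on finite binary strings
satisfying the averaging condition `2 M(σ) = M(σ0) + M(σ1)`. -/
def IsMartingale (M : List Bool → ℚ) : Prop :=
  (∀ σ, 0 ≤ M σ) ∧ ∀ σ, 2 * M σ = M (σ ++ [false]) + M (σ ++ [true])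

/-- The length-`n` initial segment of the characteristic sequence of `A`. -/
noncomputable def seg (A : Set ℕ) (n : ℕ) : List Bool :=
  (List.range n).map fun i => if i ∈ A then true else false

/-- A martingale succeeds on a set `A` if `limsup_n M(A↾n) = ∞`. -/
noncomputable def Succeeds (M : List Bool → ℚ) (A : Set ℕ) : Prop :=
  ∀ q : ℚ, ∃ n, q < M (seg A n)

/-- `H(A)`: the mass problem of infinite subsets or cosubsets of `A`. -/
def Hset (A : Set ℕ) : Set (Set ℕ) :=
  {S | S.Infinite ∧ (S ⊆ A ∨ S ⊆ Aᶜ)}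

/-- Muchnik reducibility: `MuchnikLe P Q` iff every member of `Q` computes a member of `P`. -/
noncomputable def MuchnikLe (P Q : Set (Set ℕ)) : Prop :=
  ∀ B ∈ Q, ∃ A ∈ P, TRed A B

/-- A set of naturals is computably enumerable. -/
def CE (W : Set ℕ) : Prop :=
  ∃ g : ℕ →. ℕ, RecIn (fun _ => 0) g ∧ ∀ n, n ∈ W ↔ (g n).Dom

/-- A Martin-Löf test: a uniformly c.e. sequence of sets of strings `U n`,
with the open set generated by `U n` having measure at most `2^{-n}`. -/
def MLTest (U : ℕ → Set (List Bool)) : Prop :=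
  CE {p : ℕ | ∃ σ ∈ U (Nat.unpair p).1, (Nat.unpair p).2 = Encodable.encode σ} ∧
  ∀ n, (∑' σ : (U n), ((1 : ENNReal) / 2) ^ (σ : List Bool).length) ≤ (1 / 2) ^ n

/-- A set is 1-random (Martin-Löf random) if for every Martin-Löf test there is
an `n` such that no initial segment of the set lies in `U n`. -/
noncomputable def MLRandom (A : Set ℕ) : Prop :=
  ∀ U : ℕ → Set (List Bool), MLTest U → ∃ n, ∀ m, seg A m ∉ U n

/-- Finite iterated join `L 0 ⊕ L 1 ⊕ ⋯ ⊕ L e`. -/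
def joinUpTo (L : ℕ → Set ℕ) : ℕ → Set ℕ
  | 0 => L 0
  | e + 1 => join (joinUpTo L e) (L (e + 1))

open scoped Classical
open Encodable

namespace S7

/-- total function recursive in O -/
def RI (O : ℕ → ℕ) (f : ℕ → ℕ) : Prop := RecIn O (fun n => Part.some (f n))

theorem RecIn.of_eq {O f g} (h : RecIn O f) (e : ∀ n, f n = g n) : RecIn O g := by
  have : f = g := funext e
  exact this ▸ h

theorem RI.of_eq {O f g} (h : RI O f) (e : ∀ n, f n = g n) : RI O g := by
  have : f = g := funext e
  exact this ▸ h

theorem of_partrec {O} {f : ℕ →. ℕ} (h : Nat.Partrec f) : RecIn O f := by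
  induction h with
  | zero => exact RecIn.zero
  | succ => exact RecIn.succ
  | left => exact RecIn.left
  | right => exact RecIn.right
  | pair _ _ h1 h2 => exact RecIn.pair h1 h2
  | comp _ _ h1 h2 => exact RecIn.comp h1 h2
  | prec _ _ h1 h2 => exact RecIn.prec h1 h2
  | rfind _ h1 => exact RecIn.rfind h1

theorem RI.of_nprim {O f} (h : Nat.Primrec f) : RI O f :=
  of_partrec (Nat.Partrec.of_primrec h)

theorem RI.of_prim {O} {f : ℕ → ℕ} (h : Primrec f) : RI O f :=
  RI.of_nprim (Primrec.nat_iff.1 h)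

theorem RI.comp {O f g} (hf : RI O f) (hg : RI O g) : RI O (fun n => f (g n)) :=
  RecIn.of_eq (RecIn.comp hf hg) (fun n => by simp)

theorem RI.pair {O f g} (hf : RI O f) (hg : RI O g) : RI O (fun n => Nat.pair (f n) (g n)) :=
  RecIn.of_eq (RecIn.pair hf hg) (fun n => by simp [Seq.seq])

theorem RI.comp₂ {O f g} {h : ℕ → ℕ → ℕ} (hh : Primrec₂ h) (hf : RI O f) (hg : RI O g) :
    RI O (fun n => h (f n) (g n)) := by
  have h1 : RI O (fun n => h n.unpair.1 n.unpair.2) :=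
    RI.of_prim (hh.comp (Primrec.fst.comp Primrec.unpair) (Primrec.snd.comp Primrec.unpair))
  exact (h1.comp (hf.pair hg)).of_eq (fun n => by simp)

theorem RI.prec {O} {g : ℕ → ℕ} (a : ℕ) (hg : RI O g) {s : ℕ → ℕ} (h0 : s 0 = a)
    (hs : ∀ k, s (k+1) = g (Nat.pair k (s k))) : RI O s := by
  have hc : RI O (fun _ => a) := RI.of_prim (Primrec.const a)
  have hg' : RI O (fun n => g n.unpair.2) := hg.comp RecIn.right
  have h1 := RecIn.prec hc hg'
  have h2 : RI O (fun n => Nat.pair 0 n) :=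
    RI.of_prim (Primrec₂.natPair.comp (Primrec.const 0) Primrec.id)
  refine RecIn.of_eq (RecIn.comp h1 h2) (fun n => ?_)
  simp only [Part.bind_eq_bind, Part.bind_some, Nat.unpaired, Nat.unpair_pair]
  induction n with
  | zero => simp [h0]
  | succ k ih => simp only [ih, hs, Part.bind_some]

theorem rfind_eq {f : ℕ → ℕ} {r : ℕ} (h0 : f r = 0) (h1 : ∀ m < r, f m ≠ 0) :
    (Nat.rfind fun n => (fun m => decide (m = 0)) <$> Part.some (f n)) = Part.some r := by
  apply Part.eq_some_iff.2
  refine Nat.mem_rfind.2 ⟨by simp [h0], fun {m} hm => by simp [h1 m hm]⟩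

theorem RI.find {O} {f : ℕ → ℕ} (hf : RI O f) (r : ℕ → ℕ) (h0 : ∀ n, f (Nat.pair n (r n)) = 0)
    (h1 : ∀ n, ∀ m < r n, f (Nat.pair n m) ≠ 0) : RI O r := by
  refine RecIn.of_eq (RecIn.rfind hf) (fun n => ?_)
  convert rfind_eq (f := fun m => f (Nat.pair n m)) (h0 n) (h1 n)

theorem RecIn.trans {O O' f} (hO : RI O O') (h : RecIn O' f) : RecIn O f := by
  induction h with
  | oracle => exact hO
  | zero => exact RecIn.zero
  | succ => exact RecIn.succ
  | left => exact RecIn.left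
  | right => exact RecIn.right
  | pair _ _ h1 h2 => exact RecIn.pair h1 h2
  | comp _ _ h1 h2 => exact RecIn.comp h1 h2
  | prec _ _ h1 h2 => exact RecIn.prec h1 h2
  | rfind _ h1 => exact RecIn.rfind h1

/-- typed version -/
def CI (O : ℕ → ℕ) {α β : Type} [Encodable α] [Encodable β] (f : α → β) : Prop :=
  RI O (fnOracle f)

section
variable {α β γ : Type} [Primcodable α] [Primcodable β] [Primcodable γ] {O : ℕ → ℕ}

theorem CI.of_prim {f : α → β} (h : Primrec f) : CI O f := by
  refine RI.of_nprim (f := fnOracle f) ?_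
  exact h

theorem CI.of_eq {f g : α → β} (h : CI O f) (e : ∀ n, f n = g n) : CI O g := by
  have : f = g := funext e
  exact this ▸ h

theorem CI.trans {O O' : ℕ → ℕ} (hO : RI O O') {f : α → β} (h : CI O' f) : CI O f :=
  RecIn.trans hO h

theorem CI.comp {g : β → γ} {f : α → β} (hg : CI O g) (hf : CI O f) :
    CI O (fun a => g (f a)) := by
  have h1 : Primrec₂ (fun v w : ℕ => if v = 0 then 0 else w) :=
    Primrec.ite (Primrec.eq.comp Primrec.fst (Primrec.const 0)) (Primrec.const 0) Primrec.snd
  have h2 : RI O (fun n => fnOracle f n - 1) := (RI.of_prim Primrec.pred).comp hf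
  refine (RI.comp₂ h1 hf (RI.comp hg h2)).of_eq (fun n => ?_)
  simp only [fnOracle]
  rcases Option.eq_none_or_eq_some (decode (α := α) n) with h | ⟨a, h⟩ <;> simp [h]

theorem CI.pair {f : α → β} {g : α → γ} (hf : CI O f) (hg : CI O g) :
    CI O (fun a => (f a, g a)) := by
  have h1 : Primrec₂ (fun v w : ℕ => if v = 0 then 0 else Nat.pair (v-1) (w-1) + 1) :=
    Primrec.ite (Primrec.eq.comp Primrec.fst (Primrec.const 0)) (Primrec.const 0)
      (Primrec.succ.comp (Primrec₂.natPair.comp (Primrec.pred.comp Primrec.fst)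
        (Primrec.pred.comp Primrec.snd)))
  refine (RI.comp₂ h1 hf hg).of_eq (fun n => ?_)
  simp only [fnOracle]
  rcases Option.eq_none_or_eq_some (decode (α := α) n) with h | ⟨a, h⟩ <;> simp [h]

theorem CI.comp₂ {δ : Type} [Primcodable δ] {h : β → γ → δ} {f : α → β} {g : α → γ}
    (hh : Primrec₂ h) (hf : CI O f) (hg : CI O g) : CI O (fun a => h (f a) (g a)) :=
  CI.comp (g := fun p : β × γ => h p.1 p.2) (CI.of_prim hh) (hf.pair hg)

theorem CI.compP {h : β → γ} {f : α → β}
    (hh : Primrec h) (hf : CI O f) : CI O (fun a => h (f a)) :=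
  CI.comp (CI.of_prim hh) hf

theorem CI.to_RI {f : ℕ → ℕ} (h : CI O f) : RI O f := by
  refine ((RI.of_prim Primrec.pred).comp h).of_eq fun n => ?_
  simp [fnOracle]

theorem CI.of_RI {f : ℕ → ℕ} (h : RI O f) : CI O f := by
  refine ((RI.of_prim Primrec.succ).comp h).of_eq fun n => ?_
  simp [fnOracle]

theorem CI.enc_iff {f : α → β} : CI O (fun a => encode (f a)) ↔ CI O f := by
  unfold CI
  have : fnOracle (fun a => Encodable.encode (f a)) = fnOracle f := by
    funext n
    simp only [fnOracle]
    cases h : decode (α := α) n <;> simp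
  rw [this]

theorem CI.rec {g : ℕ × β → β} (hg : CI O g) {s : ℕ → β}
    (hs : ∀ k, s (k+1) = g (k, s k)) : CI O s := by
  rw [← CI.enc_iff]
  apply CI.of_RI
  refine RI.prec (Encodable.encode (s 0)) (g := fun n => fnOracle g n - 1)
    ((RI.of_prim Primrec.pred).comp hg) rfl (fun k => ?_)
  simp [fnOracle, hs]

theorem CI.find {f : α × ℕ → Bool} (hf : CI O f) (r : α → ℕ) (h0 : ∀ a, f (a, r a) = true)
    (h1 : ∀ a, ∀ m < r a, f (a, m) = false) : CI O r := by
  have hd : Primrec (fun n : ℕ => (decode (α := α) n).isSome) :=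
    Primrec.option_isSome.comp Primrec.decode
  have ht : RI O (fun p => if fnOracle f p = 1 then 1 else 0) := by
    refine RI.comp (f := fun v => if v = 1 then 1 else 0) (RI.of_prim ?_) hf
    exact Primrec.ite (Primrec.eq.comp Primrec.id (Primrec.const 1)) (Primrec.const 1)
      (Primrec.const 0)
  have h2 := RI.find ht (fun n => ((decode (α := α) n).map r).getD 0) (fun n => ?_) (fun n m hm => ?_)
  · have h3 : Primrec₂ (fun n v : ℕ => if (decode (α := α) n).isSome then v + 1 else 0) :=
      Primrec.ite (Primrec.eq.comp (hd.comp Primrec.fst) (Primrec.const true))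
        (Primrec.succ.comp Primrec.snd) (Primrec.const 0)
    refine (RI.comp₂ h3 (RI.of_prim Primrec.id) h2).of_eq (fun n => ?_)
    simp only [fnOracle]
    cases h : decode (α := α) n <;> simp [h]
  · simp only [fnOracle]
    cases h : decode (α := α) n <;> simp [h, h0, encode_true]
  · simp only [fnOracle]
    cases h : decode (α := α) n with
    | none => simp [h] at hm
    | some a =>
      simp [h] at hm
      simp [h, h1 a m hm, encode_false]

theorem CI.chi_iff {S : Set ℕ} : CI O (fun n => decide (n ∈ S)) ↔ RI O (chi S) := by
  rw [← CI.enc_iff]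
  have : (fun n => Encodable.encode (decide (n ∈ S))) = _root_.chi S := by
    funext n
    simp only [_root_.chi]
    split_ifs with h <;> simp [h, encode_true, encode_false]
  rw [this]
  exact ⟨CI.to_RI, CI.of_RI⟩

end

end S7

open scoped Classical
open Encodable

namespace S7

def encO : OCode → ℕ
  | .zero => 0
  | .succ => 1
  | .left => 2
  | .right => 3
  | .oracle => 4
  | .pair cf cg => 2 * (2 * Nat.pair (encO cf) (encO cg)) + 5
  | .comp cf cg => 2 * (2 * Nat.pair (encO cf) (encO cg) + 1) + 5
  | .prec cf cg => (2 * (2 * Nat.pair (encO cf) (encO cg)) + 1) + 5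
  | .rfind' cf => (2 * (2 * encO cf + 1) + 1) + 5

theorem ofNat_encO (c : OCode) : ofNatOCode (encO c) = c := by
  induction c <;> simp [encO, ofNatOCode, Nat.div2_val, *]

theorem exists_code {O f} (h : RecIn O f) : ∃ c : OCode, evalo O c = f := by
  induction h with
  | oracle => exact ⟨.oracle, rfl⟩
  | zero => exact ⟨.zero, rfl⟩
  | succ => exact ⟨.succ, rfl⟩
  | left => exact ⟨.left, rfl⟩
  | right => exact ⟨.right, rfl⟩
  | pair _ _ h1 h2 =>
    obtain ⟨c1, rfl⟩ := h1
    obtain ⟨c2, rfl⟩ := h2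
    exact ⟨.pair c1 c2, rfl⟩
  | comp _ _ h1 h2 =>
    obtain ⟨c1, rfl⟩ := h1
    obtain ⟨c2, rfl⟩ := h2
    exact ⟨.comp c1 c2, rfl⟩
  | prec _ _ h1 h2 =>
    obtain ⟨c1, rfl⟩ := h1
    obtain ⟨c2, rfl⟩ := h2
    exact ⟨.prec c1 c2, rfl⟩
  | rfind _ h1 =>
    obtain ⟨c1, rfl⟩ := h1
    refine ⟨.comp (.rfind' c1) (.pair (.pair .left .right) .zero), ?_⟩
    funext n
    simp [evalo, Seq.seq]
    rw [show (fun x : ℕ => x) = id from rfl, Part.map_id']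
    intro x; rfl

def constO : ℕ → OCode
  | 0 => .zero
  | n+1 => .comp .succ (constO n)

theorem eval_constO (O : ℕ → ℕ) (n m : ℕ) : evalo O (constO n) m = Part.some n := by
  induction n with
  | zero => rfl
  | succ k ih => simp [constO, evalo, ih]

theorem prim_smn (c : OCode) : Primrec (fun n => encO (.comp c (constO n))) := by
  have h1 : Primrec (fun n => encO (constO n)) := by
    have : Primrec (fun n : ℕ => (Nat.rec 0 (fun _ i => 2 * (2 * Nat.pair 1 i + 1) + 5) n : ℕ)) := by
      refine Primrec.nat_rec₁ (f := fun _ i => 2 * (2 * Nat.pair 1 i + 1) + 5) 0 ?_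
      exact (Primrec.nat_add.comp (Primrec.nat_double.comp (Primrec.nat_double_succ.comp
        (Primrec₂.natPair.comp (Primrec.const 1) Primrec.snd))) (Primrec.const 5))
    refine this.of_eq fun n => ?_
    induction n with
    | zero => rfl
    | succ k ih => simp only [constO, encO, ih]
  simp only [encO]
  exact (Primrec.nat_add.comp (Primrec.nat_double.comp (Primrec.nat_double_succ.comp
        (Primrec₂.natPair.comp (Primrec.const _) h1))) (Primrec.const 5))

theorem dom_jump {B : Set ℕ} {p : ℕ →. ℕ} (h : RecIn (chi B) p) :
    ∃ g : ℕ → ℕ, Primrec g ∧ ∀ n, (p n).Dom ↔ g n ∈ jump B := by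
  obtain ⟨c, rfl⟩ := exists_code h
  refine ⟨_, prim_smn c, fun n => ?_⟩
  have : Phi (chi B) (encO (.comp c (constO n))) (encO (.comp c (constO n))) = evalo (chi B) c n := by
    rw [Phi, ofNat_encO]
    change (evalo (chi B) (constO n) _).bind (evalo (chi B) c) = _
    rw [eval_constO]
    exact Part.bind_some _ _
  rw [jump, Set.mem_ofPred_eq, this]

theorem CI_ex {α : Type} [Primcodable α] {B : Set ℕ} {f : α × ℕ → Bool} (hf : CI (chi B) f) :
    CI (chi (jump B)) (fun a => decide (∃ m, f (a, m) = true)) := by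
  have ht : RI (chi B) (fun p => if fnOracle f p = 2 then 0 else 1) := by
    refine RI.comp (f := fun v => if v = 2 then 0 else 1) (RI.of_prim ?_) hf
    exact Primrec.ite (Primrec.eq.comp Primrec.id (Primrec.const 2)) (Primrec.const 0)
      (Primrec.const 1)
  obtain ⟨g, hg, hd⟩ := dom_jump (RecIn.rfind ht)
  have h1 : CI (chi (jump B)) (fun n : ℕ => decide (n ∈ jump B)) := CI.chi_iff.2 RecIn.oracle
  refine (h1.comp ((CI.of_prim hg).comp (CI.of_prim Primrec.encode))).of_eq fun a => ?_
  congr 1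
  rw [← hd]
  apply propext
  have key : ∀ m, (fnOracle f (Nat.pair (encode a) m) = 2) ↔ f (a, m) = true := by
    intro m
    have : Nat.pair (encode a) m = encode (a, m) := rfl
    rw [this, fnOracle]
    cases h : f (a, m) <;> simp [h]
  refine Nat.rfind_dom.trans ?_
  constructor
  · rintro ⟨m, hm, -⟩
    refine ⟨m, (key m).1 ?_⟩
    by_contra hc
    simp [hc] at hm
  · rintro ⟨m, hm⟩
    refine ⟨m, ?_, fun _ => ?_⟩
    · simp [(key m).2 hm]
    · simp

theorem RI_jump (B : Set ℕ) : RI (chi (jump B)) (chi B) := by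
  rw [← CI.chi_iff]
  have h : CI (chi B) (fun p : ℕ × ℕ => decide (p.1 ∈ B)) :=
    (CI.chi_iff.2 RecIn.oracle : CI (chi B) (fun n : ℕ => decide (n ∈ B))).comp (CI.of_prim Primrec.fst)
  exact (CI_ex h).of_eq fun a => by simp

theorem countable_mart : ∃ Ms : ℕ → List Bool → ℚ, ∀ M, FRed M K → ∃ e, M = Ms e := by
  let Q : ℕ → (List Bool → ℚ) → Prop := fun e M => Phi (chi K) e = fun n => Part.some (fnOracle M n)
  refine ⟨fun e => if h : ∃ M, Q e M then h.choose else fun _ => 0, fun M hM => ?_⟩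
  obtain ⟨c, hc⟩ := exists_code hM
  have hQ : ∃ M, Q (encO c) M := ⟨M, by simp only [Q, Phi, ofNat_encO, hc]; rfl⟩
  refine ⟨encO c, ?_⟩
  beta_reduce
  rw [dif_pos hQ]
  have h2 := hQ.choose_spec
  generalize hQ.choose = N at h2
  simp only [Q, Phi, ofNat_encO, hc] at h2
  funext σ
  have h3 := congrFun h2 (encode σ)
  simp [fnOracle] at h3
  exact h3

end S7

open scoped Classical
open Encodable

namespace S7

/-- evaluation with a partial oracle -/
def evalp (O : ℕ → Part ℕ) : OCode → ℕ → Part ℕ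
  | .zero => fun _ => Part.some 0
  | .succ => fun n => Part.some (n + 1)
  | .left => fun n => Part.some (Nat.unpair n).1
  | .right => fun n => Part.some (Nat.unpair n).2
  | .oracle => fun n => O n
  | .pair cf cg => fun n => (evalp O cf n).bind fun a => (evalp O cg n).bind fun b =>
      Part.some (Nat.pair a b)
  | .comp cf cg => fun n => (evalp O cg n).bind (evalp O cf)
  | .prec cf cg => fun p =>
      Nat.rec (evalp O cf p.unpair.1) (fun y IH => IH.bind fun i =>
          evalp O cg (Nat.pair p.unpair.1 (Nat.pair y i))) p.unpair.2
  | .rfind' cf => fun p =>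
        (Nat.rfind fun n => (fun x => x = 0) <$>
          evalp O cf (Nat.pair p.unpair.1 (n + p.unpair.2))).map (· + p.unpair.2)

theorem evalp_total (O : ℕ → ℕ) (c : OCode) : ∀ n, evalp (fun n => Part.some (O n)) c n = evalo O c n := by
  induction c with
  | pair cf cg h1 h2 =>
    intro n; simp only [evalp, evalo, h1, h2, Seq.seq]
    apply Part.ext; intro v; simp [eq_comm]
  | comp cf cg h1 h2 =>
    intro n; simp only [evalp, evalo, h2]
    rw [funext h1]; rfl
  | prec cf cg h1 h2 =>
    intro n; simp only [evalp, evalo, h1, h2, Nat.unpaired]; rfl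
  | rfind' cf h1 =>
    intro n; simp only [evalp, evalo, h1, Nat.unpaired]
  | _ => intro n; rfl

theorem mem_rfind'' {f : ℕ → Part ℕ} {y : ℕ} :
    (y ∈ Nat.rfind fun n => (fun x => decide (x = 0)) <$> f n) ↔
      0 ∈ f y ∧ ∀ m < y, ∃ a ∈ f m, a ≠ 0 := by
  refine Nat.mem_rfind.trans ?_
  simp

theorem evalp_mono {O O' : ℕ → Part ℕ} (h : ∀ n v, v ∈ O n → v ∈ O' n) (c : OCode) :
    ∀ n v, v ∈ evalp O c n → v ∈ evalp O' c n := by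
  induction c with
  | pair cf cg h1 h2 =>
    intro n v; simp only [evalp, Part.mem_bind_iff]
    rintro ⟨a, ha, b, hb, hv⟩
    exact ⟨a, h1 _ _ ha, b, h2 _ _ hb, hv⟩
  | comp cf cg h1 h2 =>
    intro n v; simp only [evalp, Part.mem_bind_iff]
    rintro ⟨a, ha, hv⟩
    exact ⟨a, h2 _ _ ha, h1 _ _ hv⟩
  | prec cf cg h1 h2 =>
    intro p; simp only [evalp]
    generalize p.unpair.2 = m
    induction m with
    | zero => exact h1 _
    | succ m ih =>
      intro v; simp only [Part.mem_bind_iff]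
      rintro ⟨a, ha, hv⟩
      exact ⟨a, ih _ ha, h2 _ _ hv⟩
  | rfind' cf h1 =>
    intro p v; simp only [evalp, Part.mem_map_iff, mem_rfind'']
    rintro ⟨a, ⟨ha, hb⟩, hv⟩
    refine ⟨a, ⟨h1 _ _ ha, fun m hm => ?_⟩, hv⟩
    obtain ⟨b, hb, h0⟩ := hb m hm
    exact ⟨b, h1 _ _ hb, h0⟩
  | oracle => intro n v; exact h n v
  | _ => intro n v; exact id

theorem evalp_cont {O : ℕ → Part ℕ} {P : ℕ → ℕ → Part ℕ}
    (hm : ∀ i j, i ≤ j → ∀ n v, v ∈ P i n → v ∈ P j n)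
    (h : ∀ n v, v ∈ O n → ∃ k, v ∈ P k n) (c : OCode) :
    ∀ n v, v ∈ evalp O c n → ∃ k, v ∈ evalp (P k) c n := by
  have mono : ∀ (c : OCode) i j, i ≤ j → ∀ n v, v ∈ evalp (P i) c n → v ∈ evalp (P j) c n :=
    fun c i j hij => evalp_mono (hm i j hij) c
  induction c with
  | pair cf cg h1 h2 =>
    intro n v; simp only [evalp, Part.mem_bind_iff]
    rintro ⟨a, ha, b, hb, hv⟩
    obtain ⟨k, hk⟩ := h1 _ _ ha
    obtain ⟨l, hl⟩ := h2 _ _ hb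
    exact ⟨max k l, a, mono _ _ _ (le_max_left _ _) _ _ hk, b, mono _ _ _ (le_max_right _ _) _ _ hl, hv⟩
  | comp cf cg h1 h2 =>
    intro n v; simp only [evalp, Part.mem_bind_iff]
    rintro ⟨a, ha, hb⟩
    obtain ⟨k, hk⟩ := h2 _ _ ha
    obtain ⟨l, hl⟩ := h1 _ _ hb
    exact ⟨max k l, a, mono _ _ _ (le_max_left _ _) _ _ hk, mono _ _ _ (le_max_right _ _) _ _ hl⟩
  | prec cf cg h1 h2 =>
    intro p v hv
    have key : ∀ m v, v ∈ evalp O (.prec cf cg) (Nat.pair p.unpair.1 m) →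
        ∃ k, v ∈ evalp (P k) (.prec cf cg) (Nat.pair p.unpair.1 m) := by
      intro m
      induction m with
      | zero => 
        intro v hv
        simp only [evalp, Nat.unpair_pair] at hv ⊢
        exact h1 _ _ hv
      | succ m ih =>
        intro v hv
        have hv' : v ∈ (evalp O (.prec cf cg) (Nat.pair p.unpair.1 m)).bind fun i =>
            evalp O cg (Nat.pair p.unpair.1 (Nat.pair m i)) := by
          simpa only [evalp, Nat.unpair_pair] using hv
        obtain ⟨a, ha, hb⟩ := Part.mem_bind_iff.1 hv'
        obtain ⟨k, hk⟩ := ih _ ha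
        obtain ⟨l, hl⟩ := h2 _ _ hb
        refine ⟨max k l, ?_⟩
        have : v ∈ (evalp (P (max k l)) (.prec cf cg) (Nat.pair p.unpair.1 m)).bind fun i =>
            evalp (P (max k l)) cg (Nat.pair p.unpair.1 (Nat.pair m i)) :=
          Part.mem_bind_iff.2 ⟨a, mono _ _ _ (le_max_left _ _) _ _ hk, mono _ _ _ (le_max_right _ _) _ _ hl⟩
        simpa only [evalp, Nat.unpair_pair] using this
    have := key p.unpair.2 v
    rw [Nat.pair_unpair] at this
    exact this hv
  | rfind' cf h1 =>
    intro p v; simp only [evalp, Part.mem_map_iff, mem_rfind'']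
    rintro ⟨a, ⟨ha, hb⟩, hv⟩
    obtain ⟨k, hk⟩ := h1 _ _ ha
    have key : ∀ b ≤ a, ∃ l, ∀ m < b, ∃ x ∈ evalp (P l) cf (Nat.pair p.unpair.1 (m + p.unpair.2)), x ≠ 0 := by
      intro b
      induction b with
      | zero => intro _; exact ⟨0, by simp⟩
      | succ b ih =>
        intro hba
        obtain ⟨l, hl⟩ := ih (by omega)
        obtain ⟨x, hx, hx0⟩ := hb b (by omega)
        obtain ⟨l', hl'⟩ := h1 _ _ hx
        refine ⟨max l l', fun m hm => ?_⟩
        rcases Nat.lt_succ_iff_lt_or_eq.1 hm with h | rfl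
        · obtain ⟨x, hx, hx0⟩ := hl m h
          exact ⟨x, mono _ _ _ (le_max_left _ _) _ _ hx, hx0⟩
        · exact ⟨x, mono _ _ _ (le_max_right _ _) _ _ hl', hx0⟩
    obtain ⟨l, hl⟩ := key a le_rfl
    refine ⟨max k l, a, ⟨mono _ _ _ (le_max_left _ _) _ _ hk, fun m hm => ?_⟩, hv⟩
    obtain ⟨x, hx, hx0⟩ := hl m hm
    exact ⟨x, mono _ _ _ (le_max_right _ _) _ _ hx, hx0⟩
  | oracle => intro n v hv; exact h n v hv
  | _ => intro n v hv; exact ⟨0, hv⟩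

open Nat.Partrec (Code)
open Nat.Partrec.Code (eval evaln)

/-- rearrangement `((t,a),x) ↦ (t,(a,x))` -/
def asc : Code := .pair (.comp .left .left) (.pair (.comp .right .left) .right)
/-- rearrangement `(t,(a,x)) ↦ ((t,a),x)` -/
def csa : Code := .pair (.pair .left (.comp .left .right)) (.comp .right .right)

theorem eval_comp' (f g : Code) (n : ℕ) : eval (.comp f g) n = (eval g n).bind (eval f) := rfl

theorem ev_comp {f g : Code} {n a b : ℕ} (h : eval g n = Part.some a) (h' : eval f a = Part.some b) :
    eval (.comp f g) n = Part.some b := by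
  rw [eval_comp', h]
  exact (Part.bind_some _ _).trans h'

theorem ev_pair {f g : Code} {n a b : ℕ} (h : eval f n = Part.some a) (h' : eval g n = Part.some b) :
    eval (.pair f g) n = Part.some (Nat.pair a b) := by
  simp [eval, h, h', Seq.seq]

theorem ev_left (n : ℕ) : eval .left n = Part.some n.unpair.1 := rfl
theorem ev_right (n : ℕ) : eval .right n = Part.some n.unpair.2 := rfl
theorem ev_succ (n : ℕ) : eval .succ n = Part.some (n+1) := rfl

theorem eval_asc (n : ℕ) : eval asc n = Part.some (Nat.pair n.unpair.1.unpair.1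
    (Nat.pair n.unpair.1.unpair.2 n.unpair.2)) :=
  ev_pair (ev_comp (ev_left _) (ev_left _)) (ev_pair (ev_comp (ev_left _) (ev_right _)) (ev_right _))

theorem eval_csa (n : ℕ) : eval csa n = Part.some (Nat.pair (Nat.pair n.unpair.1 n.unpair.2.unpair.1)
    n.unpair.2.unpair.2) :=
  ev_pair (ev_pair (ev_left _) (ev_comp (ev_right _) (ev_left _))) (ev_comp (ev_right _) (ev_right _))

def tr (lk : Code) : OCode → Code
  | .zero => .zero
  | .succ => .comp .succ .right
  | .left => .comp .left .right
  | .right => .comp .right .right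
  | .oracle => lk
  | .pair f g => .pair (tr lk f) (tr lk g)
  | .comp f g => .comp (tr lk f) (.pair .left (tr lk g))
  | .prec f g => .comp (.prec (tr lk f) (.comp (tr lk g) asc)) csa
  | .rfind' f => .comp (.rfind' (.comp (tr lk f) asc)) csa

theorem eval_tr (lk : Code) (t : ℕ) (c : OCode) :
    ∀ n, eval (tr lk c) (Nat.pair t n) = evalp (fun n => eval lk (Nat.pair t n)) c n := by
  induction c with
  | pair cf cg h1 h2 =>
    intro n; simp only [tr, evalp, eval, h1, h2, Seq.seq]
    apply Part.ext; intro v; simp [eq_comm]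
  | comp cf cg h1 h2 =>
    intro n; 
    have : eval (.pair .left (tr lk cg)) (Nat.pair t n) = (evalp (fun n => eval lk (Nat.pair t n)) cg n).bind
       (fun a => Part.some (Nat.pair t a)) := by
      simp only [eval, h2, Seq.seq]
      apply Part.ext; intro v; simp [eq_comm]
    rw [tr, eval_comp', this]
    refine (Part.bind_assoc _ _ _).trans ?_
    simp only [evalp]
    congr 1
    funext x
    rw [← h1]
    exact Part.bind_some _ _
  | prec cf cg h1 h2 =>
    intro n; simp only [tr, evalp]
    rw [eval_comp', eval_csa]
    refine (Part.bind_some _ _).trans ?_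
    simp only [Nat.unpair_pair]
    generalize n.unpair.2 = m
    induction m with
    | zero => simp [eval, h1]
    | succ m ih =>
      rw [Nat.Partrec.Code.eval_prec_succ, ih]
      change Part.bind _ _ = _
      congr 1
      funext x
      rw [eval_comp', eval_asc]
      refine (Part.bind_some _ _).trans ?_
      simp [h2]
  | rfind' cf h1 =>
    intro n; simp only [tr, evalp]
    rw [eval_comp', eval_csa]
    refine (Part.bind_some _ _).trans ?_
    simp only [Nat.unpair_pair, eval, Nat.unpaired]
    congr 2
    funext x
    congr 1
    change Part.bind (eval asc _) (eval (tr lk cf)) = _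
    rw [eval_asc]
    refine (Part.bind_some _ _).trans ?_
    simp [h1]
  | succ => intro n; simpa [tr, evalp] using ev_comp (ev_right (Nat.pair t n)) (ev_succ _)
  | left => intro n; simpa [tr, evalp] using ev_comp (ev_right (Nat.pair t n)) (ev_left _)
  | right => intro n; simpa [tr, evalp] using ev_comp (ev_right (Nat.pair t n)) (ev_right _)
  | oracle => intro n; simp [tr, evalp]
  | zero => intro n; rfl

end S7

open scoped Classical
open Encodable

namespace S7
open Nat.Partrec (Code)
open Nat.Partrec.Code (eval evaln)

theorem prim_tr (lk : Code) : Primrec (fun n => tr lk (ofNatOCode n)) := by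
  let pr : Code × Code × Code → Code := fun p => .pair p.2.1 p.2.2
  let co : Code × Code × Code → Code := fun p => .comp p.2.1 (.pair .left p.2.2)
  let pc : Code × Code × Code → Code := fun p => .comp (.prec p.2.1 (.comp p.2.2 asc)) csa
  let rf : Code × Code × Code → Code := fun p => .comp (.rfind' (.comp p.1 asc)) csa
  have h1 : Primrec (fun p : Code × Code × Code => p.1) := Primrec.fst
  have h2 : Primrec (fun p : Code × Code × Code => p.2.1) := Primrec.fst.comp Primrec.snd
  have h3 : Primrec (fun p : Code × Code × Code => p.2.2) := Primrec.snd.comp Primrec.snd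
  have hpr : Primrec pr := Nat.Partrec.Code.primrec₂_pair.comp h2 h3
  have hco : Primrec co := Nat.Partrec.Code.primrec₂_comp.comp h2
    (Nat.Partrec.Code.primrec₂_pair.comp (Primrec.const _) h3)
  have hpc : Primrec pc := Nat.Partrec.Code.primrec₂_comp.comp
    (Nat.Partrec.Code.primrec₂_prec.comp h2
      (Nat.Partrec.Code.primrec₂_comp.comp h3 (Primrec.const _))) (Primrec.const _)
  have hrf : Primrec rf := Nat.Partrec.Code.primrec₂_comp.comp
    (Nat.Partrec.Code.primrec_rfind'.comp
      (Nat.Partrec.Code.primrec₂_comp.comp h1 (Primrec.const _))) (Primrec.const _)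
  let G₀ : ℕ × (Code × Code × Code) → Code := fun q =>
    cond q.1.bodd (cond q.1.div2.bodd (rf q.2) (pc q.2)) (cond q.1.div2.bodd (co q.2) (pr q.2))
  have hG₀ : Primrec G₀ := Primrec.cond (Primrec.nat_bodd.comp Primrec.fst)
    (Primrec.cond (Primrec.nat_bodd.comp (Primrec.nat_div2.comp Primrec.fst))
      (hrf.comp Primrec.snd) (hpc.comp Primrec.snd))
    (Primrec.cond (Primrec.nat_bodd.comp (Primrec.nat_div2.comp Primrec.fst))
      (hco.comp Primrec.snd) (hpr.comp Primrec.snd))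
  let G₁ : List Code × ℕ → Code := fun p => 
    G₀ (p.2, p.1.getI p.2.div2.div2, p.1.getI p.2.div2.div2.unpair.1, p.1.getI p.2.div2.div2.unpair.2)
  have hd : Primrec (fun p : List Code × ℕ => p.2.div2.div2) :=
    Primrec.nat_div2.comp (Primrec.nat_div2.comp Primrec.snd)
  have hG₁ : Primrec G₁ := hG₀.comp (Primrec.snd.pair ((Primrec.list_getI.comp Primrec.fst hd).pair
    ((Primrec.list_getI.comp Primrec.fst (Primrec.fst.comp (Primrec.unpair.comp hd))).pair
    (Primrec.list_getI.comp Primrec.fst (Primrec.snd.comp (Primrec.unpair.comp hd))))))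
  let G : Unit → List Code → Option Code := fun _ IH => some (
    if IH.length = 0 then .zero else if IH.length = 1 then .comp .succ .right else
    if IH.length = 2 then .comp .left .right else if IH.length = 3 then .comp .right .right else
    if IH.length = 4 then lk else G₁ (IH, IH.length - 5))
  have hlen : Primrec (fun p : Unit × List Code => p.2.length) :=
    Primrec.list_length.comp Primrec.snd
  have hi : ∀ k : ℕ, PrimrecPred (fun p : Unit × List Code => p.2.length = k) := fun k =>
    Primrec.eq.comp hlen (Primrec.const k)
  have hG : Primrec₂ G := by
    apply Primrec.option_some.comp
    exact Primrec.ite (hi 0) (Primrec.const _) <| Primrec.ite (hi 1) (Primrec.const _) <|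
      Primrec.ite (hi 2) (Primrec.const _) <| Primrec.ite (hi 3) (Primrec.const _) <|
      Primrec.ite (hi 4) (Primrec.const _) <|
      hG₁.comp (Primrec.snd.pair (Primrec.nat_sub.comp hlen (Primrec.const 5)))
  have := Primrec.nat_strong_rec (fun _ n => tr lk (ofNatOCode n)) hG (fun _ n => ?_)
  · exact this.comp (Primrec.const ()) Primrec.id
  · simp only [G, List.length_map, List.length_range]
    rcases n with _ | _ | _ | _ | _ | n
    · simp [ofNatOCode, tr]
    · simp [ofNatOCode, tr]
    · simp [ofNatOCode, tr]
    · simp [ofNatOCode, tr]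
    · simp [ofNatOCode, tr]
    · have hm : n.div2.div2 < n + 5 := by
        rw [Nat.div2_val, Nat.div2_val]; omega
      have m1 : n.div2.div2.unpair.1 < n + 5 := lt_of_le_of_lt (Nat.unpair_left_le _) hm
      have m2 : n.div2.div2.unpair.2 < n + 5 := lt_of_le_of_lt (Nat.unpair_right_le _) hm
      have key : ∀ m < n + 5, ((List.range (n + 5)).map fun n => tr lk (ofNatOCode n)).getI m =
          tr lk (ofNatOCode m) := by
        intro m hm
        rw [List.getI_eq_getElem _ (by simpa using hm)]
        simp
      have e1 : n + 1 + 1 + 1 + 1 + 1 = n + 5 := rfl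
      rw [e1]
      simp only [G₁, G₀, show n + 5 - 5 = n by omega, key _ hm, key _ m1, key _ m2]
      rw [ofNatOCode]
      cases n.bodd <;> cases n.div2.bodd <;> simp [tr, pr, co, pc, rf]

/-- oracle lookup -/
def lkf (p : ℕ) : Option ℕ :=
  ((decode (α := List Bool × List Bool) p.unpair.1).bind fun q =>
    if p.unpair.2 % 2 = 1 then q.2[p.unpair.2 / 2]? else q.1[p.unpair.2 / 2]?).map encode

theorem prim_lkf : Primrec lkf := by
  have h : Primrec (fun p : ℕ × (List Bool × List Bool) => p.1.unpair.2) :=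
    Primrec.snd.comp (Primrec.unpair.comp Primrec.fst)
  have hb : Primrec (fun p : ℕ × (List Bool × List Bool) => if p.1.unpair.2 % 2 = 1 then
      p.2.2[p.1.unpair.2 / 2]? else p.2.1[p.1.unpair.2 / 2]?) := by
    refine Primrec.ite (Primrec.eq.comp (Primrec.nat_mod.comp h (Primrec.const 2)) (Primrec.const 1)) ?_ ?_
    · exact Primrec.list_getElem?.comp (Primrec.snd.comp Primrec.snd) (Primrec.nat_div.comp h (Primrec.const 2))
    · exact Primrec.list_getElem?.comp (Primrec.fst.comp Primrec.snd) (Primrec.nat_div.comp h (Primrec.const 2))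
  exact Primrec.option_map (Primrec.option_bind (Primrec.decode.comp (Primrec.fst.comp Primrec.unpair))
    (Primrec₂.mk hb)) (Primrec.encode.comp Primrec.snd).to₂

theorem exists_lk : ∃ c : Code, ∀ p, eval c p = Part.ofOption (lkf p) := by
  have h : Partrec (fun p => (Part.ofOption (lkf p) : Part ℕ)) := Computable.ofOption prim_lkf.to_comp
  obtain ⟨c, hc⟩ := Nat.Partrec.Code.exists_code.1 (Partrec.nat_iff.1 h)
  exact ⟨c, fun p => congrFun hc p⟩

noncomputable def lk : Code := exists_lk.choose
theorem eval_lk (p : ℕ) : eval lk p = Part.ofOption (lkf p) := exists_lk.choose_spec p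

theorem seg_length (A : Set ℕ) (n : ℕ) : (seg A n).length = n := by simp [seg]

theorem seg_take (A : Set ℕ) {n m : ℕ} (h : n ≤ m) : (seg A m).take n = seg A n := by
  simp [seg, ← List.map_take, List.take_range, h]

theorem seg_get (A : Set ℕ) (n i : ℕ) : (seg A n)[i]? = if i < n then some (decide (i ∈ A)) else none := by
  split_ifs with h
  · simp [seg, h]
  · simp [seg]; omega

theorem seg_succ (A : Set ℕ) (n : ℕ) : seg A (n+1) = seg A n ++ [decide (n ∈ A)] := by
  simp [seg, List.range_succ]

theorem mem_join (B A : Set ℕ) (n : ℕ) : n ∈ join B A ↔ if n % 2 = 1 then n / 2 ∈ A else n / 2 ∈ B := by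
  simp only [join, Set.mem_ofPred_eq]
  split_ifs with h
  · constructor
    · rintro (⟨a, ha, rfl⟩ | ⟨a, ha, rfl⟩)
      · omega
      · rwa [show (2 * a + 1) / 2 = a by omega]
    · intro h'
      exact Or.inr ⟨_, h', by omega⟩
  · constructor
    · rintro (⟨a, ha, rfl⟩ | ⟨a, ha, rfl⟩)
      · rwa [show (2 * a) / 2 = a by omega]
      · omega
    · intro h'
      exact Or.inl ⟨_, h', by omega⟩

theorem lk_seg (B A : Set ℕ) (k n v : ℕ) :
    v ∈ eval lk (Nat.pair (encode (seg B k, seg A k)) n) ↔ n / 2 < k ∧ v = chi (join B A) n := by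
  rw [eval_lk, Part.mem_ofOption, lkf]
  simp only [Nat.unpair_pair, encodek, Option.bind_some, seg_get, Option.mem_def, chi, mem_join]
  by_cases h : n / 2 < k <;> by_cases h2 : n % 2 = 1 <;> simp [h, h2]
  · by_cases h3 : n / 2 ∈ A <;> simp [h3, eq_comm]
  · by_cases h3 : n / 2 ∈ B <;> simp [h3, eq_comm]

def Hl (e : ℕ) (β σ : List Bool) : Prop :=
  ∃ i < σ.length + 1, (evaln σ.length (tr lk (ofNatOCode e))
    (Nat.pair (encode (β.take i, σ.take i)) e)).isSome = true

def HH (B : Set ℕ) (e : ℕ) (σ : List Bool) : Prop := Hl e (seg B σ.length) σ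

theorem Hl_seg {B : Set ℕ} {e : ℕ} {σ : List Bool} {m : ℕ} (h : σ.length ≤ m) :
    Hl e (seg B m) σ ↔ HH B e σ := by
  simp only [HH, Hl]
  refine exists_congr fun i => and_congr_right fun hi => ?_
  rw [seg_take B (by omega : i ≤ m), seg_take B (by omega : i ≤ σ.length)]

theorem HH_mono {B : Set ℕ} {e : ℕ} {σ : List Bool} (ρ : List Bool) (h : HH B e σ) : HH B e (σ ++ ρ) := by
  obtain ⟨i, hi, h⟩ := h
  refine ⟨i, by simp; omega, ?_⟩
  rw [seg_take B (by omega : i ≤ σ.length)] at h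
  rw [seg_take B (by simp; omega), List.take_append_of_le_length (by omega)]
  obtain ⟨v, hv⟩ := Option.isSome_iff_exists.1 h
  exact Option.isSome_iff_exists.2 ⟨v, Nat.Partrec.Code.evaln_mono (by simp) hv⟩

theorem HH_jump {B A : Set ℕ} {e : ℕ} : e ∈ jump (join B A) ↔ ∃ n, HH B e (seg A n) := by
  have hm : ∀ k n v, v ∈ eval lk (Nat.pair (encode (seg B k, seg A k)) n) → v ∈ Part.some (chi (join B A) n) := by
    intro k n v h
    exact Part.mem_some_iff.2 ((lk_seg B A k n v).1 h).2
  constructor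
  · intro h
    obtain ⟨v, hv⟩ := Part.dom_iff_mem.1 (h : (Phi (chi (join B A)) e e).Dom)
    rw [Phi, ← evalp_total] at hv
    obtain ⟨k, hk⟩ := evalp_cont (P := fun k n => eval lk (Nat.pair (encode (seg B k, seg A k)) n))
      (fun i j hij n v h => by
        rw [lk_seg] at h ⊢
        exact ⟨by omega, h.2⟩)
      (fun n v h => ⟨n / 2 + 1, by
        rw [lk_seg]
        exact ⟨by omega, Part.mem_some_iff.1 h⟩⟩) _ _ _ hv
    rw [← eval_tr] at hk
    obtain ⟨s, hs⟩ := Nat.Partrec.Code.evaln_complete.1 hk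
    refine ⟨max k s, k, by simp [seg_length], ?_⟩
    simp only [seg_length]
    rw [seg_take _ (le_max_left _ _), seg_take _ (le_max_left _ _)]
    exact Option.isSome_iff_exists.2 ⟨v, Nat.Partrec.Code.evaln_mono (le_max_right _ _) hs⟩
  · rintro ⟨n, i, hi, h⟩
    rw [seg_length] at hi h
    rw [seg_take B (by omega : i ≤ n), seg_take A (by omega : i ≤ n)] at h
    obtain ⟨v, hv⟩ := Option.isSome_iff_exists.1 h
    have h2 := Nat.Partrec.Code.evaln_sound hv
    rw [eval_tr] at h2
    have h3 := evalp_mono (hm i) _ _ _ h2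
    rw [evalp_total] at h3
    exact Part.dom_iff_mem.2 ⟨v, h3⟩

end S7

open scoped Classical
open Encodable

namespace S7
open Nat.Partrec (Code)
open Nat.Partrec.Code (eval evaln)

theorem prim_pow2 : Primrec (fun n : ℕ => 2 ^ n) := by
  have h : Primrec₂ (fun (_ : ℕ) (x : ℕ) => 2 * x) :=
    (Primrec.nat_mul.comp (Primrec.const 2) Primrec.snd).to₂
  refine (Primrec.nat_rec₁ 1 h).of_eq fun n => ?_
  induction n with
  | zero => rfl
  | succ n ih => simp only [ih]; rw [pow_succ, mul_comm]

def strs : ℕ → List (List Bool)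
  | 0 => [[]]
  | j + 1 => (strs j).map (List.cons false) ++ (strs j).map (List.cons true)

theorem prim_strs : Primrec strs := by
  have hc : ∀ b : Bool, Primrec (fun p : ℕ × List (List Bool) => p.2.map (List.cons b)) := fun b =>
    Primrec.list_map Primrec.snd (Primrec.list_cons.comp (Primrec.const b) Primrec.snd).to₂
  have h : Primrec₂ (fun (_ : ℕ) (x : List (List Bool)) => x.map (List.cons false) ++ x.map (List.cons true)) :=
    Primrec₂.mk (Primrec.list_append.comp (hc false) (hc true))
  refine (Primrec.nat_rec₁ [[]] h).of_eq fun n => ?_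
  induction n with
  | zero => rfl
  | succ n ih => simp only [ih]; rfl

theorem strs_len {j : ℕ} {ρ : List Bool} (h : ρ ∈ strs j) : ρ.length = j := by
  induction j generalizing ρ with
  | zero => simp [strs] at h; simp [h]
  | succ j ih =>
    simp only [strs, List.mem_append, List.mem_map] at h
    rcases h with ⟨a, ha, rfl⟩ | ⟨a, ha, rfl⟩ <;> simp [ih ha]

theorem strs_card (j : ℕ) : (strs j).length = 2 ^ j := by
  induction j with
  | zero => rfl
  | succ j ih => simp [strs, ih, pow_succ]; ring

theorem prim_Hl : PrimrecPred (fun x : ℕ × List Bool × List Bool => Hl x.1 x.2.1 x.2.2) := by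
  have hR : PrimrecRel (fun (i : ℕ) (x : ℕ × List Bool × List Bool) =>
      (evaln x.2.2.length (tr lk (ofNatOCode x.1))
        (Nat.pair (encode (x.2.1.take i, x.2.2.take i)) x.1)).isSome = true) := by
    have e : Primrec (fun p : ℕ × (ℕ × List Bool × List Bool) => p.2.1) := Primrec.fst.comp Primrec.snd
    have b : Primrec (fun p : ℕ × (ℕ × List Bool × List Bool) => p.2.2.1) :=
      Primrec.fst.comp (Primrec.snd.comp Primrec.snd)
    have s : Primrec (fun p : ℕ × (ℕ × List Bool × List Bool) => p.2.2.2) :=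
      Primrec.snd.comp (Primrec.snd.comp Primrec.snd)
    have i : Primrec (fun p : ℕ × (ℕ × List Bool × List Bool) => p.1) := Primrec.fst
    have h1 := Nat.Partrec.Code.primrec_evaln.comp (((Primrec.list_length.comp s).pair
      ((prim_tr lk).comp e)).pair (Primrec₂.natPair.comp (Primrec.encode.comp
        ((Primrec.list_take.comp i b).pair (Primrec.list_take.comp i s))) e))
    exact Primrec.eq.comp (Primrec.option_isSome.comp h1) (Primrec.const true)
  have h2 := hR.exists_mem_list.comp (Primrec.list_range.comp (Primrec.succ.comp
    (Primrec.list_length.comp (Primrec.snd.comp Primrec.snd)))) (Primrec.id (α := ℕ × List Bool × List Bool))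
  refine h2.of_eq fun x => ?_
  simp only [Hl, List.mem_range, id]

def HFl (F : List ℕ) (β σ : List Bool) : Prop := ∃ e ∈ F, Hl e β σ
def HF (B : Set ℕ) (F : List ℕ) (σ : List Bool) : Prop := ∃ e ∈ F, HH B e σ

theorem prim_HFl : PrimrecPred (fun x : List ℕ × List Bool × List Bool => HFl x.1 x.2.1 x.2.2) := by
  have hR : PrimrecRel (fun (e : ℕ) (x : List Bool × List Bool) => Hl e x.1 x.2) := prim_Hl
  exact hR.exists_mem_list

noncomputable def cntl (F : List ℕ) (β σ : List Bool) (j : ℕ) : ℕ :=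
  ((strs j).filter fun ρ => decide (HFl F β (σ ++ ρ))).length

noncomputable def cnt (B : Set ℕ) (F : List ℕ) (σ : List Bool) (j : ℕ) : ℕ :=
  ((strs j).filter fun ρ => decide (HF B F (σ ++ ρ))).length

theorem cntl_seg {B : Set ℕ} {F : List ℕ} {σ : List Bool} {j : ℕ} :
    cntl F (seg B (σ.length + j)) σ j = cnt B F σ j := by
  rw [cntl, cnt]
  congr 1
  refine List.filter_congr fun ρ hρ => ?_
  have := strs_len hρ
  refine decide_eq_decide.2 ?_
  refine exists_congr fun e => and_congr_right fun _ => Hl_seg ?_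
  simp [this]

theorem prim_cntl : Primrec (fun x : (List ℕ × List Bool) × (List Bool × ℕ) =>
    cntl x.1.1 x.1.2 x.2.1 x.2.2) := by
  have hR : PrimrecRel (fun (ρ : List Bool) (x : (List ℕ × List Bool) × (List Bool × ℕ)) =>
      HFl x.1.1 x.1.2 (x.2.1 ++ ρ)) := by
    refine PrimrecPred.comp prim_HFl (f := fun p : List Bool × ((List ℕ × List Bool) × (List Bool × ℕ)) =>
      (p.2.1.1, p.2.1.2, p.2.2.1 ++ p.1)) ?_
    refine (Primrec.fst.comp (Primrec.fst.comp Primrec.snd)).pair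
      ((Primrec.snd.comp (Primrec.fst.comp Primrec.snd)).pair ?_)
    exact Primrec.list_append.comp (Primrec.fst.comp (Primrec.snd.comp Primrec.snd)) Primrec.fst
  have := hR.listFilter.comp (prim_strs.comp (Primrec.snd.comp Primrec.snd))
    (Primrec.id (α := (List ℕ × List Bool) × (List Bool × ℕ)))
  exact Primrec.list_length.comp this

/-- numerator of encoded nonneg rational -/
def pn (v : ℕ) : ℕ := v.unpair.1 / 2
def qn (v : ℕ) : ℕ := v.unpair.2

theorem prim_pn : Primrec pn :=
  Primrec.nat_div.comp (Primrec.fst.comp Primrec.unpair) (Primrec.const 2)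
theorem prim_qn : Primrec qn := Primrec.snd.comp Primrec.unpair

theorem enc_rat {q : ℚ} (h : 0 ≤ q) : q = (pn (encode q) : ℚ) / (qn (encode q) : ℚ) ∧ 0 < qn (encode q) := by
  have e : encode q = Nat.pair (encode q.num) q.den := rfl
  obtain ⟨n, hn⟩ := Int.eq_ofNat_of_zero_le (Rat.num_nonneg.2 h)
  have e2 : encode q.num = 2 * n := by rw [hn]; rfl
  rw [e, pn, qn, Nat.unpair_pair, e2]
  refine ⟨?_, q.den_pos⟩
  conv_lhs => rw [← Rat.num_div_den q, hn]
  simp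

def badn (c0 v k j c : ℕ) : Prop :=
  (c0+1) * qn v * 2^j * 2^k < pn v * 2^j * 2^k + (c0+2) * c * qn v * 2^k + qn v * 2^j

theorem prim_badn (c0 : ℕ) : PrimrecPred (fun x : (ℕ × ℕ) × (ℕ × ℕ) =>
    badn c0 x.1.1 x.1.2 x.2.1 x.2.2) := by
  have p : Primrec (fun x : (ℕ × ℕ) × (ℕ × ℕ) => pn x.1.1) := prim_pn.comp (Primrec.fst.comp Primrec.fst)
  have q : Primrec (fun x : (ℕ × ℕ) × (ℕ × ℕ) => qn x.1.1) := prim_qn.comp (Primrec.fst.comp Primrec.fst)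
  have k : Primrec (fun x : (ℕ × ℕ) × (ℕ × ℕ) => 2^x.1.2) := prim_pow2.comp (Primrec.snd.comp Primrec.fst)
  have j : Primrec (fun x : (ℕ × ℕ) × (ℕ × ℕ) => 2^x.2.1) := prim_pow2.comp (Primrec.fst.comp Primrec.snd)
  have c : Primrec (fun x : (ℕ × ℕ) × (ℕ × ℕ) => x.2.2) := Primrec.snd.comp Primrec.snd
  have m := @Primrec.nat_mul
  exact Primrec.nat_lt.comp (m.comp (m.comp (m.comp (Primrec.const (c0+1)) q) j) k)
    (Primrec.nat_add.comp (Primrec.nat_add.comp (m.comp (m.comp p j) k)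
      (m.comp (m.comp (m.comp (Primrec.const (c0+2)) c) q) k)) (m.comp q j))

theorem CI_seg (B : Set ℕ) : CI (chi B) (seg B) := by
  have h : CI (chi B) (fun n => decide (n ∈ B)) := CI.chi_iff.2 RecIn.oracle
  refine CI.rec (g := fun p : ℕ × List Bool => p.2 ++ [decide (p.1 ∈ B)]) ?_ fun k => seg_succ B k
  refine CI.comp₂ (h := fun (l : List Bool) (b : Bool) => l ++ [b]) ?_
    (CI.of_prim Primrec.snd) (h.comp (CI.of_prim Primrec.fst))
  exact Primrec.list_append.comp Primrec.fst (Primrec.list_cons.comp Primrec.snd (Primrec.const []))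

theorem CI_HH (B : Set ℕ) : CI (chi B) (fun x : ℕ × List Bool => decide (HH B x.1 x.2)) := by
  have h1 := prim_Hl.decide
  refine CI.comp (CI.of_prim h1) (f := fun x : ℕ × List Bool => (x.1, seg B x.2.length, x.2)) ?_
  exact CI.pair (CI.of_prim Primrec.fst) (CI.pair ((CI_seg B).comp (CI.of_prim
    (Primrec.list_length.comp Primrec.snd))) (CI.of_prim Primrec.snd))

theorem CI_bad (B : Set ℕ) (c0 : ℕ) : CI (chi (jump B))
    (fun x : (List ℕ × List Bool) × (ℕ × ℕ) =>
      decide (∃ j, badn c0 x.2.1 x.2.2 j (cnt B x.1.1 x.1.2 j))) := by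
  have h : CI (chi B) (fun y : ((List ℕ × List Bool) × (ℕ × ℕ)) × ℕ =>
      decide (badn c0 y.1.2.1 y.1.2.2 y.2 (cnt B y.1.1.1 y.1.1.2 y.2))) := by
    have hs : Primrec (fun y : ((List ℕ × List Bool) × (ℕ × ℕ)) × ℕ => y.1.1.2) :=
      Primrec.snd.comp (Primrec.fst.comp Primrec.fst)
    have hF : Primrec (fun y : ((List ℕ × List Bool) × (ℕ × ℕ)) × ℕ => y.1.1.1) :=
      Primrec.fst.comp (Primrec.fst.comp Primrec.fst)
    have hseg : CI (chi B) (fun y : ((List ℕ × List Bool) × (ℕ × ℕ)) × ℕ => seg B (y.1.1.2.length + y.2)) :=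
      (CI_seg B).comp (CI.of_prim (Primrec.nat_add.comp (Primrec.list_length.comp hs) Primrec.snd))
    have hc : CI (chi B) (fun y : ((List ℕ × List Bool) × (ℕ × ℕ)) × ℕ => cnt B y.1.1.1 y.1.1.2 y.2) := by
      refine CI.of_eq (CI.comp (CI.of_prim prim_cntl) (CI.pair (CI.pair (CI.of_prim hF) hseg)
        (CI.pair (CI.of_prim hs) (CI.of_prim Primrec.snd)))) fun y => ?_
      exact cntl_seg
    have h0 : CI (chi B) (fun x : (ℕ × ℕ) × (ℕ × ℕ) => decide (badn c0 x.1.1 x.1.2 x.2.1 x.2.2)) :=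
      CI.of_prim (prim_badn c0).decide
    exact CI.comp h0 (f := fun y : ((List ℕ × List Bool) × (ℕ × ℕ)) × ℕ =>
      ((y.1.2.1, y.1.2.2), (y.2, cnt B y.1.1.1 y.1.1.2 y.2))) (CI.pair (CI.of_prim (Primrec.snd.comp Primrec.fst))
      (CI.pair (CI.of_prim Primrec.snd) hc))
  have h2 := CI_ex h
  simp only [decide_eq_true_eq] at h2
  exact h2
end S7

open scoped Classical
open Encodable

namespace S7

theorem HF_mono {B : Set ℕ} {F : List ℕ} {σ : List Bool} (ρ : List Bool) (h : HF B F σ) :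
    HF B F (σ ++ ρ) := by
  obtain ⟨e, he, h⟩ := h
  exact ⟨e, he, HH_mono ρ h⟩

theorem cnt_zero (B : Set ℕ) (F : List ℕ) (σ : List Bool) :
    cnt B F σ 0 = if HF B F σ then 1 else 0 := by
  simp only [cnt, strs, List.filter_cons, List.append_nil, List.filter_nil, decide_eq_true_eq]
  split_ifs <;> rfl

theorem cnt_succ (B : Set ℕ) (F : List ℕ) (σ : List Bool) (j : ℕ) :
    cnt B F σ (j+1) = cnt B F (σ ++ [false]) j + cnt B F (σ ++ [true]) j := by
  simp only [cnt, strs, List.filter_append, List.length_append, List.filter_map, List.length_map]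
  congr 3 <;> (funext ρ; simp)

theorem cnt_le (B : Set ℕ) (F : List ℕ) (σ : List Bool) (j : ℕ) : cnt B F σ j ≤ 2 ^ j := by
  rw [← strs_card j]
  exact List.length_filter_le _ _

theorem cnt_step (B : Set ℕ) (F : List ℕ) (σ : List Bool) (j : ℕ) :
    2 * cnt B F σ j ≤ cnt B F σ (j+1) := by
  induction j generalizing σ with
  | zero =>
    rw [cnt_succ, cnt_zero, cnt_zero, cnt_zero]
    by_cases h : HF B F σ
    · simp [h, HF_mono _ h]
    · simp [h]
  | succ j ih =>
    rw [cnt_succ, cnt_succ B F σ (j+1)]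
    have := ih (σ ++ [false])
    have := ih (σ ++ [true])
    omega

theorem cnt_cons (B : Set ℕ) (e : ℕ) (F : List ℕ) (σ : List Bool) (j : ℕ) :
    cnt B (e :: F) σ j ≤ cnt B F σ j + cnt B [e] σ j := by
  induction j generalizing σ with
  | zero =>
    rw [cnt_zero, cnt_zero, cnt_zero]
    have e1 : HF B (e :: F) σ ↔ HH B e σ ∨ HF B F σ := by simp [HF]
    have e2 : HF B [e] σ ↔ HH B e σ := by simp [HF]
    simp only [e1, e2]
    by_cases h : HH B e σ <;> by_cases h2 : HF B F σ <;> simp [h, h2]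
  | succ j ih =>
    rw [cnt_succ, cnt_succ B F, cnt_succ B [e]]
    have := ih (σ ++ [false])
    have := ih (σ ++ [true])
    omega

noncomputable def rr (B : Set ℕ) (F : List ℕ) (σ : List Bool) (j : ℕ) : ℝ := (cnt B F σ j : ℝ) / 2 ^ j

noncomputable def mu (B : Set ℕ) (F : List ℕ) (σ : List Bool) : ℝ := ⨆ j, rr B F σ j

variable {B : Set ℕ} {F : List ℕ} {σ : List Bool}

theorem rr_le_one (j : ℕ) : rr B F σ j ≤ 1 := by
  rw [rr, div_le_one (by positivity)]
  exact_mod_cast cnt_le B F σ j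

theorem rr_nonneg (j : ℕ) : 0 ≤ rr B F σ j := by rw [rr]; positivity

theorem rr_mono : Monotone (rr B F σ) := by
  refine monotone_nat_of_le_succ fun j => ?_
  rw [rr, rr, pow_succ, div_le_div_iff₀ (by positivity) (by positivity)]
  have : (2 * cnt B F σ j : ℝ) ≤ cnt B F σ (j+1) := by exact_mod_cast cnt_step B F σ j
  have h2 : (0:ℝ) < 2 ^ j := by positivity
  nlinarith

theorem rr_bdd : BddAbove (Set.range (rr B F σ)) := ⟨1, by rintro _ ⟨j, rfl⟩; exact rr_le_one j⟩

theorem rr_tendsto : Filter.Tendsto (rr B F σ) Filter.atTop (nhds (mu B F σ)) :=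
  tendsto_atTop_ciSup rr_mono rr_bdd

theorem rr_le_mu (j : ℕ) : rr B F σ j ≤ mu B F σ := le_ciSup rr_bdd j
theorem mu_le_one : mu B F σ ≤ 1 := ciSup_le rr_le_one
theorem mu_nonneg : 0 ≤ mu B F σ := (rr_nonneg 0).trans (rr_le_mu 0)

theorem rr_succ (j : ℕ) : 2 * rr B F σ (j+1) = rr B F (σ ++ [false]) j + rr B F (σ ++ [true]) j := by
  rw [rr, rr, rr, cnt_succ, pow_succ]
  push_cast
  field_simp

theorem mu_avg : 2 * mu B F σ = mu B F (σ ++ [false]) + mu B F (σ ++ [true]) := by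
  have h1 := ((rr_tendsto (B := B) (F := F) (σ := σ)).comp (Filter.tendsto_add_atTop_nat 1)).const_mul 2
  have h2 := (rr_tendsto (B := B) (F := F) (σ := σ ++ [false])).add
    (rr_tendsto (B := B) (F := F) (σ := σ ++ [true]))
  refine tendsto_nhds_unique h1 (h2.congr fun j => ?_)
  exact (rr_succ j).symm

theorem mu_one (h : HF B F σ) : mu B F σ = 1 := by
  refine le_antisymm mu_le_one ?_
  have := rr_le_mu (B := B) (F := F) (σ := σ) 0
  rw [rr, cnt_zero, if_pos h] at this
  simpa using this

theorem mu_cons (e : ℕ) : mu B (e :: F) σ ≤ mu B F σ + mu B [e] σ := by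
  refine ciSup_le fun j => ?_
  have h1 := rr_le_mu (B := B) (F := F) (σ := σ) j
  have h2 := rr_le_mu (B := B) (F := [e]) (σ := σ) j
  refine le_trans ?_ (add_le_add h1 h2)
  rw [rr, rr, rr, ← add_div]
  gcongr
  exact_mod_cast cnt_cons B e F σ j

theorem mu_nil : mu B [] σ = 0 := by
  refine le_antisymm (ciSup_le fun j => ?_) mu_nonneg
  have : cnt B [] σ j = 0 := by simp [cnt, HF]
  simp [rr, this]

noncomputable def NN (M : List Bool → ℚ) (c0 : ℕ) (B : Set ℕ) (F : List ℕ) (σ : List Bool) : ℝ :=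
  (M σ : ℝ) + (c0 + 2 : ℝ) * mu B F σ

noncomputable def ck (c0 k : ℕ) : ℝ := (c0 : ℝ) + 1 - 1 / 2 ^ k

variable {M : List Bool → ℚ} {c0 : ℕ}

theorem NN_avg (hM : IsMartingale M) : 2 * NN M c0 B F σ = NN M c0 B F (σ ++ [false]) + NN M c0 B F (σ ++ [true]) := by
  have h1 : (2 * (M σ : ℝ)) = M (σ ++ [false]) + M (σ ++ [true]) := by exact_mod_cast hM.2 σ
  have h2 := mu_avg (B := B) (F := F) (σ := σ)
  simp only [NN]
  linear_combination h1 + (c0 + 2 : ℝ) * h2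

theorem M_le_NN : (M σ : ℝ) ≤ NN M c0 B F σ := by
  have := mu_nonneg (B := B) (F := F) (σ := σ)
  rw [NN]
  have : 0 ≤ (c0 + 2 : ℝ) * mu B F σ := by positivity
  linarith

theorem NN_nonneg (hM : IsMartingale M) : 0 ≤ NN M c0 B F σ :=
  le_trans (by exact_mod_cast hM.1 σ) M_le_NN

theorem good_iff (hM : IsMartingale M) (k : ℕ) :
    (¬ ∃ j, badn c0 (encode (M σ)) k j (cnt B F σ j)) ↔ NN M c0 B F σ ≤ ck c0 k := by
  obtain ⟨e, hq⟩ := enc_rat (hM.1 σ)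
  set p := pn (encode (M σ)) with hp
  set q := qn (encode (M σ)) with hqd
  have e' : (M σ : ℝ) = (p : ℝ) / q := by rw [e]; push_cast; rfl
  have hq' : (0 : ℝ) < q := by exact_mod_cast hq
  have key : ∀ j, badn c0 (encode (M σ)) k j (cnt B F σ j) ↔
      ck c0 k < (M σ : ℝ) + (c0 + 2 : ℝ) * rr B F σ j := by
    intro j
    rw [badn, ← hp, ← hqd, ← Nat.cast_lt (α := ℝ)]
    push_cast
    rw [e', rr, ck]
    have h2 : (0:ℝ) < 2 ^ j := by positivity
    have h3 : (0:ℝ) < 2 ^ k := by positivity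
    have h4 : (0:ℝ) < q * 2 ^ j * 2 ^ k := by positivity
    rw [← mul_lt_mul_iff_left₀ h4 (b := (c0 : ℝ) + 1 - 1 / 2 ^ k)]
    have e1 : ((c0 : ℝ) + 1 - 1 / 2 ^ k) * (q * 2 ^ j * 2 ^ k) = (c0 + 1) * q * 2 ^ j * 2 ^ k - q * 2 ^ j := by
      field_simp
    have e2 : ((p : ℝ) / q + (c0 + 2) * ((cnt B F σ j : ℝ) / 2 ^ j)) * (q * 2 ^ j * 2 ^ k) =
        p * 2 ^ j * 2 ^ k + (c0 + 2) * cnt B F σ j * q * 2 ^ k := by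
      field_simp
    rw [e1, e2]
    constructor <;> intro h <;> linarith
  simp only [key, not_exists, not_lt]
  constructor
  · intro h
    refine le_of_tendsto' ((rr_tendsto (B := B) (F := F) (σ := σ)).const_mul (c0 + 2 : ℝ) |>.const_add (M σ : ℝ)) h
  · intro h j
    refine le_trans ?_ h
    rw [NN]
    have := rr_le_mu (B := B) (F := F) (σ := σ) j
    gcongr

theorem ex_one (hM : IsMartingale M) (c : ℝ) (n : ℕ) : ∀ σ, NN M c0 B F σ ≤ c → c < (c - NN M c0 B F σ) * 2 ^ n →
    ∃ ρ : List Bool, true ∈ ρ ∧ NN M c0 B F (σ ++ ρ) ≤ c ∧ ∀ i, (M (σ ++ ρ.take i) : ℝ) ≤ c := by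
  induction n with
  | zero =>
    intro σ _ h
    have := NN_nonneg (c0 := c0) (B := B) (F := F) (σ := σ) hM
    simp at h
    linarith
  | succ n ih =>
    intro σ hσ h
    have hav := NN_avg (c0 := c0) (B := B) (F := F) (σ := σ) hM
    by_cases h1 : NN M c0 B F (σ ++ [true]) ≤ c
    · refine ⟨[true], by simp, h1, fun i => ?_⟩
      rcases i with _ | i
      · simpa using M_le_NN.trans hσ
      · simpa using M_le_NN.trans h1
    · push Not at h1
      obtain ⟨ρ, a, b, d⟩ := ih (σ ++ [false]) (by linarith) (by
        refine h.trans_le ?_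
        rw [pow_succ]
        have : (0:ℝ) < 2 ^ n := by positivity
        nlinarith)
      refine ⟨false :: ρ, by simp [a], by simpa using b, fun i => ?_⟩
      rcases i with _ | i
      · simpa using M_le_NN.trans hσ
      · simpa using d i

theorem ex_two (hM : IsMartingale M) (c : ℝ) (e j : ℕ) : ∀ σ, 
    NN M c0 B F σ < c - (c0 + 2 : ℝ) * (mu B [e] σ - rr B [e] σ j) →
    ∃ (fl : Bool) (ρ : List Bool), (fl = true ∨ HH B e (σ ++ ρ)) ∧
      NN M c0 B (if fl then e :: F else F) (σ ++ ρ) ≤ c ∧ ∀ i, (M (σ ++ ρ.take i) : ℝ) ≤ c := by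
  have hc : (0:ℝ) < c0 + 2 := by positivity
  induction j with
  | zero =>
    intro σ h
    by_cases hh : HH B e σ
    · have hF : HF B [e] σ := ⟨e, by simp, hh⟩
      rw [mu_one hF, rr, cnt_zero, if_pos hF] at h
      simp at h
      refine ⟨false, [], Or.inr (by simpa using hh), by simpa using h.le, fun i => ?_⟩
      simpa using M_le_NN.trans h.le
    · have hF : ¬ HF B [e] σ := by simpa [HF] using hh
      rw [rr, cnt_zero, if_neg hF] at h
      simp at h
      have h1 := mu_cons (B := B) (F := F) (σ := σ) e
      have h2 : NN M c0 B (e :: F) σ ≤ c := by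
        rw [NN] at h ⊢
        nlinarith
      refine ⟨true, [], Or.inl rfl, by simpa using h2, fun i => ?_⟩
      simpa using M_le_NN.trans h2
  | succ j ih =>
    intro σ h
    have h0 : (M σ : ℝ) ≤ c := by
      refine (M_le_NN (c0 := c0) (B := B) (F := F)).trans (h.le.trans ?_)
      have := rr_le_mu (B := B) (F := [e]) (σ := σ) (j+1)
      nlinarith
    have hav := NN_avg (c0 := c0) (B := B) (F := F) (σ := σ) hM
    have hmu := mu_avg (B := B) (F := [e]) (σ := σ)
    have hr := rr_succ (B := B) (F := [e]) (σ := σ) j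
    have hh : ∃ b : Bool, NN M c0 B F (σ ++ [b]) <
        c - (c0 + 2 : ℝ) * (mu B [e] (σ ++ [b]) - rr B [e] (σ ++ [b]) j) := by
      by_contra hne
      push Not at hne
      have h1 := hne false
      have h2 := hne true
      nlinarith
    obtain ⟨b, hb⟩ := hh
    obtain ⟨fl, ρ, a1, a2, a3⟩ := ih _ hb
    refine ⟨fl, b :: ρ, by simpa using a1, by simpa using a2, fun i => ?_⟩
    rcases i with _ | i
    · simpa using h0
    · simpa using a3 i

theorem take_bd {c : ℝ} {σ ρ : List Bool} (h1 : ∀ i, (M (σ.take i) : ℝ) ≤ c)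
    (h2 : ∀ i, (M (σ ++ ρ.take i) : ℝ) ≤ c) (i : ℕ) : (M ((σ ++ ρ).take i) : ℝ) ≤ c := by
  rw [List.take_append]
  by_cases h : i ≤ σ.length
  · rw [Nat.sub_eq_zero_of_le h]
    simpa using h1 i
  · rw [List.take_of_length_le (by omega)]
    exact h2 _

theorem ck_lt (k : ℕ) : ck c0 k < ck c0 (k+1) := by
  rw [ck, ck, pow_succ]
  have : (0:ℝ) < 1 / 2 ^ k := by positivity
  have e : (1:ℝ) / (2 ^ k * 2) = (1 / 2 ^ k) / 2 := by field_simp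
  rw [e]; linarith

theorem ck_le (k : ℕ) : ck c0 k ≤ c0 + 1 := by
  rw [ck]
  have : (0:ℝ) < 1 / 2 ^ k := by positivity
  linarith

theorem ex_step (hM : IsMartingale M) (e k : ℕ) (h0 : NN M c0 B F σ ≤ ck c0 k)
    (h1 : ∀ i, (M (σ.take i) : ℝ) ≤ c0 + 1) :
    ∃ (fl : Bool) (ρ : List Bool), true ∈ ρ ∧ (fl = true ∨ HH B e (σ ++ ρ)) ∧
      NN M c0 B (if fl then e :: F else F) (σ ++ ρ) ≤ ck c0 (k+1) ∧
      ∀ i, (M ((σ ++ ρ).take i) : ℝ) ≤ c0 + 1 := by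
  have hc : (0:ℝ) < c0 + 2 := by positivity
  obtain ⟨c, hc1, hc2⟩ := exists_between (ck_lt (c0 := c0) k)
  have hl := ck_le (c0 := c0) (k+1)
  obtain ⟨n, hn⟩ := pow_unbounded_of_one_lt (c / (c - NN M c0 B F σ)) (one_lt_two)
  obtain ⟨ρ, a1, a2, a3⟩ := ex_one (B := B) (F := F) (c0 := c0) hM c n σ (by linarith) (by
    rw [div_lt_iff₀ (by linarith)] at hn
    linarith)
  have ht : Filter.Tendsto (fun j => ck c0 (k+1) - (c0 + 2 : ℝ) * (mu B [e] (σ ++ ρ) - rr B [e] (σ ++ ρ) j))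
      Filter.atTop (nhds (ck c0 (k+1) - (c0 + 2 : ℝ) * (mu B [e] (σ ++ ρ) - mu B [e] (σ ++ ρ)))) :=
    ((rr_tendsto.const_sub _).const_mul _).const_sub _
  rw [sub_self, mul_zero, sub_zero] at ht
  obtain ⟨j, hj⟩ := (ht.eventually (lt_mem_nhds hc2)).exists
  obtain ⟨fl, ρ', b1, b2, b3⟩ := ex_two (B := B) (F := F) (c0 := c0) hM (ck c0 (k+1)) e j (σ ++ ρ) (by linarith)
  refine ⟨fl, ρ ++ ρ', by simp [a1], by simpa using b1, by simpa using b2, fun i => ?_⟩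
  rw [← List.append_assoc]
  refine take_bd (fun i => take_bd h1 (fun i => ?_) i) (fun i => ?_) i
  · have := a3 i; linarith
  · have := b3 i; linarith

end S7

open scoped Classical
open Encodable

namespace S7

noncomputable def CP (O : ℕ → ℕ) {α : Type} [Primcodable α] (p : α → Prop) : Prop := CI O (fun a => decide (p a))

section
variable {α β : Type} [Primcodable α] [Primcodable β] {O : ℕ → ℕ}

theorem CP.of_prim {p : α → Prop} (h : PrimrecPred p) : CP O p := CI.of_prim h.decide

theorem CP.congr {p q : α → Prop} (h : CP O p) (e : ∀ a, p a ↔ q a) : CP O q :=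
  CI.of_eq h fun a => decide_eq_decide.2 (e a)

theorem CP.comp {p : β → Prop} (h : CP O p) {f : α → β} (hf : CI O f) : CP O (fun a => p (f a)) :=
  CI.comp (g := fun b => decide (p b)) h hf

theorem CP.and {p q : α → Prop} (hp : CP O p) (hq : CP O q) : CP O (fun a => p a ∧ q a) :=
  CI.of_eq (CI.comp₂ Primrec.and hp hq) fun a => by simp

theorem CP.or {p q : α → Prop} (hp : CP O p) (hq : CP O q) : CP O (fun a => p a ∨ q a) :=
  CI.of_eq (CI.comp₂ Primrec.or hp hq) fun a => by simp

theorem CP.not {p : α → Prop} (hp : CP O p) : CP O (fun a => ¬ p a) :=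
  CI.of_eq (CI.compP Primrec.not hp) fun a => by simp

theorem CP.find {p : α × ℕ → Prop} (hp : CP O p) [∀ a, DecidablePred fun n => p (a, n)]
    (h : ∀ a, ∃ n, p (a, n)) :
    CI O (fun a => Nat.find (h a)) := by
  refine CI.find hp _ (fun a => ?_) (fun a m hm => ?_)
  · simpa using Nat.find_spec (h a)
  · simpa using Nat.find_min (h a) hm
end

section
variable {M : List Bool → ℚ} {c0 : ℕ} {B : Set ℕ}

theorem CI_M (h : FRed M K) : CI (chi K) (fun σ => encode (M σ)) := by
  have : fnOracle (fun a => Encodable.encode (M a)) = fnOracle M := by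
    funext n
    simp only [fnOracle]
    cases h : decode (α := List Bool) n <;> simp
  unfold CI
  rw [this]
  exact h

theorem M_le_iff (hM : IsMartingale M) (σ : List Bool) :
    pn (encode (M σ)) ≤ (c0+1) * qn (encode (M σ)) ↔ (M σ : ℝ) ≤ c0 + 1 := by
  obtain ⟨e, hq⟩ := enc_rat (hM.1 σ)
  have e' : (M σ : ℝ) = (pn (encode (M σ)) : ℝ) / qn (encode (M σ)) := by
    conv_lhs => rw [e]
    push_cast; rfl
  have hq' : (0 : ℝ) < qn (encode (M σ)) := by exact_mod_cast hq
  rw [e', div_le_iff₀ hq', ← Nat.cast_le (α := ℝ)]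
  push_cast
  rfl

def PB (M : List Bool → ℚ) (c0 : ℕ) (τ : List Bool) : Prop := ∀ i, (M (τ.take i) : ℝ) ≤ c0 + 1

theorem CP_PB (hM : IsMartingale M) (h : FRed M K) : CP (chi K) (PB M c0) := by
  have h1 : CP (chi K) (fun x : List Bool × ℕ => (M (x.1.take x.2) : ℝ) ≤ c0 + 1) := by
    have hv : CI (chi K) (fun x : List Bool × ℕ => encode (M (x.1.take x.2))) :=
      (CI_M h).comp (CI.of_prim (Primrec.list_take.comp Primrec.snd Primrec.fst))
    have hp : PrimrecPred (fun v : ℕ => pn v ≤ (c0+1) * qn v) :=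
      Primrec.nat_le.comp prim_pn (Primrec.nat_mul.comp (Primrec.const _) prim_qn)
    exact ((CP.of_prim hp).comp hv).congr fun x => M_le_iff hM _
  have h2 : CP (chi K) (fun x : List Bool × ℕ => x.1.length < x.2 ∨ ¬ (M (x.1.take x.2) : ℝ) ≤ c0 + 1) :=
    CP.or (CP.of_prim (Primrec.nat_lt.comp (Primrec.list_length.comp Primrec.fst) Primrec.snd)) h1.not
  have hex : ∀ τ : List Bool, ∃ n, (τ.length < n ∨ ¬ (M (τ.take n) : ℝ) ≤ c0 + 1) :=
    fun τ => ⟨τ.length + 1, Or.inl (by omega)⟩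
  have h3 : CI (chi K) (fun τ : List Bool => Nat.find (hex τ)) := CP.find h2 hex
  have hlt : CP (chi K) (fun x : ℕ × ℕ => x.1 < x.2) := CP.of_prim (Primrec.nat_lt.comp Primrec.fst Primrec.snd)
  refine (hlt.comp ((CI.of_prim Primrec.list_length).pair h3)).congr fun τ => ?_
  show τ.length < Nat.find (hex τ) ↔ _
  constructor
  · intro hl i
    by_cases hi : i ≤ τ.length
    · have := Nat.find_min (hex τ) (m := i) (by omega)
      push Not at this
      exact this.2
    · have := Nat.find_min (hex τ) hl
      push Not at this
      rw [List.take_of_length_le (by omega)]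
      simpa using this.2
  · intro hp
    rcases Nat.find_spec (hex τ) with h | h
    · exact h
    · exact absurd (hp _) h

theorem CP_G (hM : IsMartingale M) (h : FRed M K) (hB : Low B) :
    CP (chi K) (fun x : (List ℕ × List Bool) × ℕ => NN M c0 B x.1.1 x.1.2 ≤ ck c0 x.2) := by
  have h1 : CP (chi K) (fun x : (List ℕ × List Bool) × (ℕ × ℕ) =>
      ∃ j, badn c0 x.2.1 x.2.2 j (cnt B x.1.1 x.1.2 j)) := CI.trans hB (CI_bad B c0)
  have hf : CI (chi K) (fun x : (List ℕ × List Bool) × ℕ => (x.1, (encode (M x.1.2), x.2))) :=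
    (CI.of_prim Primrec.fst).pair (((CI_M h).comp (CI.of_prim (Primrec.snd.comp Primrec.fst))).pair
      (CI.of_prim Primrec.snd))
  exact (h1.not.comp hf).congr fun x => good_iff hM x.2

def upd (k : ℕ) (s : List ℕ × List Bool) (x : Bool × List Bool) : List ℕ × List Bool :=
  (if x.1 then k :: s.1 else s.1, s.2 ++ x.2)

theorem prim_upd : Primrec (fun y : (ℕ × (List ℕ × List Bool)) × (Bool × List Bool) => upd y.1.1 y.1.2 y.2) := by
  have hs : Primrec (fun y : (ℕ × (List ℕ × List Bool)) × (Bool × List Bool) => y.1.2) :=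
    Primrec.snd.comp Primrec.fst
  refine Primrec.pair (Primrec.ite (Primrec.eq.comp (Primrec.fst.comp Primrec.snd) (Primrec.const true))
    (Primrec.list_cons.comp (Primrec.fst.comp Primrec.fst) (Primrec.fst.comp hs)) (Primrec.fst.comp hs)) ?_
  exact Primrec.list_append.comp (Primrec.snd.comp hs) (Primrec.snd.comp Primrec.snd)

def Inv (M : List Bool → ℚ) (c0 : ℕ) (B : Set ℕ) (k : ℕ) (s : List ℕ × List Bool) : Prop :=
  NN M c0 B s.1 s.2 ≤ ck c0 k ∧ PB M c0 s.2

def TT (M : List Bool → ℚ) (c0 : ℕ) (B : Set ℕ) (k : ℕ) (s : List ℕ × List Bool) (x : Bool × List Bool) : Prop :=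
  (true ∈ x.2 ∧ (x.1 = true ∨ HH B k (upd k s x).2)) ∧ Inv M c0 B (k+1) (upd k s x)

theorem CP_Inv (hM : IsMartingale M) (h : FRed M K) (hB : Low B) :
    CP (chi K) (fun y : ℕ × (List ℕ × List Bool) => Inv M c0 B y.1 y.2) :=
  ((CP_G hM h hB).comp (CI.of_prim (Primrec.snd.pair Primrec.fst))).and
    ((CP_PB hM h).comp (CI.of_prim (Primrec.snd.comp Primrec.snd)))

theorem CP_TT (hM : IsMartingale M) (h : FRed M K) (hB : Low B) :
    CP (chi K) (fun y : (ℕ × (List ℕ × List Bool)) × (Bool × List Bool) => TT M c0 B y.1.1 y.1.2 y.2) := by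
  have hk : Primrec (fun y : (ℕ × (List ℕ × List Bool)) × (Bool × List Bool) => y.1.1) :=
    Primrec.fst.comp Primrec.fst
  have hHH : CP (chi K) (fun x : ℕ × List Bool => HH B x.1 x.2) :=
    CI.trans hB (CI.trans (RI_jump B) (CI_HH B))
  have h1 : PrimrecPred (fun y : (ℕ × (List ℕ × List Bool)) × (Bool × List Bool) => true ∈ y.2.2) := by
    have hR : PrimrecRel (fun (a : Bool) (_ : Unit) => a = true) :=
      Primrec.eq.comp Primrec.fst (Primrec.const true)
    refine (hR.exists_mem_list.comp (Primrec.snd.comp Primrec.snd) (Primrec.const ())).of_eq fun y => ?_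
    simp
  have h2 : PrimrecPred (fun y : (ℕ × (List ℕ × List Bool)) × (Bool × List Bool) => y.2.1 = true) :=
    Primrec.eq.comp (Primrec.fst.comp Primrec.snd) (Primrec.const true)
  exact ((CP.of_prim h1).and ((CP.of_prim h2).or (hHH.comp (CI.of_prim (hk.pair (Primrec.snd.comp prim_upd)))))).and
    ((CP_Inv hM h hB).comp (CI.of_prim ((Primrec.succ.comp hk).pair prim_upd)))

theorem ex_TT (hM : IsMartingale M) (k : ℕ) (s : List ℕ × List Bool) (hs : Inv M c0 B k s) :
    ∃ x, TT M c0 B k s x := by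
  obtain ⟨fl, ρ, a1, a2, a3, a4⟩ := ex_step hM k k hs.1 hs.2
  exact ⟨(fl, ρ), ⟨a1, a2⟩, a3, a4⟩

theorem ex_srch (hM : IsMartingale M) (c0 : ℕ) (B : Set ℕ) (a : ℕ × (List ℕ × List Bool)) :
    ∃ n : ℕ, ¬ Inv M c0 B a.1 a.2 ∨ TT M c0 B a.1 a.2 ((decode (α := Bool × List Bool) n).getD (false, [])) := by
  by_cases h : Inv M c0 B a.1 a.2
  · obtain ⟨x, hx⟩ := ex_TT hM _ _ h
    exact ⟨encode x, Or.inr (by simpa using hx)⟩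
  · exact ⟨0, Or.inl h⟩

noncomputable def stp (hM : IsMartingale M) (c0 : ℕ) (B : Set ℕ) (a : ℕ × (List ℕ × List Bool)) : List ℕ × List Bool :=
  upd a.1 a.2 ((decode (α := Bool × List Bool) (Nat.find (ex_srch hM c0 B a))).getD (false, []))

theorem CI_stp (hM : IsMartingale M) (h : FRed M K) (hB : Low B) : CI (chi K) (stp hM c0 B) := by
  have hd : Primrec (fun n : ℕ => (decode (α := Bool × List Bool) n).getD (false, [])) :=
    Primrec.option_getD.comp Primrec.decode (Primrec.const _)
  have h1 : CP (chi K) (fun y : (ℕ × (List ℕ × List Bool)) × ℕ => ¬ Inv M c0 B y.1.1 y.1.2 ∨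
      TT M c0 B y.1.1 y.1.2 ((decode (α := Bool × List Bool) y.2).getD (false, []))) :=
    ((CP_Inv hM h hB).not.comp (CI.of_prim Primrec.fst)).or
      ((CP_TT hM h hB).comp (CI.of_prim (Primrec.fst.pair (hd.comp Primrec.snd))))
  have h2 := CP.find h1 (ex_srch hM c0 B)
  exact CI.comp (CI.of_prim prim_upd) (f := fun a => (a, 
    (decode (α := Bool × List Bool) (Nat.find (ex_srch hM c0 B a))).getD (false, [])))
    ((CI.of_prim Primrec.id).pair (CI.compP hd h2))

noncomputable def sts (hM : IsMartingale M) (c0 : ℕ) (B : Set ℕ) : ℕ → List ℕ × List Bool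
  | 0 => ([], [])
  | k + 1 => stp hM c0 B (k, sts hM c0 B k)

theorem CI_sts (hM : IsMartingale M) (h : FRed M K) (hB : Low B) : CI (chi K) (sts hM c0 B) :=
  CI.rec (CI_stp hM h hB) fun _ => rfl

theorem stp_spec (hM : IsMartingale M) {k : ℕ} {s : List ℕ × List Bool} (hs : Inv M c0 B k s) :
    ∃ x, TT M c0 B k s x ∧ stp hM c0 B (k, s) = upd k s x := by
  refine ⟨_, ?_, rfl⟩
  exact (Nat.find_spec (ex_srch hM c0 B (k, s))).resolve_left (not_not.2 hs)

theorem sts_inv (hM : IsMartingale M) (hc : M [] ≤ c0) (k : ℕ) : Inv M c0 B k (sts hM c0 B k) := by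
  have hc' : (M [] : ℝ) ≤ c0 := by exact_mod_cast hc
  induction k with
  | zero =>
    refine ⟨?_, fun i => ?_⟩
    · simp only [sts, NN, ck, mu_nil]
      simpa using hc'
    · simp only [sts, List.take_nil]
      linarith
  | succ k ih =>
    obtain ⟨x, hx, he⟩ := stp_spec hM ih
    rw [sts, he]
    exact hx.2

theorem sts_step (hM : IsMartingale M) (hc : M [] ≤ c0) (k : ℕ) :
    ∃ x, TT M c0 B k (sts hM c0 B k) x ∧ sts hM c0 B (k+1) = upd k (sts hM c0 B k) x :=
  stp_spec hM (sts_inv hM hc k)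

theorem core (hM : IsMartingale M) (h : FRed M K) (hB : Low B) :
    ∃ A : Set ℕ, A.Infinite ∧ ¬ Succeeds M A ∧ Low (join B A) ∧ TRed A K := by
  obtain ⟨c0, hc⟩ := exists_nat_ge (M [])
  set s := sts hM c0 B with hs
  have hstep : ∀ k, ∃ x, TT M c0 B k (s k) x ∧ s (k+1) = upd k (s k) x := sts_step hM hc
  have hinv : ∀ k, Inv M c0 B k (s k) := sts_inv hM hc
  have hpre1 : ∀ k, (s k).2 <+: (s (k+1)).2 := by
    intro k
    obtain ⟨x, -, e⟩ := hstep k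
    rw [e]; exact ⟨_, rfl⟩
  have hpre : ∀ k l, k ≤ l → (s k).2 <+: (s l).2 := by
    intro k l hkl
    induction l, hkl using Nat.le_induction with
    | base => exact List.prefix_rfl
    | succ l _ ih => exact ih.trans (hpre1 l)
  have hlen : ∀ k, k ≤ (s k).2.length := by
    intro k
    induction k with
    | zero => simp
    | succ k ih =>
      obtain ⟨x, hx, e⟩ := hstep k
      have := List.length_pos_of_mem hx.1.1
      rw [e]
      simp only [upd, List.length_append]
      omega
  let A : Set ℕ := {n | (s (n+1)).2[n]? = some true}
  have hA : ∀ k n b, (s k).2[n]? = some b → (n ∈ A ↔ b = true) := by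
    intro k n b hb
    have h1 : (s (n+1)).2[n]? = some b := by
      have hl := hlen (n+1)
      rcases le_total k (n+1) with hk | hk
      · exact by
          obtain ⟨t, ht⟩ := hpre _ _ hk
          rw [← ht, List.getElem?_append_left (List.getElem?_eq_some_iff.1 hb).1]
          exact hb
      · obtain ⟨t, ht⟩ := hpre _ _ hk
        rw [← ht, List.getElem?_append_left (by omega)] at hb
        exact hb
    show ((s (n+1)).2[n]? = some true) ↔ b = true
    rw [h1]; cases b <;> simp
  have hseg : ∀ k, (s k).2 = seg A (s k).2.length := by
    intro k
    apply List.ext_getElem?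
    intro i
    rw [seg_get]
    split_ifs with hi
    · have := hA k i _ (List.getElem?_eq_getElem hi)
      rw [List.getElem?_eq_getElem hi]
      simp [this]
    · exact List.getElem?_eq_none (by omega)
  have hF1 : ∀ k e, e ∈ (s k).1 → e < k ∧ e ∈ (s (k+1)).1 := by
    intro k
    have hm : ∀ k e, e ∈ (s k).1 → e ∈ (s (k+1)).1 := by
      intro k e he
      obtain ⟨x, hx, e'⟩ := hstep k
      rw [e']; simp only [upd]; split_ifs <;> simp [he]
    induction k with
    | zero => intro e he; simp [hs, sts] at he
    | succ k ih =>
      intro e he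
      refine ⟨?_, hm _ _ he⟩
      obtain ⟨x, hx, e'⟩ := hstep k
      rw [e'] at he; simp only [upd] at he
      split_ifs at he
      · rcases List.mem_cons.1 he with rfl | he
        · omega
        · have := ih _ he; omega
      · have := ih _ he; omega
  have hF : ∀ k l e, k ≤ l → e ∈ (s k).1 → e ∈ (s l).1 := by
    intro k l e hkl he
    induction l, hkl using Nat.le_induction with
    | base => exact he
    | succ l _ ih => exact (hF1 _ _ ih).2
  have hjump : ∀ e, e ∈ jump (join B A) ↔ e ∉ (s (e+1)).1 := by
    intro e
    rw [HH_jump]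
    constructor
    · rintro ⟨n, hn⟩ he
      let k := max n (e+1)
      have hk : HF B (s k).1 (s k).2 := by
        refine ⟨e, hF _ _ _ (le_max_right _ _) he, ?_⟩
        have hnl : n ≤ (s k).2.length := (le_max_left _ _).trans (hlen k)
        have e1 : seg A n = (s k).2.take n := by
          rw [hseg k, seg_take A hnl]
        have := HH_mono ((s k).2.drop n) hn
        rwa [e1, List.take_append_drop] at this
      have h1 := (hinv k).1
      have h2 := ck_le (c0 := c0) k
      have h3 : (0:ℝ) ≤ M (s k).2 := by exact_mod_cast hM.1 _
      rw [NN, mu_one hk] at h1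
      linarith
    · intro he
      obtain ⟨x, hx, e'⟩ := hstep e
      refine ⟨(s (e+1)).2.length, ?_⟩
      rw [← hseg]
      rw [e'] at he ⊢
      rcases hx.1.2 with h | h
      · simp [upd, h] at he
      · exact h
  have hCs : CI (chi K) s := CI_sts hM h hB
  refine ⟨A, ?_, ?_, ?_, ?_⟩
  · rw [Set.infinite_iff_exists_gt]
    intro k
    obtain ⟨x, hx, e⟩ := hstep (k+1)
    obtain ⟨i, hi, hi'⟩ := List.getElem_of_mem hx.1.1
    have hl := hlen (k+1)
    refine ⟨(s (k+1)).2.length + i, ?_, by omega⟩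
    have := hA (k+1+1) ((s (k+1)).2.length + i) true (by
      rw [e]
      simp only [upd]
      rw [List.getElem?_append_right (by omega)]
      simp [hi, hi'])
    exact this.2 rfl
  · intro hS
    obtain ⟨n, hn⟩ := hS (c0 + 1)
    have h1 := (hinv n).2 n
    rw [hseg n, seg_take A (hlen n)] at h1
    have h2 : ((c0 : ℝ) + 1) < M (seg A n) := by exact_mod_cast hn
    linarith
  · have h1 : PrimrecPred (fun y : ℕ × (List ℕ × List Bool) => y.1 ∉ y.2.1) := by
      have hR : PrimrecRel (fun (a : ℕ) (b : ℕ) => a = b) := Primrec.eq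
      refine ((hR.exists_mem_list.comp (Primrec.fst.comp Primrec.snd) Primrec.fst).not).of_eq fun y => ?_
      simp
    have h2 : CP (chi K) (fun e : ℕ => e ∉ (s (e+1)).1) :=
      (CP.of_prim h1).comp ((CI.of_prim Primrec.id).pair (hCs.comp (CI.of_prim Primrec.succ)))
    exact CI.chi_iff.1 (h2.congr fun e => (hjump e).symm)
  · have h1 : PrimrecPred (fun y : ℕ × (List ℕ × List Bool) => y.2.2[y.1]? = some true) :=
      Primrec.eq.comp (Primrec.list_getElem?.comp (Primrec.snd.comp Primrec.snd) Primrec.fst) (Primrec.const _)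
    have h2 : CP (chi K) (fun n : ℕ => n ∈ A) :=
      (CP.of_prim h1).comp ((CI.of_prim Primrec.id).pair (hCs.comp (CI.of_prim Primrec.succ)))
    exact CI.chi_iff.1 h2
end

theorem core' (M : List Bool → ℚ) (B : Set ℕ) : ∃ A : Set ℕ, (Low B → Low (join B A) ∧ TRed A K) ∧
    (Low B → IsMartingale M → FRed M K → A.Infinite ∧ ¬ Succeeds M A) := by
  by_cases hB : Low B
  · by_cases h : IsMartingale M ∧ FRed M K
    · obtain ⟨A, a, b, c, d⟩ := core h.1 h.2 hB
      exact ⟨A, fun _ => ⟨c, d⟩, fun _ _ _ => ⟨a, b⟩⟩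
    · have h0 : IsMartingale (fun _ => (0:ℚ)) := ⟨fun _ => le_rfl, fun _ => by norm_num⟩
      have h1 : FRed (fun _ : List Bool => (0:ℚ)) K := by
        have : CI (chi K) (fun _ : List Bool => encode (0:ℚ)) := CI.of_prim (Primrec.const _)
        have e : fnOracle (fun _ : List Bool => encode (0:ℚ)) = fnOracle (fun _ : List Bool => (0:ℚ)) := by
          funext n
          simp only [fnOracle]
          cases h : decode (α := List Bool) n <;> simp
        unfold CI at this
        rw [e] at this
        exact this
      obtain ⟨A, a, b, c, d⟩ := core h0 h1 hB
      exact ⟨A, fun _ => ⟨c, d⟩, fun _ h2 h3 => absurd ⟨h2, h3⟩ h⟩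
  · exact ⟨∅, fun h => absurd h hB, fun h => absurd h hB⟩

noncomputable def Lj (Ms : ℕ → List Bool → ℚ) : ℕ → Set ℕ × Set ℕ
  | 0 => (∅, ∅)
  | e + 1 => ((core' (Ms e) (Lj Ms e).2).choose, join (Lj Ms e).2 (core' (Ms e) (Lj Ms e).2).choose)

theorem Lj_join (Ms : ℕ → List Bool → ℚ) (e : ℕ) : joinUpTo (fun e => (Lj Ms e).1) e = (Lj Ms e).2 := by
  induction e with
  | zero => rfl
  | succ e ih => rw [joinUpTo, ih]; rfl

theorem low_empty : Low ∅ := RecIn.oracle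

theorem Lj_low (Ms : ℕ → List Bool → ℚ) (e : ℕ) : Low (Lj Ms e).2 := by
  induction e with
  | zero => exact low_empty
  | succ e ih => exact ((core' (Ms e) (Lj Ms e).2).choose_spec.1 ih).1

theorem Lj_red (Ms : ℕ → List Bool → ℚ) (e : ℕ) : TRed (Lj Ms e).1 K := by
  cases e with
  | zero => exact RI_jump ∅
  | succ e => exact ((core' (Ms e) (Lj Ms e).2).choose_spec.1 (Lj_low Ms e)).2

end S7

/-- a sequence of sets whose finite joins are low, all computable in some
`D ≤_T ∅''`, forming a class that is not `Δ⁰₂` null. -/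
theorem stmt7 :
    ∃ (L : ℕ → Set ℕ) (D : Set ℕ), TRed D (jump K) ∧
      (∀ e, Low (joinUpTo L e)) ∧
      (∀ e, TRed (L e) D) ∧
      ∀ M : List Bool → ℚ, IsMartingale M → FRed M K →
        ∃ e, ¬ Succeeds M (L e) ∧ (L e).Infinite := by
  obtain ⟨Ms, hMs⟩ := S7.countable_mart
  refine ⟨fun e => (S7.Lj Ms e).1, K, S7.RI_jump K, fun e => ?_, S7.Lj_red Ms, fun M hM h => ?_⟩
  · rw [S7.Lj_join]
    exact S7.Lj_low Ms e
  · obtain ⟨e, he⟩ := hMs M h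
    refine ⟨e + 1, ?_⟩
    rw [he] at hM h ⊢
    have := (S7.core' (Ms e) (S7.Lj Ms e).2).choose_spec.2 (S7.Lj_low Ms e) hM h
    exact ⟨this.2, this.1⟩
end

section
/- There is no Δ⁰₂ set A such that for every Δ⁰₂ set B, every infinite subset or cosubset of A computes an infinite subset or cosubset of B. That is, the structure of mass problems H(A) for Δ⁰₂ sets A, ordered by Muchnik reducibility, has no largest element. -/
/-!
Preamble: oracle computability, Turing reducibility, the jump, martingales,
and Martin-Löf randomness, developed from scratch.
-/

open scoped Classical

namespace NL
open Filter

attribute [fun_prop] Primrec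
attribute [fun_prop] Primrec.id Primrec.const

section prim
variable {α β γ δ σ : Type} [Primcodable α] [Primcodable β] [Primcodable γ] [Primcodable δ]
  [Primcodable σ]

@[fun_prop] theorem P_id : Primrec (fun a : α => a) := Primrec.id
@[fun_prop] theorem P_comp {f : β → σ} {g : α → β} (hf : Primrec f) (hg : Primrec g) :
    Primrec fun a => f (g a) := hf.comp hg
@[fun_prop] theorem P_fst {f : α → β × γ} (hf : Primrec f) : Primrec fun a => (f a).1 :=
  Primrec.fst.comp hf
@[fun_prop] theorem P_snd {f : α → β × γ} (hf : Primrec f) : Primrec fun a => (f a).2 :=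
  Primrec.snd.comp hf
@[fun_prop] theorem P_pair {f : α → β} {g : α → γ} (hf : Primrec f) (hg : Primrec g) :
    Primrec fun a => (f a, g a) := hf.pair hg
@[fun_prop] theorem P_unpair {f : α → ℕ} (hf : Primrec f) : Primrec fun a => (f a).unpair :=
  Primrec.unpair.comp hf
@[fun_prop] theorem P_natPair {f g : α → ℕ} (hf : Primrec f) (hg : Primrec g) :
    Primrec fun a => Nat.pair (f a) (g a) := Primrec₂.natPair.comp hf hg
@[fun_prop] theorem P_add {f g : α → ℕ} (hf : Primrec f) (hg : Primrec g) :
    Primrec fun a => f a + g a := Primrec.nat_add.comp hf hg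
@[fun_prop] theorem P_sub {f g : α → ℕ} (hf : Primrec f) (hg : Primrec g) :
    Primrec fun a => f a - g a := Primrec.nat_sub.comp hf hg
@[fun_prop] theorem P_mul {f g : α → ℕ} (hf : Primrec f) (hg : Primrec g) :
    Primrec fun a => f a * g a := Primrec.nat_mul.comp hf hg
@[fun_prop] theorem P_natrec {f : α → ℕ} {g : α → β} {h : α → ℕ → β → β} (hf : Primrec f)
    (hg : Primrec g) (hh : Primrec fun p : α × ℕ × β => h p.1 p.2.1 p.2.2) :
    Primrec fun a => (Nat.rec (g a) (h a) (f a) : β) :=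
  Primrec.nat_rec' (h := fun a q => h a q.1 q.2) hf hg hh
@[fun_prop] theorem P_map {f : α → List β} {g : α → β → γ} (hf : Primrec f)
    (hg : Primrec fun p : α × β => g p.1 p.2) : Primrec fun a => (f a).map (g a) :=
  Primrec.list_map hf hg
@[fun_prop] theorem P_append {f g : α → List β} (hf : Primrec f) (hg : Primrec g) :
    Primrec fun a => f a ++ g a := Primrec.list_append.comp hf hg
@[fun_prop] theorem P_cons {f : α → β} {g : α → List β} (hf : Primrec f) (hg : Primrec g) :
    Primrec fun a => f a :: g a := Primrec.list_cons.comp hf hg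
@[fun_prop] theorem P_range {f : α → ℕ} (hf : Primrec f) : Primrec fun a => List.range (f a) :=
  Primrec.list_range.comp hf
@[fun_prop] theorem P_length {f : α → List β} (hf : Primrec f) : Primrec fun a => (f a).length :=
  Primrec.list_length.comp hf
@[fun_prop] theorem P_get {f : α → List β} {g : α → ℕ} (hf : Primrec f) (hg : Primrec g) :
    Primrec fun a => (f a)[g a]? := Primrec.list_getElem?.comp hf hg
@[fun_prop] theorem P_findIdx {f : α → List β} {p : α → β → Bool} (hf : Primrec f)
    (hg : Primrec fun q : α × β => p q.1 q.2) : Primrec fun a => (f a).findIdx (p a) :=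
  Primrec.list_findIdx hf hg
@[fun_prop] theorem P_some {f : α → β} (hf : Primrec f) : Primrec fun a => some (f a) :=
  Primrec.option_some.comp hf
@[fun_prop] theorem P_isSome {f : α → Option β} (hf : Primrec f) : Primrec fun a => (f a).isSome :=
  Primrec.option_isSome.comp hf
@[fun_prop] theorem P_bind {f : α → Option β} {g : α → β → Option γ} (hf : Primrec f)
    (hg : Primrec fun p : α × β => g p.1 p.2) : Primrec fun a => (f a).bind (g a) :=
  Primrec.option_bind hf hg
@[fun_prop] theorem P_omap {f : α → Option β} {g : α → β → γ} (hf : Primrec f)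
    (hg : Primrec fun p : α × β => g p.1 p.2) : Primrec fun a => (f a).map (g a) :=
  Primrec.option_map hf hg
@[fun_prop] theorem P_getD {f : α → Option β} {g : α → β} (hf : Primrec f) (hg : Primrec g) :
    Primrec fun a => (f a).getD (g a) := Primrec.option_getD.comp hf hg
@[fun_prop] theorem P_and {f g : α → Bool} (hf : Primrec f) (hg : Primrec g) :
    Primrec fun a => f a && g a := Primrec.and.comp hf hg
@[fun_prop] theorem P_or {f g : α → Bool} (hf : Primrec f) (hg : Primrec g) :
    Primrec fun a => f a || g a := Primrec.or.comp hf hg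
@[fun_prop] theorem P_not {f : α → Bool} (hf : Primrec f) : Primrec fun a => !(f a) :=
  Primrec.not.comp hf
@[fun_prop] theorem P_cond {c : α → Bool} {f g : α → β} (hc : Primrec c) (hf : Primrec f)
    (hg : Primrec g) : Primrec fun a => bif c a then f a else g a := Primrec.cond hc hf hg
@[fun_prop] theorem P_le {f g : α → ℕ} (hf : Primrec f) (hg : Primrec g) :
    Primrec fun a => Nat.ble (f a) (g a) := by
  have : PrimrecPred fun a => f a ≤ g a := Primrec.nat_le.comp hf hg
  refine this.decide.of_eq fun a => ?_
  rw [Bool.eq_iff_iff]; simp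
@[fun_prop] theorem P_beq [BEq β] [LawfulBEq β] {f g : α → β} (hf : Primrec f) (hg : Primrec g) :
    Primrec fun a => (f a == g a) := by
  have : PrimrecPred fun a => f a = g a := Primrec.eq.comp hf hg
  refine this.decide.of_eq fun a => ?_
  rw [Bool.eq_iff_iff]; simp
@[fun_prop] theorem P_all {f : α → List β} {p : α → β → Bool} (hf : Primrec f)
    (hg : Primrec fun q : α × β => p q.1 q.2) : Primrec fun a => (f a).all (p a) := by
  refine (Primrec.list_foldr (h := fun a q => p a q.1 && q.2) hf (Primrec.const true)
    (Primrec₂.mk ?_)).of_eq fun a => ?_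
  · fun_prop
  · dsimp only
    induction f a with
    | nil => rfl
    | cons b l ih => simp [ih]
@[fun_prop] theorem P_any {f : α → List β} {p : α → β → Bool} (hf : Primrec f)
    (hg : Primrec fun q : α × β => p q.1 q.2) : Primrec fun a => (f a).any (p a) := by
  have : Primrec fun a => !((f a).all fun x => !(p a x)) := by fun_prop
  refine this.of_eq fun a => ?_
  rw [Bool.eq_iff_iff]; simp
@[fun_prop] theorem P_encode {f : α → β} (hf : Primrec f) :
    Primrec fun a => Encodable.encode (f a) := Primrec.encode.comp hf
@[fun_prop] theorem P_decode {f : α → ℕ} (hf : Primrec f) :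
    Primrec fun a => (Encodable.decode (f a) : Option β) := Primrec.decode.comp hf
@[fun_prop] theorem P_ofNat {δ : Type} [Denumerable δ] {f : α → ℕ} (hf : Primrec f) :
    Primrec fun a => Denumerable.ofNat δ (f a) := (Primrec.ofNat δ).comp hf
open Nat.Partrec (Code) in
@[fun_prop] theorem P_evaln {f g : α → ℕ} {c : α → Code} (hf : Primrec f) (hc : Primrec c)
    (hg : Primrec g) : Primrec fun a => Code.evaln (f a) (c a) (g a) :=
  Code.primrec_evaln.comp ((hf.pair hc).pair hg)
@[fun_prop] theorem P_casesOn {f : α → ℕ} {g : α → β} {h : α → ℕ → β} (hf : Primrec f)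
    (hg : Primrec g) (hh : Primrec fun p : α × ℕ => h p.1 p.2) :
    Primrec fun a => (Nat.casesOn (f a) (g a) (h a) : β) := Primrec.nat_casesOn hf hg hh
@[fun_prop] theorem P_bodd {f : α → ℕ} (hf : Primrec f) : Primrec fun a => (f a).bodd :=
  Primrec.nat_bodd.comp hf
@[fun_prop] theorem P_div2 {f : α → ℕ} (hf : Primrec f) : Primrec fun a => (f a).div2 :=
  Primrec.nat_div2.comp hf

/-- limit computable functions -/
def LC (f : α → β) : Prop :=
  ∃ g : α → ℕ → β, (Primrec fun p : α × ℕ => g p.1 p.2) ∧ ∀ a, ∀ᶠ s in atTop, g a s = f a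

theorem LC.of_primrec {f : α → β} (hf : Primrec f) : LC f :=
  ⟨fun a _ => f a, by fun_prop, fun a => Eventually.of_forall fun _ => rfl⟩

theorem LC.comp {f : β → γ} {g : α → β} (hf : LC f) (hg : LC g) : LC fun a => f (g a) := by
  obtain ⟨F, hF, hF'⟩ := hf
  obtain ⟨G, hG, hG'⟩ := hg
  refine ⟨fun a s => F (G a s) s, hF.comp (f := fun p : β × ℕ => F p.1 p.2)
    (g := fun p : α × ℕ => (G p.1 p.2, p.2)) (by fun_prop), fun a => ?_⟩
  filter_upwards [hG' a, hF' (g a)] with s h1 h2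
  rw [h1, h2]

theorem LC.pair {f : α → β} {g : α → γ} (hf : LC f) (hg : LC g) : LC fun a => (f a, g a) := by
  obtain ⟨F, hF, hF'⟩ := hf
  obtain ⟨G, hG, hG'⟩ := hg
  refine ⟨fun a s => (F a s, G a s), by fun_prop, fun a => ?_⟩
  filter_upwards [hG' a, hF' a] with s h1 h2
  rw [h1, h2]

theorem LC.natrec {f : α → β} {h : α × ℕ × β → β} (hf : LC f) (hh : LC h) :
    LC fun a : α × ℕ => (Nat.rec (f a.1) (fun n b => h (a.1, n, b)) a.2 : β) := by
  obtain ⟨F, hF, hF'⟩ := hf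
  obtain ⟨H, hH, hH'⟩ := hh
  refine ⟨fun a s => (Nat.rec (F a.1 s) (fun n b => H (a.1, n, b) s) a.2 : β), ?_, ?_⟩
  · have : Primrec fun q : ((α × ℕ) × ℕ) × ℕ × β => H (q.1.1.1, q.2.1, q.2.2) q.1.2 :=
      hH.comp (f := fun p : (α × ℕ × β) × ℕ => H p.1 p.2)
        (g := fun q : ((α × ℕ) × ℕ) × ℕ × β => ((q.1.1.1, q.2.1, q.2.2), q.1.2)) (by fun_prop)
    have h2 : Primrec fun q : (α × ℕ) × ℕ => F q.1.1 q.2 :=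
      hF.comp (f := fun p : α × ℕ => F p.1 p.2)
        (g := fun q : (α × ℕ) × ℕ => (q.1.1, q.2)) (by fun_prop)
    exact P_natrec (f := fun q : (α × ℕ) × ℕ => q.1.2) (by fun_prop) h2 this
  · rintro ⟨a, n⟩
    induction n with
    | zero => exact hF' a
    | succ n ih =>
      filter_upwards [ih, hH' (a, n, (Nat.rec (f a) (fun n b => h (a, n, b)) n : β))] with s h1 h2
      rw [← h2]; exact congrArg (fun z => H (a, n, z) s) h1

theorem LC.all {p : α × ℕ → Bool} (hp : LC p) :
    LC fun a : α × ℕ => (List.range a.2).all fun x => p (a.1, x) := by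
  have := LC.natrec (f := fun _ : α => true) (h := fun q : α × ℕ × Bool => p (q.1, q.2.1) && q.2.2)
    (LC.of_primrec (by fun_prop))
    (LC.comp (f := fun q : Bool × Bool => q.1 && q.2) (LC.of_primrec (by fun_prop))
      (LC.pair (LC.comp hp (LC.of_primrec (by fun_prop))) (LC.of_primrec (by fun_prop))))
  convert this using 1
  funext ⟨a, n⟩
  induction n with
  | zero => rfl
  | succ n ih =>
    simp only [List.range_succ, List.all_append] at ih ⊢
    rw [ih, Bool.and_comm]; simp

theorem LC.choose {p : α × ℕ → Bool} (hp : LC p) (h : ∀ a, ∃ n, p (a, n) = true) :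
    ∃ f : α → ℕ, LC f ∧ ∀ a, p (a, f a) = true := by
  obtain ⟨P, hP, hP'⟩ := hp
  refine ⟨fun a => Nat.find (h a), ⟨fun a s => (List.range s).findIdx fun n => P (a, n) s,
    ?_, fun a => ?_⟩, fun a => Nat.find_spec (h a)⟩
  · have : Primrec fun q : (α × ℕ) × ℕ => P (q.1.1, q.2) q.1.2 :=
      hP.comp (f := fun p : (α × ℕ) × ℕ => P p.1 p.2)
        (g := fun q : (α × ℕ) × ℕ => ((q.1.1, q.2), q.1.2)) (by fun_prop)
    fun_prop
  · have h1 : ∀ᶠ s in atTop, ∀ n ∈ Finset.range (Nat.find (h a) + 1), P (a, n) s = p (a, n) := by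
      rw [Filter.eventually_all_finset]
      intro n _
      exact hP' (a, n)
    filter_upwards [h1, eventually_gt_atTop (Nat.find (h a))] with s h2 h3
    rw [List.findIdx_eq (by simpa using h3)]
    constructor
    · simp only [List.getElem_range]
      rw [h2 _ (by simp)]
      exact Nat.find_spec (h a)
    · intro j hj
      simp only [List.getElem_range]
      rw [h2 j (by rw [Finset.mem_range]; omega)]
      simpa using Nat.find_min (h a) hj

end prim
open Nat.Partrec (Code)

/-! ### translation of codes -/

def trO : OCode → Code
  | .zero => .zero
  | .succ => .succ
  | .left => .left
  | .right => .right
  | .oracle => .zero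
  | .pair a b => .pair (trO a) (trO b)
  | .comp a b => .comp (trO a) (trO b)
  | .prec a b => .prec (trO a) (trO b)
  | .rfind' a => .rfind' (trO a)

theorem eval_trO (c : OCode) : Code.eval (trO c) = evalo (chi ∅) c := by
  induction c with
  | zero => rfl
  | succ => rfl
  | left => rfl
  | right => rfl
  | oracle => funext n; simp [trO, evalo, Code.eval, chi]; rfl
  | pair a b iha ihb => simp [trO, evalo, Code.eval, iha, ihb]; rfl
  | comp a b iha ihb => simp [trO, evalo, Code.eval, iha, ihb]; rfl
  | prec a b iha ihb => simp [trO, evalo, Code.eval, iha, ihb]; rfl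
  | rfind' a iha => simp [trO, evalo, Code.eval, iha]; rfl

@[fun_prop] theorem P_cpair {α : Type} [Primcodable α] {f g : α → Code} (hf : Primrec f)
    (hg : Primrec g) : Primrec fun a => Code.pair (f a) (g a) := Code.primrec₂_pair.comp hf hg
@[fun_prop] theorem P_ccomp {α : Type} [Primcodable α] {f g : α → Code} (hf : Primrec f)
    (hg : Primrec g) : Primrec fun a => Code.comp (f a) (g a) := Code.primrec₂_comp.comp hf hg
@[fun_prop] theorem P_cprec {α : Type} [Primcodable α] {f g : α → Code} (hf : Primrec f)
    (hg : Primrec g) : Primrec fun a => Code.prec (f a) (g a) := Code.primrec₂_prec.comp hf hg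
@[fun_prop] theorem P_crfind {α : Type} [Primcodable α] {f : α → Code} (hf : Primrec f) :
    Primrec fun a => Code.rfind' (f a) := Code.primrec_rfind'.comp hf

def trG1 (L : List Code) (n : ℕ) : Option Code :=
  (L[n.div2.div2]?).bind fun s => (L[n.div2.div2.unpair.1]?).bind fun s1 =>
    (L[n.div2.div2.unpair.2]?).map fun s2 =>
      bif n.bodd then (bif n.div2.bodd then Code.rfind' s else Code.prec s1 s2)
      else (bif n.div2.bodd then Code.comp s1 s2 else Code.pair s1 s2)

theorem trG1_prim : Primrec fun p : List Code × ℕ => trG1 p.1 p.2 := by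
  unfold trG1; fun_prop

def trG (L : List Code) : Option Code :=
  bif L.length == 0 then some .zero else bif L.length == 1 then some .succ else
  bif L.length == 2 then some .left else bif L.length == 3 then some .right else
  bif L.length == 4 then some .zero else trG1 L (L.length - 5)

theorem trG_prim : Primrec trG := by
  have := trG1_prim
  have h : Primrec fun L : List Code => trG1 L (L.length - 5) :=
    P_comp (f := fun p : List Code × ℕ => trG1 p.1 p.2) (g := fun L => (L, L.length - 5))
      trG1_prim (by fun_prop)
  unfold trG; fun_prop

theorem tr_prim : Primrec fun e => trO (ofNatOCode e) := by
  have : Primrec₂ fun (_ : Unit) e => trO (ofNatOCode e) := by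
    refine Primrec.nat_strong_rec (g := fun _ L => trG L) _ (trG_prim.comp Primrec.snd) ?_
    intro _ n
    rcases n with _ | _ | _ | _ | _ | n
    · simp [trG, ofNatOCode, trO]
    · simp [trG, ofNatOCode, trO]
    · simp [trG, ofNatOCode, trO]
    · simp [trG, ofNatOCode, trO]
    · simp [trG, ofNatOCode, trO]
    · have hm : n.div2.div2 < n + 1 + 1 + 1 + 1 + 1 := by
        rw [Nat.div2_val, Nat.div2_val]; omega
      have m1 : n.div2.div2.unpair.1 < n + 1 + 1 + 1 + 1 + 1 := lt_of_le_of_lt (Nat.unpair_left_le _) hm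
      have m2 : n.div2.div2.unpair.2 < n + 1 + 1 + 1 + 1 + 1 := lt_of_le_of_lt (Nat.unpair_right_le _) hm
      rw [ofNatOCode]
      have k : ∀ j, j < n + 1 + 1 + 1 + 1 + 1 →
          ((List.range (n + 1 + 1 + 1 + 1 + 1)).map fun e => trO (ofNatOCode e))[j]? =
            some (trO (ofNatOCode j)) := by
        intro j hj
        rw [List.getElem?_map, List.getElem?_eq_getElem (by simpa using hj), List.getElem_range]
        rfl
      have e : n + 1 + 1 + 1 + 1 + 1 - 5 = n := by omega
      simp only [trG, List.length_map, List.length_range, e, trG1, k _ hm, k _ m1, k _ m2]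
      cases n.bodd <;> cases n.div2.bodd <;> simp [trO]
  exact this.comp (Primrec.const ()) Primrec.id

theorem LC_chiK : LC (chi K) := by
  have := tr_prim
  refine ⟨fun e s => bif (Code.evaln s (trO (ofNatOCode e)) e).isSome then 1 else 0, ?_, ?_⟩
  · have h : Primrec fun p : ℕ × ℕ => trO (ofNatOCode p.1) := tr_prim.comp Primrec.fst
    fun_prop
  · intro e
    have hK : e ∈ K ↔ (Code.eval (trO (ofNatOCode e)) e).Dom := by
      rw [eval_trO]; rfl
    by_cases he : e ∈ K
    · have h2 := hK.1 he
      obtain ⟨k, hk⟩ := Code.evaln_complete.1 (Part.get_mem h2)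
      filter_upwards [eventually_ge_atTop k] with s hs
      have := Code.evaln_mono hs hk
      rw [Option.mem_def] at this
      simp [this, chi, he]
    · refine Eventually.of_forall fun s => ?_
      have : Code.evaln s (trO (ofNatOCode e)) e = none := by
        rw [Option.eq_none_iff_forall_not_mem]
        intro x hx
        exact he (hK.2 (Part.dom_iff_mem.2 ⟨x, Code.evaln_sound hx⟩))
      simp [this, chi, he]

theorem recIn_approx {O : ℕ → ℕ} (hO : LC O) {f : ℕ →. ℕ} (hf : RecIn O f) :
    ∃ g : ℕ → ℕ → Option ℕ, (Primrec fun p : ℕ × ℕ => g p.1 p.2) ∧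
      ∀ n y, y ∈ f n → ∀ᶠ s in atTop, g n s = some y := by
  induction hf with
  | oracle =>
    obtain ⟨g, hg, hg'⟩ := hO
    refine ⟨fun n s => some (g n s), by fun_prop, fun n y hy => ?_⟩
    filter_upwards [hg' n] with s hs
    rw [hs, Part.mem_some_iff.1 hy]
  | zero =>
    exact ⟨fun n s => some 0, by fun_prop, fun n y hy => .of_forall fun s => by
      rw [Part.mem_some_iff.1 hy]⟩
  | succ =>
    exact ⟨fun n s => some (n + 1), by fun_prop, fun n y hy => .of_forall fun s => by
      rw [Part.mem_some_iff.1 hy]⟩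
  | left =>
    exact ⟨fun n s => some n.unpair.1, by fun_prop, fun n y hy => .of_forall fun s => by
      rw [Part.mem_some_iff.1 hy]⟩
  | right =>
    exact ⟨fun n s => some n.unpair.2, by fun_prop, fun n y hy => .of_forall fun s => by
      rw [Part.mem_some_iff.1 hy]⟩
  | pair _ _ ihf ihg =>
    obtain ⟨F, hF, hF'⟩ := ihf
    obtain ⟨G, hG, hG'⟩ := ihg
    refine ⟨fun n s => (F n s).bind fun a => (G n s).map fun b => Nat.pair a b, by fun_prop, ?_⟩
    intro n y hy
    simp only [Seq.seq, Part.map_eq_map, Part.mem_bind_iff, Part.mem_map_iff] at hy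
    obtain ⟨_, ⟨a, ha, rfl⟩, b, hb, rfl⟩ := hy
    filter_upwards [hF' n a ha, hG' n b hb] with s h1 h2
    simp [h1, h2]
  | comp _ _ ihf ihg =>
    obtain ⟨F, hF, hF'⟩ := ihf
    obtain ⟨G, hG, hG'⟩ := ihg
    refine ⟨fun n s => (G n s).bind fun a => F a s, ?_, ?_⟩
    · have : Primrec fun q : (ℕ × ℕ) × ℕ => F q.2 q.1.2 :=
        P_comp (f := fun p : ℕ × ℕ => F p.1 p.2) (g := fun q : (ℕ × ℕ) × ℕ => (q.2, q.1.2))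
          hF (by fun_prop)
      fun_prop
    intro n y hy
    obtain ⟨a, ha, hy⟩ := Part.mem_bind_iff.1 hy
    filter_upwards [hG' n a ha, hF' a y hy] with s h1 h2
    simp [h1, h2]
  | @prec f g _ _ ihf ihg =>
    obtain ⟨F, hF, hF'⟩ := ihf
    obtain ⟨G, hG, hG'⟩ := ihg
    refine ⟨fun n s => (Nat.rec (F n.unpair.1 s) (fun y IH => IH.bind fun i =>
      G (Nat.pair n.unpair.1 (Nat.pair y i)) s) n.unpair.2 : Option ℕ), ?_, ?_⟩
    · have h1 : Primrec fun q : ((ℕ × ℕ) × ℕ × Option ℕ) × ℕ =>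
          G (Nat.pair q.1.1.1.unpair.1 (Nat.pair q.1.2.1 q.2)) q.1.1.2 :=
        P_comp (f := fun p : ℕ × ℕ => G p.1 p.2) (g := fun q : ((ℕ × ℕ) × ℕ × Option ℕ) × ℕ =>
          (Nat.pair q.1.1.1.unpair.1 (Nat.pair q.1.2.1 q.2), q.1.1.2)) hG (by fun_prop)
      have h2 : Primrec fun q : ℕ × ℕ => F q.1.unpair.1 q.2 :=
        P_comp (f := fun p : ℕ × ℕ => F p.1 p.2) (g := fun q : ℕ × ℕ => (q.1.unpair.1, q.2))
          hF (by fun_prop)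
      fun_prop
    intro n
    simp only [Nat.unpaired]
    generalize n.unpair.1 = a
    generalize n.unpair.2 = m
    induction m with
    | zero => exact hF' a
    | succ m ih =>
      intro y hy
      obtain ⟨i, hi, hy⟩ := Part.mem_bind_iff.1 hy
      filter_upwards [ih i hi, hG' _ y hy] with s h1 h2
      simp only [h1, Option.bind_some, h2]
  | @rfind f _ ihf =>
    obtain ⟨F, hF, hF'⟩ := ihf
    refine ⟨fun n s => some ((List.range s).findIdx fun m => F (Nat.pair n m) s == some 0), ?_, ?_⟩
    · have h1 : Primrec fun q : (ℕ × ℕ) × ℕ => F (Nat.pair q.1.1 q.2) q.1.2 :=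
        P_comp (f := fun p : ℕ × ℕ => F p.1 p.2) (g := fun q : (ℕ × ℕ) × ℕ =>
          (Nat.pair q.1.1 q.2, q.1.2)) hF (by fun_prop)
      fun_prop
    intro n y hy
    have hy := Nat.mem_rfind.1 hy
    simp only [Part.map_eq_map, Part.mem_map_iff] at hy
    obtain ⟨⟨z, hz, hz0⟩, hlt⟩ := hy
    have hz0 : z = 0 := by simpa using hz0
    subst hz0
    have h1 : ∀ᶠ s in atTop, ∀ m ∈ Finset.range y, ¬ F (Nat.pair n m) s = some 0 := by
      rw [Filter.eventually_all_finset]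
      intro m hm
      obtain ⟨w, hw, hw0⟩ := hlt (Finset.mem_range.1 hm)
      filter_upwards [hF' _ w hw] with s hs
      rw [hs]; simpa using hw0
    filter_upwards [h1, hF' _ 0 hz, eventually_gt_atTop y] with s h2 h3 h4
    congr 1
    rw [List.findIdx_eq (by simpa using h4)]
    refine ⟨by simp [h3], fun j hj => ?_⟩
    simpa using h2 j (Finset.mem_range.2 hj)

theorem LC_of_TRed {A : Set ℕ} (h : TRed A K) : LC fun n => decide (n ∈ A) := by
  obtain ⟨g, hg, hg'⟩ := recIn_approx LC_chiK h
  refine ⟨fun n s => g n s == some 1, by fun_prop, fun n => ?_⟩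
  filter_upwards [hg' n _ (Part.mem_some _)] with s hs
  by_cases hn : n ∈ A <;> simp [hs, chi, hn]

/-! ### limit computable sets are reducible to K -/

theorem recIn_of_partrec {O : ℕ → ℕ} {f : ℕ →. ℕ} (hf : Nat.Partrec f) : RecIn O f := by
  induction hf with
  | zero => exact RecIn.zero
  | succ => exact RecIn.succ
  | left => exact RecIn.left
  | right => exact RecIn.right
  | pair _ _ h1 h2 => exact RecIn.pair h1 h2
  | comp _ _ h1 h2 => exact RecIn.comp h1 h2
  | prec _ _ h1 h2 => exact RecIn.prec h1 h2
  | rfind _ h1 => exact RecIn.rfind h1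

theorem recIn_of_primrec {O : ℕ → ℕ} {f : ℕ → ℕ} (hf : Primrec f) :
    RecIn O (fun n => Part.some (f n)) :=
  recIn_of_partrec (Partrec.nat_iff.1 hf.to_comp.partrec)

def toO : Code → OCode
  | .zero => .zero
  | .succ => .succ
  | .left => .left
  | .right => .right
  | .pair a b => .pair (toO a) (toO b)
  | .comp a b => .comp (toO a) (toO b)
  | .prec a b => .prec (toO a) (toO b)
  | .rfind' a => .rfind' (toO a)

theorem trO_toO (c : Code) : trO (toO c) = c := by
  induction c <;> simp_all [trO, toO]

theorem div2_aux (m : ℕ) (a b : Bool) :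
    (4 * m + 2 * b.toNat + a.toNat).bodd = a ∧ (4 * m + 2 * b.toNat + a.toNat).div2.bodd = b ∧
      (4 * m + 2 * b.toNat + a.toNat).div2.div2 = m := by
  refine ⟨?_, ?_, ?_⟩
  · rw [Nat.bodd_eq_one_and_ne_zero]
    cases a <;> cases b <;> simp <;> omega
  · rw [Nat.bodd_eq_one_and_ne_zero, Nat.div2_val]
    cases a <;> cases b <;> simp <;> omega
  · rw [Nat.div2_val, Nat.div2_val]
    cases a <;> cases b <;> simp <;> omega

theorem ofNat_comp (a b : ℕ) :
    ofNatOCode (4 * Nat.pair a b + 7) = .comp (ofNatOCode a) (ofNatOCode b) := by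
  have h := div2_aux (Nat.pair a b) false true
  simp only [Bool.toNat_true, Bool.toNat_false, mul_one, add_zero] at h
  rw [show 4 * Nat.pair a b + 7 = (4 * Nat.pair a b + 2) + 5 by omega, ofNatOCode]
  simp only [h]
  simp

theorem ofNat_surj (c : OCode) : ∃ e, ofNatOCode e = c := by
  induction c with
  | zero => exact ⟨0, by simp [ofNatOCode]⟩
  | succ => exact ⟨1, by simp [ofNatOCode]⟩
  | left => exact ⟨2, by simp [ofNatOCode]⟩
  | right => exact ⟨3, by simp [ofNatOCode]⟩
  | oracle => exact ⟨4, by simp [ofNatOCode]⟩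
  | pair _ _ h1 h2 =>
    obtain ⟨a, rfl⟩ := h1
    obtain ⟨b, rfl⟩ := h2
    refine ⟨4 * Nat.pair a b + 2 * false.toNat + false.toNat + 5, ?_⟩
    have h := div2_aux (Nat.pair a b) false false
    rw [ofNatOCode]
    simp only [h]
    simp
  | comp _ _ h1 h2 =>
    obtain ⟨a, rfl⟩ := h1
    obtain ⟨b, rfl⟩ := h2
    exact ⟨_, ofNat_comp a b⟩
  | prec _ _ h1 h2 =>
    obtain ⟨a, rfl⟩ := h1
    obtain ⟨b, rfl⟩ := h2
    refine ⟨4 * Nat.pair a b + 2 * false.toNat + true.toNat + 5, ?_⟩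
    have h := div2_aux (Nat.pair a b) true false
    rw [ofNatOCode]
    simp only [h]
    simp
  | rfind' _ h1 =>
    obtain ⟨a, rfl⟩ := h1
    refine ⟨4 * a + 2 * true.toNat + true.toNat + 5, ?_⟩
    have h := div2_aux a true true
    rw [ofNatOCode]
    simp only [h]

def cst (m : ℕ) : ℕ := Nat.rec 0 (fun _ r => 4 * Nat.pair 1 r + 7) m

theorem eval_cst (m n : ℕ) : evalo (chi ∅) (ofNatOCode (cst m)) n = Part.some m := by
  induction m with
  | zero => simp [cst, ofNatOCode, evalo]
  | succ m ih =>
    have : cst (m + 1) = 4 * Nat.pair 1 (cst m) + 7 := rfl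
    rw [this, ofNat_comp]
    simp [evalo, ih, ofNatOCode]

theorem K_sigma1 {r : ℕ × ℕ → Bool} (hr : Primrec r) :
    ∃ h : ℕ → ℕ, Primrec h ∧ ∀ m, h m ∈ K ↔ ∃ t, r (m, t) = true := by
  have h1 : Partrec fun m : ℕ => Nat.rfind fun t => Part.some (r (m, t)) :=
    Partrec.rfind (p := fun m t => Part.some (r (m, t))) hr.to_comp.partrec
  obtain ⟨c, hc⟩ := Code.exists_code.1 (Partrec.nat_iff.1 h1)
  obtain ⟨e, he⟩ := ofNat_surj (toO c)
  refine ⟨fun m => 4 * Nat.pair e (cst m) + 7, by unfold cst; fun_prop, fun m => ?_⟩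
  change (evalo (chi ∅) (ofNatOCode (4 * Nat.pair e (cst m) + 7)) _).Dom ↔ _
  rw [ofNat_comp]
  simp only [evalo, eval_cst, he]
  rw [← eval_trO, trO_toO, hc, Part.bind_eq_bind, Part.bind_some]
  refine Nat.rfind_dom.trans ?_
  simp

theorem TRed_of_LC {B : Set ℕ} (h : LC fun n => decide (n ∈ B)) : TRed B K := by
  obtain ⟨g, hg, hg'⟩ := h
  have hr : Primrec fun q : ℕ × ℕ => Nat.ble q.1.unpair.2 q.2 &&
      !(g q.1.unpair.1 q.2 == g q.1.unpair.1 q.1.unpair.2) := by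
    have h1 : Primrec fun q : ℕ × ℕ => g q.1.unpair.1 q.2 :=
      P_comp (f := fun p : ℕ × ℕ => g p.1 p.2) (g := fun q : ℕ × ℕ => (q.1.unpair.1, q.2)) hg
        (by fun_prop)
    have h2 : Primrec fun q : ℕ × ℕ => g q.1.unpair.1 q.1.unpair.2 :=
      P_comp (f := fun p : ℕ × ℕ => g p.1 p.2) (g := fun q : ℕ × ℕ => (q.1.unpair)) hg
        (by fun_prop)
    fun_prop
  obtain ⟨H, hH, hH'⟩ := K_sigma1 hr
  have hG : Primrec fun m : ℕ => bif g m.unpair.1 m.unpair.2 then 1 else 0 := by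
    have h2 : Primrec fun q : ℕ => g q.unpair.1 q.unpair.2 :=
      P_comp (f := fun p : ℕ × ℕ => g p.1 p.2) (g := fun q : ℕ => q.unpair) hg
        (by fun_prop)
    fun_prop
  have R := RecIn.comp (recIn_of_primrec (O := chi K) hG) (RecIn.pair (recIn_of_primrec P_id)
    (RecIn.rfind (RecIn.comp (RecIn.oracle (O := chi K)) (recIn_of_primrec hH))))
  unfold TRed
  refine cast (congrArg (RecIn (chi K)) ?_) R
  funext n
  rw [Part.eq_some_iff]
  have hn : ∀ s, H (Nat.pair n s) ∉ K ↔ ∀ t ≥ s, g n t = g n s := by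
    intro s
    rw [hH']
    simp
  have hn' : ∀ s, (chi K (H (Nat.pair n s)) = 0) ↔ ∀ t ≥ s, g n t = g n s := by
    intro s
    rw [← hn]
    simp [chi]
  obtain ⟨s0, hs0⟩ := eventually_atTop.1 (hg' n)
  have hex : ∃ s, ∀ t ≥ s, g n t = g n s :=
    ⟨s0, fun t ht => by rw [hs0 t ht, hs0 s0 le_rfl]⟩
  have hval : g n (Nat.find hex) = decide (n ∈ B) := by
    have h1 := Nat.find_spec hex (max s0 (Nat.find hex)) (le_max_right _ _)
    rw [← h1, hs0 _ (le_max_left _ _)]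
  have key : Nat.find hex ∈ (Nat.rfind fun s => (fun m => decide (m = 0)) <$>
      (Part.some (H (Nat.pair n s)) >>= fun m => Part.some (chi K m))) := by
    apply Nat.mem_rfind.2
    constructor
    · simp only [Part.bind_eq_bind, Part.bind_some, Part.map_eq_map, Part.map_some,
        Part.mem_some_iff]
      symm
      rw [decide_eq_true_iff, hn']
      exact Nat.find_spec hex
    · intro m hm
      simp only [Part.bind_eq_bind, Part.bind_some, Part.map_eq_map, Part.map_some,
        Part.mem_some_iff]
      symm
      rw [decide_eq_false_iff_not, hn']
      exact Nat.find_min hex hm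
  have e := Part.eq_some_iff.2 key
  refine Part.mem_bind_iff.2 ⟨Nat.pair n (Nat.find hex), ?_, ?_⟩
  · simp only [Seq.seq, Part.map_eq_map, Part.map_some, Part.bind_some, Part.mem_map_iff]
    exact ⟨_, key, rfl⟩
  · simp only [Nat.unpair_pair, hval, Part.mem_some_iff, chi]
    by_cases h : n ∈ B <;> simp [h]

/-! ### use principle -/

def pre (N : ℕ → Bool) (k : ℕ) : List Bool := (List.range k).map N

theorem pre_length (N : ℕ → Bool) (k : ℕ) : (pre N k).length = k := by simp [pre]

theorem pre_get (N : ℕ → Bool) (k n : ℕ) :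
    (pre N k)[n]? = if n < k then some (N n) else none := by
  unfold pre
  split_ifs with h
  · rw [List.getElem?_map, List.getElem?_eq_getElem (by simpa using h), List.getElem_range]
    rfl
  · simp; omega

theorem use_principle {O : ℕ → ℕ} {N : ℕ → Bool} (hN : ∀ n, O n = bif N n then 1 else 0)
    {f : ℕ →. ℕ} (hf : RecIn O f) :
    ∃ Ψ : List Bool × ℕ →. ℕ, Partrec Ψ ∧ (∀ k n y, y ∈ Ψ (pre N k, n) → y ∈ f n) ∧
      (∀ n y, y ∈ f n → ∀ᶠ k in atTop, y ∈ Ψ (pre N k, n)) := by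
  induction hf with
  | oracle =>
    refine ⟨fun p => (((p.1[p.2]?).map fun b => bif b then 1 else 0 : Option ℕ) : Part ℕ),
      Computable.ofOption (Primrec.to_comp (by fun_prop)), ?_, ?_⟩
    · intro k n y hy
      simp only [pre_get, Part.mem_ofOption, Part.mem_some_iff] at hy ⊢
      split_ifs at hy with h
      · simp only [Option.map_some, Option.mem_def, Option.some.injEq] at hy
        rw [hN, hy]
      · simp at hy
    · intro n y hy
      filter_upwards [eventually_gt_atTop n] with k hk
      simp only [pre_get, Part.mem_ofOption, Part.mem_some_iff] at hy ⊢
      simp [hk, hy, hN]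
  | zero =>
    exact ⟨fun p => Part.some 0, (Primrec.to_comp (by fun_prop)).partrec,
      fun _ _ _ h => h, fun _ _ h => .of_forall fun _ => h⟩
  | succ =>
    exact ⟨fun p => Part.some (p.2 + 1), (Primrec.to_comp (by fun_prop)).partrec,
      fun _ _ _ h => h, fun _ _ h => .of_forall fun _ => h⟩
  | left =>
    exact ⟨fun p => Part.some (p.2.unpair.1), (Primrec.to_comp (by fun_prop)).partrec,
      fun _ _ _ h => h, fun _ _ h => .of_forall fun _ => h⟩
  | right =>
    exact ⟨fun p => Part.some (p.2.unpair.2), (Primrec.to_comp (by fun_prop)).partrec,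
      fun _ _ _ h => h, fun _ _ h => .of_forall fun _ => h⟩
  | @pair f g _ _ ihf ihg =>
    obtain ⟨F, hF, hF1, hF2⟩ := ihf
    obtain ⟨G, hG, hG1, hG2⟩ := ihg
    have hm : ∀ (P Q : Part ℕ) y, y ∈ (Nat.pair <$> P <*> Q) ↔
        ∃ a ∈ P, ∃ b ∈ Q, Nat.pair a b = y := by
      intro P Q y
      simp only [Seq.seq, Part.map_eq_map, Part.mem_bind_iff, Part.mem_map_iff]
      constructor
      · rintro ⟨_, ⟨a, ha, rfl⟩, b, hb, rfl⟩; exact ⟨a, ha, b, hb, rfl⟩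
      · rintro ⟨a, ha, b, hb, rfl⟩; exact ⟨_, ⟨a, ha, rfl⟩, b, hb, rfl⟩
    refine ⟨fun p => (F p).bind fun a => (G p).map fun b => Nat.pair a b, ?_, ?_, ?_⟩
    · refine hF.bind (Partrec.map (hG.comp Computable.fst) (Primrec.to_comp ?_))
      fun_prop
    · intro k n y hy
      simp only [Part.mem_bind_iff, Part.mem_map_iff] at hy
      obtain ⟨a, ha, b, hb, rfl⟩ := hy
      exact (hm _ _ _).2 ⟨a, hF1 _ _ _ ha, b, hG1 _ _ _ hb, rfl⟩
    · intro n y hy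
      obtain ⟨a, ha, b, hb, rfl⟩ := (hm _ _ _).1 hy
      filter_upwards [hF2 _ _ ha, hG2 _ _ hb] with k h1 h2
      simp only [Part.mem_bind_iff, Part.mem_map_iff]
      exact ⟨a, h1, b, h2, rfl⟩
  | @comp f g _ _ ihf ihg =>
    obtain ⟨F, hF, hF1, hF2⟩ := ihf
    obtain ⟨G, hG, hG1, hG2⟩ := ihg
    refine ⟨fun p => (G p).bind fun a => F (p.1, a), ?_, ?_, ?_⟩
    · refine hG.bind (hF.comp (Primrec.to_comp ?_))
      fun_prop
    · intro k n y hy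
      obtain ⟨a, ha, hy⟩ := Part.mem_bind_iff.1 hy
      exact Part.mem_bind_iff.2 ⟨a, hG1 _ _ _ ha, hF1 _ _ _ hy⟩
    · intro n y hy
      obtain ⟨a, ha, hy⟩ := Part.mem_bind_iff.1 hy
      filter_upwards [hG2 _ _ ha, hF2 _ _ hy] with k h1 h2
      exact Part.mem_bind_iff.2 ⟨a, h1, h2⟩
  | @prec f g _ _ ihf ihg =>
    obtain ⟨F, hF, hF1, hF2⟩ := ihf
    obtain ⟨G, hG, hG1, hG2⟩ := ihg
    refine ⟨fun p => (Nat.rec (F (p.1, p.2.unpair.1)) (fun y IH => IH.bind fun i =>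
      G (p.1, Nat.pair p.2.unpair.1 (Nat.pair y i))) p.2.unpair.2 : Part ℕ), ?_, ?_, ?_⟩
    · refine Partrec.nat_rec (f := fun p : List Bool × ℕ => p.2.unpair.2)
        (g := fun p => F (p.1, p.2.unpair.1))
        (h := fun p q => G (p.1, Nat.pair p.2.unpair.1 (Nat.pair q.1 q.2)))
        (Primrec.to_comp (by fun_prop)) (hF.comp (Primrec.to_comp (by fun_prop)))
        (hG.comp (Primrec.to_comp (by fun_prop)))
    · intro k n
      simp only [Nat.unpaired]
      generalize n.unpair.1 = a
      generalize n.unpair.2 = m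
      induction m with
      | zero => exact hF1 k a
      | succ m ih =>
        intro y hy
        obtain ⟨i, hi, hy⟩ := Part.mem_bind_iff.1 hy
        exact Part.mem_bind_iff.2 ⟨i, ih i hi, hG1 _ _ _ hy⟩
    · intro n
      simp only [Nat.unpaired]
      generalize n.unpair.1 = a
      generalize n.unpair.2 = m
      induction m with
      | zero => exact hF2 a
      | succ m ih =>
        intro y hy
        obtain ⟨i, hi, hy⟩ := Part.mem_bind_iff.1 hy
        filter_upwards [ih i hi, hG2 _ y hy] with s h1 h2
        exact Part.mem_bind_iff.2 ⟨i, h1, h2⟩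
  | @rfind f _ ihf =>
    obtain ⟨F, hF, hF1, hF2⟩ := ihf
    refine ⟨fun p => Nat.rfind fun m => (F (p.1, Nat.pair p.2 m)).map fun z => Nat.ble z 0,
      ?_, ?_, ?_⟩
    · refine Partrec.rfind (p := fun (p : List Bool × ℕ) m => (F (p.1, Nat.pair p.2 m)).map fun z => Nat.ble z 0)
        (Partrec.map (hF.comp (Primrec.to_comp (by fun_prop))) (Primrec.to_comp ?_))
      fun_prop
    · intro k n y hy
      have hy := Nat.mem_rfind.1 hy
      simp only [Part.mem_map_iff] at hy
      obtain ⟨⟨z, hz, hz0⟩, hlt⟩ := hy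
      apply Nat.mem_rfind.2
      simp only [Part.map_eq_map, Part.mem_map_iff]
      refine ⟨⟨z, hF1 _ _ _ hz, by simpa using hz0⟩, fun {m} hm => ?_⟩
      obtain ⟨w, hw, hw0⟩ := hlt hm
      refine ⟨w, hF1 _ _ _ hw, ?_⟩
      rw [← hw0, Bool.eq_iff_iff]; simp
    · intro n y hy
      have hy := Nat.mem_rfind.1 hy
      simp only [Part.map_eq_map, Part.mem_map_iff] at hy
      obtain ⟨⟨z, hz, hz0⟩, hlt⟩ := hy
      have h1 : ∀ᶠ s in atTop, ∀ m ∈ Finset.range y, false ∈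
          (F (pre N s, Nat.pair n m)).map fun z => Nat.ble z 0 := by
        rw [Filter.eventually_all_finset]
        intro m hm
        obtain ⟨w, hw, hw0⟩ := hlt (Finset.mem_range.1 hm)
        filter_upwards [hF2 _ w hw] with s hs
        refine (Part.mem_map_iff _).2 ⟨w, hs, ?_⟩
        rw [← hw0, Bool.eq_iff_iff]; simp
      filter_upwards [h1, hF2 _ z hz] with s h2 h3
      apply Nat.mem_rfind.2
      refine ⟨(Part.mem_map_iff _).2 ⟨z, h3, ?_⟩, fun {m} hm => h2 m (Finset.mem_range.2 hm)⟩
      simpa using hz0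

theorem partrec_code {Ψ : List Bool × ℕ →. ℕ} (h : Partrec Ψ) :
    ∃ c : Code, ∀ p, (c.eval (Encodable.encode p)).Dom ↔ (Ψ p).Dom := by
  obtain ⟨c, hc⟩ := Code.exists_code.1 h
  refine ⟨c, fun p => ?_⟩
  rw [hc]
  simp [Encodable.encodek]

theorem use_code {T S : Set ℕ} (h : TRed T S) : ∃ c : Code, ∀ n,
    (n ∈ T → ∀ᶠ k in atTop,
      (c.eval (Encodable.encode (pre (fun x => decide (x ∈ S)) k, n))).Dom) ∧
    ∀ k, (c.eval (Encodable.encode (pre (fun x => decide (x ∈ S)) k, n))).Dom → n ∈ T := by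
  obtain ⟨Ψ, hΨ, h1, h2⟩ := use_principle (N := fun x => decide (x ∈ S))
    (fun n => by by_cases hn : n ∈ S <;> simp [chi, hn]) h
  have hP : Partrec fun p => (Ψ p).bind fun y =>
      ((bif y == 1 then some 0 else none : Option ℕ) : Part ℕ) := by
    refine hΨ.bind (Computable.ofOption (Primrec.to_comp ?_))
    fun_prop
  obtain ⟨c, hc⟩ := partrec_code hP
  refine ⟨c, fun n => ⟨fun hn => ?_, fun k hk => ?_⟩⟩
  · filter_upwards [h2 n 1 (by simp [chi, hn])] with k hk
    rw [hc, Part.dom_iff_mem]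
    exact ⟨0, Part.mem_bind_iff.2 ⟨1, hk, by simp⟩⟩
  · rw [hc, Part.dom_iff_mem] at hk
    obtain ⟨z, hz⟩ := hk
    obtain ⟨y, hy, hz⟩ := Part.mem_bind_iff.1 hz
    have := h1 _ _ _ hy
    rw [Part.mem_some_iff] at this
    by_contra hn
    simp [chi, hn] at this
    subst this
    simp at hz

/-! ### low basis -/

theorem pre_succ (N : ℕ → Bool) (k : ℕ) : pre N (k + 1) = pre N k ++ [N k] := by
  simp [pre, List.range_succ]

theorem pre_congr {N N' : ℕ → Bool} {k : ℕ} (h : ∀ x < k, N x = N' x) : pre N k = pre N' k := by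
  unfold pre
  exact List.map_congr_left fun x hx => h x (List.mem_range.1 hx)

theorem pre_lc (k : ℕ) : IsLocallyConstant fun N : ℕ → Bool => pre N k := by
  induction k with
  | zero => exact IsLocallyConstant.const _
  | succ k ih =>
    simp only [pre_succ]
    exact IsLocallyConstant.comp₂ ih
      ((IsLocallyConstant.iff_continuous _).2 (continuous_apply k)) fun a b => a ++ [b]

theorem closed_pre (k : ℕ) (P : List Bool → Prop) : IsClosed {N : ℕ → Bool | P (pre N k)} := by
  constructor
  exact pre_lc k {l | ¬ P l}

theorem cantor_compact {C : ℕ → Set (ℕ → Bool)} (hc : ∀ k, IsClosed (C k))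
    (hm : ∀ k, C (k + 1) ⊆ C k) (hn : ∀ k, (C k).Nonempty) : ∃ N, ∀ k, N ∈ C k := by
  have := IsCompact.nonempty_iInter_of_sequence_nonempty_isCompact_isClosed C hm hn
    (hc 0).isCompact hc
  obtain ⟨N, hN⟩ := this
  exact ⟨N, fun k => Set.mem_iInter.1 hN k⟩

def allstr (k : ℕ) : List (List Bool) :=
  Nat.rec [[]] (fun _ L => L.map (fun l => l ++ [false]) ++ L.map (fun l => l ++ [true])) k

theorem mem_allstr (k : ℕ) (μ : List Bool) : μ ∈ allstr k ↔ ∃ N, μ = pre N k := by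
  induction k generalizing μ with
  | zero => simp [allstr, pre]
  | succ k ih =>
    have e : allstr (k + 1) = (allstr k).map (fun l => l ++ [false]) ++
      (allstr k).map (fun l => l ++ [true]) := rfl
    have key : μ ∈ allstr (k + 1) ↔ ∃ ν ∈ allstr k, ∃ b, μ = ν ++ [b] := by
      rw [e, List.mem_append, List.mem_map, List.mem_map]
      constructor
      · rintro (⟨ν, h, rfl⟩ | ⟨ν, h, rfl⟩)
        exacts [⟨ν, h, _, rfl⟩, ⟨ν, h, _, rfl⟩]
      · rintro ⟨ν, h, b, rfl⟩
        cases b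
        exacts [Or.inl ⟨ν, h, rfl⟩, Or.inr ⟨ν, h, rfl⟩]
    rw [key]
    constructor
    · rintro ⟨ν, h, b, rfl⟩
      obtain ⟨N, rfl⟩ := (ih ν).1 h
      refine ⟨fun x => if x = k then b else N x, ?_⟩
      rw [pre_succ]
      congr 1
      · exact pre_congr fun x hx => by simp [hx.ne]
      · simp
    · rintro ⟨N, rfl⟩
      exact ⟨pre N k, (ih _).2 ⟨N, rfl⟩, N k, pre_succ N k⟩

theorem allstr_prim : Primrec allstr := by
  unfold allstr; fun_prop

theorem low_basis (U : ℕ → List Bool → Bool) (hU : Primrec fun p : ℕ × List Bool => U p.1 p.2)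
    (mono : ∀ s N j k, j ≤ k → U s (pre N j) = true → U s (pre N k) = true) :
    ∃ (M : ℕ → Bool) (d : ℕ → Bool), LC d ∧ ∀ s, (d s = true → ∀ j, U s (pre M j) = false) ∧
      (d s = false → ∀ N, (∀ s' < s, d s' = true → ∀ j, U s' (pre N j) = false) →
        ∃ j, U s (pre N j) = true) := by
  let emp : List ℕ → ℕ → Bool := fun L k => (allstr k).all fun μ => L.any fun s => U s μ
  have hemp : Primrec fun p : List ℕ × ℕ => emp p.1 p.2 := by
    have h1 : Primrec fun p : List ℕ × ℕ => allstr p.2 := allstr_prim.comp Primrec.snd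
    have h2 : Primrec fun q : ((List ℕ × ℕ) × List Bool) × ℕ => U q.2 q.1.2 :=
      P_comp (f := fun p : ℕ × List Bool => U p.1 p.2)
        (g := fun q : ((List ℕ × ℕ) × List Bool) × ℕ => (q.2, q.1.2)) hU (by fun_prop)
    show Primrec fun p : List ℕ × ℕ => (allstr p.2).all fun μ => p.1.any fun s => U s μ
    fun_prop
  have emp_iff : ∀ L k, emp L k = true ↔ ∀ N, ∃ s ∈ L, U s (pre N k) = true := by
    intro L k
    simp only [emp, List.all_eq_true, List.any_eq_true, mem_allstr]
    constructor
    · intro h N; exact h _ ⟨N, rfl⟩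
    · rintro h _ ⟨N, rfl⟩; exact h N
  have emp_mono : ∀ L j k, j ≤ k → emp L j = true → emp L k = true := by
    intro L j k hjk h
    rw [emp_iff] at h ⊢
    intro N
    obtain ⟨s, hs, h⟩ := h N
    exact ⟨s, hs, mono _ _ _ _ hjk h⟩
  let Emp : List ℕ → Prop := fun L => ∃ k, emp L k = true
  have LCE : LC fun L => decide (Emp L) := by
    refine ⟨emp, hemp, fun L => ?_⟩
    by_cases h : Emp L
    · obtain ⟨k, hk⟩ := h
      filter_upwards [eventually_ge_atTop k] with s hs
      rw [emp_mono L k s hs hk]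
      symm; rw [decide_eq_true_iff]; exact ⟨k, hk⟩
    · refine .of_forall fun s => ?_
      show emp L s = decide (Emp L)
      rw [decide_eq_false h]
      by_contra h'
      exact h ⟨s, by simpa using h'⟩
  have Emp_iff : ∀ L, Emp L ↔ ∀ N, ∃ j, ∃ s ∈ L, U s (pre N j) = true := by
    intro L
    constructor
    · rintro ⟨k, hk⟩ N
      exact ⟨k, (emp_iff _ _).1 hk N⟩
    · intro h
      by_contra hE
      have := cantor_compact (C := fun k => {N | ¬ ∃ s ∈ L, U s (pre N k) = true})
        (fun k => closed_pre k fun l => ¬ ∃ s ∈ L, U s l = true)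
        (fun k N hN hN' => by
          obtain ⟨s, hs, h⟩ := hN'
          exact hN ⟨s, hs, mono _ _ _ _ (Nat.le_succ k) h⟩)
        (fun k => by
          have : ¬ emp L k = true := fun h => hE ⟨k, h⟩
          rw [emp_iff] at this
          push Not at this
          obtain ⟨N, hN⟩ := this
          refine ⟨N, ?_⟩
          rintro ⟨s, hs, h⟩
          exact hN s hs h)
      obtain ⟨N, hN⟩ := this
      obtain ⟨j, hj⟩ := h N
      exact hN j hj
  let step : ℕ → List ℕ → List ℕ := fun s L =>
    bif decide (Emp (L ++ [s])) then L else L ++ [s]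
  let Ls : ℕ → List ℕ := fun s => Nat.rec [] step s
  let d : ℕ → Bool := fun s => !decide (Emp (Ls s ++ [s]))
  have LCL : LC Ls := by
    have h1 : LC fun q : Unit × ℕ × List ℕ => step q.2.1 q.2.2 := by
      have a1 : LC fun q : Unit × ℕ × List ℕ => decide (Emp (q.2.2 ++ [q.2.1])) :=
        LC.comp LCE (LC.of_primrec (by fun_prop))
      exact LC.comp (f := fun z : Bool × Unit × ℕ × List ℕ =>
        bif z.1 then z.2.2.2 else z.2.2.2 ++ [z.2.2.1]) (LC.of_primrec (by fun_prop))
        (LC.pair a1 (LC.of_primrec P_id))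
    have h2 := LC.natrec (f := fun _ : Unit => ([] : List ℕ)) (LC.of_primrec (by fun_prop)) h1
    exact LC.comp (f := fun a : Unit × ℕ => (Nat.rec [] (fun n b => step n b) a.2 : List ℕ)) h2
      (LC.of_primrec (f := fun s : ℕ => ((), s)) (by fun_prop))
  have LCd : LC d := by
    have a1 : LC fun s => decide (Emp (Ls s ++ [s])) :=
      LC.comp LCE (LC.comp (f := fun z : List ℕ × ℕ => z.1 ++ [z.2]) (LC.of_primrec (by fun_prop))
        (LC.pair LCL (LC.of_primrec P_id)))
    exact LC.comp (f := fun b : Bool => !b) (LC.of_primrec (by fun_prop)) a1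
  have Ls_succ : ∀ s, Ls (s + 1) = bif d s then Ls s ++ [s] else Ls s := by
    intro s
    show step s (Ls s) = _
    simp only [step, d]
    by_cases h : Emp (Ls s ++ [s]) <;> simp [h]
  have memL : ∀ s s', s' ∈ Ls s ↔ s' < s ∧ d s' = true := by
    intro s
    induction s with
    | zero => intro s'; simp [Ls]
    | succ s ih =>
      intro s'
      rw [Ls_succ]
      cases hd : d s
      · simp only [cond_false, ih]
        constructor
        · rintro ⟨h1, h2⟩; exact ⟨by omega, h2⟩
        · rintro ⟨h1, h2⟩
          refine ⟨?_, h2⟩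
          rcases Nat.lt_succ_iff_lt_or_eq.1 h1 with h | rfl
          · exact h
          · rw [hd] at h2; cases h2
      · simp only [cond_true, List.mem_append, ih, List.mem_singleton]
        constructor
        · rintro (⟨h1, h2⟩ | rfl)
          exacts [⟨by omega, h2⟩, ⟨by omega, hd⟩]
        · rintro ⟨h1, h2⟩
          rcases Nat.lt_succ_iff_lt_or_eq.1 h1 with h | rfl
          exacts [Or.inl ⟨h, h2⟩, Or.inr rfl]
  have nE : ∀ s, ¬ Emp (Ls s) := by
    intro s
    induction s with
    | zero =>
      rw [Emp_iff]
      intro h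
      obtain ⟨j, s, hs, _⟩ := h fun _ => false
      simp [Ls] at hs
    | succ s ih =>
      rw [Ls_succ]
      cases hd : d s
      · exact ih
      · simpa [d] using hd
  obtain ⟨M, hM⟩ := cantor_compact (C := fun s => {N | ∀ s' ∈ Ls s, ∀ j, ¬ U s' (pre N j) = true})
    (fun s => by
      have : {N : ℕ → Bool | ∀ s' ∈ Ls s, ∀ j, ¬ U s' (pre N j) = true} =
          ⋂ j, {N | ∀ s' ∈ Ls s, ¬ U s' (pre N j) = true} := by
        ext N
        simp only [Set.mem_ofPred_eq, Set.mem_iInter]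
        exact ⟨fun h j s' hs => h s' hs j, fun h s' hs j => h j s' hs⟩
      rw [this]
      exact isClosed_iInter fun j => closed_pre j fun l => ∀ s' ∈ Ls s, ¬ U s' l = true)
    (fun s N hN s' hs' => hN s' ((memL (s + 1) s').2
      ⟨Nat.lt_succ_of_lt ((memL s s').1 hs').1, ((memL s s').1 hs').2⟩))
    (fun s => by
      have := nE s
      rw [Emp_iff] at this
      push Not at this
      obtain ⟨N, hN⟩ := this
      exact ⟨N, fun s' hs' j => by have := hN j s' hs'; simpa using this⟩)
  refine ⟨M, d, LCd, fun s => ⟨fun hd j => ?_, fun hd N hN => ?_⟩⟩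
  · simpa using hM (s + 1) s ((memL (s + 1) s).2 ⟨Nat.lt_succ_self s, hd⟩) j
  · have hE : Emp (Ls s ++ [s]) := by simpa [d] using hd
    obtain ⟨j, s', hs', h⟩ := (Emp_iff _).1 hE N
    rcases List.mem_append.1 hs' with h1 | h1
    · obtain ⟨h2, h3⟩ := (memL _ _).1 h1
      rw [hN s' h2 h3 j] at h; cases h
    · rw [List.mem_singleton.1 h1] at h
      exact ⟨j, h⟩

/-! ### the generic sequence of cohesive-like rows -/

def W (e : ℕ) (τ : List Bool) (n : ℕ) : Prop :=
  (Code.eval (Denumerable.ofNat Code e.unpair.1) (Encodable.encode (τ, n))).Dom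

def Wk (e : ℕ) (k : ℕ) (z : List Bool × ℕ) : Bool :=
  (Code.evaln k (Denumerable.ofNat Code e.unpair.1) (Encodable.encode z)).isSome

theorem Wk_mono {e k k' z} (h : k ≤ k') (hw : Wk e k z = true) : Wk e k' z = true := by
  unfold Wk at *
  obtain ⟨x, hx⟩ := Option.isSome_iff_exists.1 hw
  exact Option.isSome_iff_exists.2 ⟨x, Code.evaln_mono h hx⟩

theorem Wk_sound {e k z} (hw : Wk e k z = true) : W e z.1 z.2 := by
  unfold Wk at hw
  obtain ⟨x, hx⟩ := Option.isSome_iff_exists.1 hw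
  exact Part.dom_iff_mem.2 ⟨x, Code.evaln_sound hx⟩

theorem Wk_complete {e τ n} (hw : W e τ n) : ∀ᶠ k in atTop, Wk e k (τ, n) = true := by
  obtain ⟨k, hk⟩ := Code.evaln_complete.1 (Part.get_mem hw)
  filter_upwards [eventually_ge_atTop k] with k' h
  exact Wk_mono h (Option.isSome_iff_exists.2 ⟨_, hk⟩)

def dz (t : ℕ) : List Bool × ℕ := (Encodable.decode t : Option (List Bool × ℕ)).getD ([], 0)

theorem dz_encode (z : List Bool × ℕ) : dz (Encodable.encode z) = z := by
  simp [dz]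

def extb (σ τ : List Bool) : Bool := (List.range σ.length).all fun x => τ[x]? == σ[x]?

theorem extb_iff (σ τ : List Bool) : extb σ τ = true ↔ ∀ x < σ.length, τ[x]? = σ[x]? := by
  simp [extb]

def newb (σ τ : List Bool) (R : ℕ → Bool) : Bool := (List.range τ.length).all fun x =>
  Nat.ble (x + 1) σ.length || (!(τ[x]? == some true) || R x)

theorem newb_iff (σ τ : List Bool) (R : ℕ → Bool) : newb σ τ R = true ↔
    ∀ x, σ.length ≤ x → τ[x]? = some true → R x = true := by
  simp only [newb, List.all_eq_true, List.mem_range, Bool.or_eq_true, Nat.ble_eq]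
  constructor
  · intro h x h1 h2
    have hx : x < τ.length := (List.getElem?_eq_some_iff.1 h2).1
    rcases h x hx with h3 | h3 | h3
    · omega
    · simp [h2] at h3
    · exact h3
  · intro h x hx
    by_cases h1 : x + 1 ≤ σ.length
    · exact Or.inl h1
    · right
      by_cases h2 : τ[x]? = some true
      · exact Or.inr (h x (by omega) h2)
      · left; simp only [Bool.not_eq_true', beq_eq_false_iff_ne]; exact h2

structure Ext (σ τ : List Bool) (R : ℕ → Prop) : Prop where
  e : ∀ x < σ.length, τ[x]? = σ[x]?
  n : ∀ x, σ.length ≤ x → τ[x]? = some true → R x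

def Neg (e : ℕ) (σ : List Bool) (b : ℕ) (R : ℕ → Prop) : Prop :=
  ∀ τ n, Ext σ τ R → b ≤ n → ¬ W e τ n

def viol (σ : List Bool) (e b k : ℕ) (R : ℕ → Bool) : Bool :=
  (List.range k).any fun t => extb σ (dz t).1 && (newb σ (dz t).1 R &&
    (Nat.ble b (dz t).2 && Wk e k (dz t)))

section
variable {α : Type} [Primcodable α]
@[fun_prop] theorem P_dz {f : α → ℕ} (h : Primrec f) : Primrec fun a => dz (f a) := by
  unfold dz; fun_prop
@[fun_prop] theorem P_extb {f g : α → List Bool} (hf : Primrec f) (hg : Primrec g) :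
    Primrec fun a => extb (f a) (g a) := by
  unfold extb; fun_prop
@[fun_prop] theorem P_newb {f g : α → List Bool} {R : α → ℕ → Bool} (hf : Primrec f)
    (hg : Primrec g) (hR : Primrec fun p : α × ℕ => R p.1 p.2) :
    Primrec fun a => newb (f a) (g a) (R a) := by
  unfold newb; fun_prop
@[fun_prop] theorem P_Wk {e k : α → ℕ} {z : α → List Bool × ℕ} (he : Primrec e) (hk : Primrec k)
    (hz : Primrec z) : Primrec fun a => Wk (e a) (k a) (z a) := by
  unfold Wk; fun_prop
@[fun_prop] theorem P_viol {σ : α → List Bool} {e b k : α → ℕ} {R : α → ℕ → Bool} (h1 : Primrec σ)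
    (h2 : Primrec e) (h3 : Primrec b) (h4 : Primrec k)
    (hR : Primrec fun p : α × ℕ => R p.1 p.2) :
    Primrec fun a => viol (σ a) (e a) (b a) (k a) (R a) := by
  have : Primrec fun q : (α × ℕ) × ℕ => R q.1.1 q.2 :=
    P_comp (f := fun p : α × ℕ => R p.1 p.2) (g := fun q : (α × ℕ) × ℕ => (q.1.1, q.2)) hR
      (by fun_prop)
  unfold viol; fun_prop
end

theorem viol_mono {σ e b k k'} {R R' : ℕ → Bool} (h : k ≤ k')
    (hR : ∀ x, R x = true → R' x = true) (hv : viol σ e b k R = true) :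
    viol σ e b k' R' = true := by
  simp only [viol, List.any_eq_true, List.mem_range, Bool.and_eq_true, newb_iff] at hv ⊢
  obtain ⟨t, h1, h2, h3, h4, h5⟩ := hv
  exact ⟨t, by omega, h2, fun x hx hx' => hR _ (h3 x hx hx'), h4, Wk_mono h h5⟩

theorem viol_iff (σ : List Bool) (e b : ℕ) {R : ℕ → ℕ → Bool} {Q : ℕ → Prop}
    (hs : ∀ k x, R k x = true → Q x) (hc : ∀ x, Q x → ∀ᶠ k in atTop, R k x = true) :
    (∀ k, viol σ e b k (R k) = false) ↔ Neg e σ b Q := by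
  constructor
  · intro h τ n hE hb hW
    have h1 : ∀ᶠ k in atTop, ∀ x ∈ Finset.range τ.length, Q x → R k x = true := by
      rw [Filter.eventually_all_finset]
      intro x _
      by_cases hx : Q x
      · filter_upwards [hc x hx] with k hk _ using hk
      · exact .of_forall fun k h => absurd h hx
    obtain ⟨k, h1, h2, h3⟩ := (h1.and ((Wk_complete hW).and
      (eventually_gt_atTop (Encodable.encode (τ, n))))).exists
    have : viol σ e b k (R k) = true := by
      simp only [viol, List.any_eq_true, List.mem_range, Bool.and_eq_true, newb_iff, extb_iff]
      refine ⟨Encodable.encode (τ, n), h3, ?_⟩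
      rw [dz_encode]
      refine ⟨hE.e, fun x hx hx' => h1 x ?_ (hE.n x hx hx'), by simpa using hb, h2⟩
      exact Finset.mem_range.2 (List.getElem?_eq_some_iff.1 hx').1
    rw [h k] at this; cases this
  · intro h k
    by_contra hv
    have hv : viol σ e b k (R k) = true := by simpa using hv
    simp only [viol, List.any_eq_true, List.mem_range, Bool.and_eq_true, newb_iff,
      extb_iff] at hv
    obtain ⟨t, h1, h2, h3, h4, h5⟩ := hv
    exact h _ _ ⟨h2, fun x hx hx' => hs _ _ (h3 x hx hx')⟩ (by simpa using h4) (Wk_sound h5)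

abbrev Par := List Bool × List Bool × ℕ × ℕ

def cs (q : ℕ) : Par :=
  (Encodable.decode q.unpair.1.unpair.2 : Option Par).getD ([], [], 0, 0)

def ci (q : ℕ) : ℕ := q.unpair.1.unpair.1

theorem ci_le (q : ℕ) : ci q ≤ q := (Nat.unpair_left_le _).trans (Nat.unpair_left_le _)

@[fun_prop] theorem P_cs {α : Type} [Primcodable α] {f : α → ℕ} (h : Primrec f) :
    Primrec fun a => cs (f a) := by unfold cs; fun_prop
@[fun_prop] theorem P_ci {α : Type} [Primcodable α] {f : α → ℕ} (h : Primrec f) :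
    Primrec fun a => ci (f a) := by unfold ci; fun_prop

def row (N : ℕ → Bool) (i x : ℕ) : Prop := i = 0 ∨ N (Nat.pair (i - 1) x) = true

def Sol (q : ℕ) (Row Z : ℕ → Prop) : Prop :=
  Neg (cs q).2.2.1 (cs q).1 q.unpair.2 Z ∧
  Neg (cs q).2.2.2 (cs q).2.1 q.unpair.2 (fun x => Row x ∧ ¬ Z x) ∧ ∀ x, Z x → Row x

def R0 (q : ℕ) (μ : List Bool) (x : ℕ) : Bool := μ[Nat.pair q x]? == some true
def R1 (q : ℕ) (μ : List Bool) (x : ℕ) : Bool :=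
  (ci q == 0 || μ[Nat.pair (ci q - 1) x]? == some true) && μ[Nat.pair q x]? == some false
def R2 (q : ℕ) (μ : List Bool) (x : ℕ) : Bool :=
  μ[Nat.pair q x]? == some true && (!(ci q == 0) && μ[Nat.pair (ci q - 1) x]? == some false)

def UU (q : ℕ) (μ : List Bool) : Bool :=
  viol (cs q).1 (cs q).2.2.1 q.unpair.2 μ.length (R0 q μ) ||
  (viol (cs q).2.1 (cs q).2.2.2 q.unpair.2 μ.length (R1 q μ) ||
    (List.range μ.length).any (R2 q μ))

def U (s : ℕ) (μ : List Bool) : Bool :=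
  bif s.bodd then μ[s.div2]? == some true else UU s.div2 μ

theorem UU_prim : Primrec fun p : ℕ × List Bool => UU p.1 p.2 := by
  unfold UU
  have h0 : Primrec fun q : (ℕ × List Bool) × ℕ => R0 q.1.1 q.1.2 q.2 := by
    unfold R0; fun_prop
  have h1 : Primrec fun q : (ℕ × List Bool) × ℕ => R1 q.1.1 q.1.2 q.2 := by
    unfold R1; fun_prop
  have h2 : Primrec fun q : (ℕ × List Bool) × ℕ => R2 q.1.1 q.1.2 q.2 := by
    unfold R2; fun_prop
  fun_prop

theorem U_prim : Primrec fun p : ℕ × List Bool => U p.1 p.2 := by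
  have h : Primrec fun p : ℕ × List Bool => UU p.1.div2 p.2 :=
    P_comp (f := fun p : ℕ × List Bool => UU p.1 p.2)
      (g := fun p : ℕ × List Bool => (p.1.div2, p.2)) UU_prim (by fun_prop)
  unfold U; fun_prop

theorem pre_get_some (N : ℕ → Bool) (k n : ℕ) (b : Bool) :
    (pre N k)[n]? = some b ↔ n < k ∧ N n = b := by
  rw [pre_get]; split_ifs with h <;> simp [h]

theorem R0_iff (q N k x) : R0 q (pre N k) x = true ↔ Nat.pair q x < k ∧ N (Nat.pair q x) = true := by
  simp [R0, pre_get_some]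
theorem R1_iff (q N k x) : R1 q (pre N k) x = true ↔
    (ci q = 0 ∨ (Nat.pair (ci q - 1) x < k ∧ N (Nat.pair (ci q - 1) x) = true)) ∧
      Nat.pair q x < k ∧ N (Nat.pair q x) = false := by
  simp [R1, pre_get_some]
theorem R2_iff (q N k x) : R2 q (pre N k) x = true ↔
    (Nat.pair q x < k ∧ N (Nat.pair q x) = true) ∧
    ci q ≠ 0 ∧ (Nat.pair (ci q - 1) x < k ∧ N (Nat.pair (ci q - 1) x) = false) := by
  simp [R2, pre_get_some]

theorem UU_mono (q N j k) (h : j ≤ k) (hu : UU q (pre N j) = true) : UU q (pre N k) = true := by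
  simp only [UU, Bool.or_eq_true, pre_length] at hu ⊢
  rcases hu with hu | hu | hu
  · refine Or.inl (viol_mono h (fun x => ?_) hu)
    rw [R0_iff, R0_iff]
    rintro ⟨a, b⟩; exact ⟨by omega, b⟩
  · refine Or.inr (Or.inl (viol_mono h (fun x => ?_) hu))
    rw [R1_iff, R1_iff]
    rintro ⟨a | a, b, c⟩
    · exact ⟨Or.inl a, by omega, c⟩
    · exact ⟨Or.inr ⟨by omega, a.2⟩, by omega, c⟩
  · right; right
    simp only [List.any_eq_true, List.mem_range, R2_iff] at hu ⊢
    obtain ⟨x, h1, ⟨h2, h3⟩, h4, h5, h6⟩ := hu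
    exact ⟨x, by omega, ⟨by omega, h3⟩, h4, by omega, h6⟩

theorem U_mono (s N j k) (h : j ≤ k) (hu : U s (pre N j) = true) : U s (pre N k) = true := by
  unfold U at *
  cases hs : s.bodd
  · rw [hs] at hu; exact UU_mono _ _ _ _ h hu
  · rw [hs] at hu
    simp only [cond_true, beq_iff_eq, pre_get_some] at hu ⊢
    exact ⟨by omega, hu.2⟩

theorem UU_sem (q : ℕ) (N : ℕ → Bool) :
    (∀ j, UU q (pre N j) = false) ↔ Sol q (row N (ci q)) (row N (q + 1)) := by
  have e0 := viol_iff (cs q).1 (cs q).2.2.1 q.unpair.2 (R := fun k => R0 q (pre N k))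
    (Q := row N (q + 1)) (fun k x h => Or.inr ((R0_iff _ _ _ _).1 h).2)
    (fun x hx => by
      filter_upwards [eventually_gt_atTop (Nat.pair q x)] with k hk
      rw [R0_iff]
      exact ⟨hk, by simpa [row] using hx⟩)
  have e1 := viol_iff (cs q).2.1 (cs q).2.2.2 q.unpair.2 (R := fun k => R1 q (pre N k))
    (Q := fun x => row N (ci q) x ∧ ¬ row N (q + 1) x)
    (fun k x h => by
      obtain ⟨h1, h2, h3⟩ := (R1_iff _ _ _ _).1 h
      refine ⟨h1.imp id fun h => h.2, by simp [row, h3]⟩)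
    (fun x hx => by
      filter_upwards [eventually_gt_atTop (Nat.pair q x),
        eventually_gt_atTop (Nat.pair (ci q - 1) x)] with k hk hk'
      rw [R1_iff]
      exact ⟨hx.1.imp id fun h => ⟨hk', h⟩, hk, by simpa [row] using hx.2⟩)
  have e2 : (∀ k, (List.range k).any (R2 q (pre N k)) = false) ↔
      ∀ x, row N (q + 1) x → row N (ci q) x := by
    constructor
    · intro h x h1
      by_contra h2
      simp only [row, not_or, Bool.not_eq_true] at h2
      have h1 : N (Nat.pair q x) = true := by simpa [row] using h1
      obtain ⟨k, hk⟩ : ∃ k, k = x + Nat.pair q x + Nat.pair (ci q - 1) x + 1 := ⟨_, rfl⟩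
      have : (List.range k).any (R2 q (pre N k)) = true := by
        simp only [List.any_eq_true, List.mem_range, R2_iff]
        exact ⟨x, by omega, ⟨by omega, h1⟩, h2.1, by omega, h2.2⟩
      rw [h k] at this; cases this
    · intro h k
      by_contra hc
      have hc : (List.range k).any (R2 q (pre N k)) = true := by simpa using hc
      simp only [List.any_eq_true, List.mem_range, R2_iff] at hc
      obtain ⟨x, _, h2, h3, h4⟩ := hc
      rcases h x (Or.inr h2.2) with h5 | h5
      · exact h3 h5
      · rw [h4.2] at h5; cases h5
  unfold Sol
  rw [← e0, ← e1, ← e2, ← forall_and, ← forall_and]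
  simp only [UU, Bool.or_eq_false_iff, pre_length]

theorem U_even (q μ) : U (2 * q) μ = UU q μ := by
  have : (2 * q).div2 = q := by rw [Nat.div2_val]; omega
  simp [U, this]
theorem U_odd (q μ) : U (2 * q + 1) μ = (μ[q]? == some true) := by
  have : (2 * q + 1).div2 = q := by rw [Nat.div2_val]; omega
  simp only [U, this]
  simp

theorem generic_rows : ∃ (M d : ℕ → Bool), LC M ∧ LC d ∧ ∀ q,
    (d q = true → Sol q (row M (ci q)) (row M (q + 1))) ∧
    (d q = false → ∀ Z, ¬ Sol q (row M (ci q)) Z) := by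
  obtain ⟨M, d, hd, h⟩ := low_basis U U_prim U_mono
  have hU1 : ∀ y, (∀ N, (∀ j, U (2 * y + 1) (pre N j) = false) ↔ N y = false) := by
    intro y N
    simp only [U_odd, beq_eq_false_iff_ne, ne_eq, pre_get_some]
    constructor
    · intro h; have := h (y + 1); simpa using this
    · intro h j h'; rw [h] at h'; exact absurd h'.2 (by simp)
  have hM : ∀ y, M y = !d (2 * y + 1) := by
    intro y
    cases hy : d (2 * y + 1)
    · obtain ⟨j, hj⟩ := (h _).2 hy M fun s' _ hs' => (h s').1 hs'
      by_contra hc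
      have := (hU1 y M).2 (by simpa using hc) j
      rw [hj] at this; cases this
    · exact (hU1 y M).1 ((h _).1 hy)
  refine ⟨M, fun q => d (2 * q), ?_, LC.comp hd (LC.of_primrec (by fun_prop)), fun q => ⟨?_, ?_⟩⟩
  · have : LC fun y => !d (2 * y + 1) :=
      LC.comp (f := fun b : Bool => !b) (LC.of_primrec (by fun_prop))
        (LC.comp hd (LC.of_primrec (by fun_prop)))
    rw [show M = fun y => !d (2 * y + 1) from funext hM]
    exact this
  · intro hq
    rw [← UU_sem]
    intro j
    rw [← U_even]
    exact (h _).1 hq j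
  · intro hq Z hZ
    let N : ℕ → Bool := fun y => if y.unpair.1 = q then decide (Z y.unpair.2) else M y
    have hrow : ∀ i ≤ q, row N i = row M i := by
      intro i hi
      funext x
      rcases i with _ | i
      · simp [row]
      · have : ¬ i = q := by omega
        simp [row, N, this]
    have hrowq : row N (q + 1) = Z := by
      funext x
      simp [row, N]
    obtain ⟨j, hj⟩ := (h _).2 hq N (by
      intro s' hs' hd' 
      rcases Nat.even_or_odd' s' with ⟨y, rfl | rfl⟩
      · have := (h _).1 hd'
        simp only [U_even] at this ⊢
        rw [UU_sem] at this ⊢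
        rw [hrow _ (by have := ci_le y; omega), hrow _ (by omega)]
        exact this
      · have := (h _).1 hd'
        rw [hU1] at this ⊢
        have h1 : y.unpair.1 ≠ q := by have := Nat.unpair_left_le y; omega
        simp [N, h1, this])
    rw [U_even] at hj
    have : ∀ j, UU q (pre N j) = false := by
      rw [UU_sem, hrowq, hrow _ (ci_le q)]
      exact hZ
    rw [this] at hj; cases hj

/-! ### construction of `B` -/

def par (e : ℕ) : Bool := Nat.ble 1 e.unpair.2

@[fun_prop] theorem P_par {α : Type} [Primcodable α] {f : α → ℕ} (h : Primrec f) :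
    Primrec fun a => par (f a) := by unfold par; fun_prop

def sσ (side : Bool) (q : ℕ) : List Bool := bif side then (cs q).1 else (cs q).2.1
def se (side : Bool) (q : ℕ) : ℕ := bif side then (cs q).2.2.1 else (cs q).2.2.2

@[fun_prop] theorem P_sσ {α : Type} [Primcodable α] {s : α → Bool} {f : α → ℕ} (h1 : Primrec s)
    (h : Primrec f) : Primrec fun a => sσ (s a) (f a) := by unfold sσ; fun_prop
@[fun_prop] theorem P_se {α : Type} [Primcodable α] {s : α → Bool} {f : α → ℕ} (h1 : Primrec s)
    (h : Primrec f) : Primrec fun a => se (s a) (f a) := by unfold se; fun_prop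

def goodN (_q t : ℕ) : ℕ := (dz t.div2).2

def Good (M a : ℕ → Bool) (q t : ℕ) : Prop :=
  Ext (sσ t.bodd q) (dz t.div2).1 (fun x => row M (ci q) x ∧ a x = t.bodd) ∧
  q.unpair.2 ≤ goodN q t ∧ W (se t.bodd q) (dz t.div2).1 (goodN q t)

theorem LC_Good {M a : ℕ → Bool} (hM : LC M) (ha : LC a) :
    LC fun z : ℕ × ℕ => decide (Good M a z.1 z.2) := by
  obtain ⟨MS, hMS, hM⟩ := hM
  obtain ⟨aS, haS, ha⟩ := ha
  refine ⟨fun z s => extb (sσ z.2.bodd z.1) (dz z.2.div2).1 &&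
    (newb (sσ z.2.bodd z.1) (dz z.2.div2).1 (fun x =>
      (ci z.1 == 0 || MS (Nat.pair (ci z.1 - 1) x) s) && (aS x s == z.2.bodd)) &&
    (Nat.ble z.1.unpair.2 (dz z.2.div2).2 && Wk (se z.2.bodd z.1) s (dz z.2.div2))), ?_, ?_⟩
  · have h1 : Primrec fun w : ((ℕ × ℕ) × ℕ) × ℕ => aS w.2 w.1.2 :=
      P_comp (f := fun p : ℕ × ℕ => aS p.1 p.2)
        (g := fun w : ((ℕ × ℕ) × ℕ) × ℕ => (w.2, w.1.2)) haS (by fun_prop)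
    have h2 : Primrec fun w : ((ℕ × ℕ) × ℕ) × ℕ => MS (Nat.pair (ci w.1.1.1 - 1) w.2) w.1.2 :=
      P_comp (f := fun p : ℕ × ℕ => MS p.1 p.2)
        (g := fun w : ((ℕ × ℕ) × ℕ) × ℕ => (Nat.pair (ci w.1.1.1 - 1) w.2, w.1.2)) hMS
        (by fun_prop)
    fun_prop
  · rintro ⟨q, t⟩
    dsimp only
    have h1 : ∀ᶠ s in atTop, ∀ x ∈ Finset.range (dz t.div2).1.length,
        aS x s = a x ∧ MS (Nat.pair (ci q - 1) x) s = M (Nat.pair (ci q - 1) x) := by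
      rw [Filter.eventually_all_finset]
      intro x _
      exact (ha x).and (hM _)
    have h2 : ∀ᶠ s in atTop, (Wk (se t.bodd q) s (dz t.div2) = true ↔
        W (se t.bodd q) (dz t.div2).1 (dz t.div2).2) := by
      by_cases h : W (se t.bodd q) (dz t.div2).1 (dz t.div2).2
      · filter_upwards [Wk_complete h] with s hs
        exact ⟨fun _ => h, fun _ => hs⟩
      · exact .of_forall fun s => ⟨Wk_sound, fun h' => absurd h' h⟩
    filter_upwards [h1, h2] with s h1 h2
    rw [Bool.eq_iff_iff, decide_eq_true_iff]
    simp only [Bool.and_eq_true, extb_iff, newb_iff, h2, Good, goodN, Nat.ble_eq, Bool.or_eq_true,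
      beq_iff_eq]
    have key : ∀ x, (dz t.div2).1[x]? = some true →
        (((ci q = 0 ∨ MS (Nat.pair (ci q - 1) x) s = true) ∧ aS x s = t.bodd) ↔
          (row M (ci q) x ∧ a x = t.bodd)) := by
      intro x hx
      obtain ⟨h3, h4⟩ := h1 x (Finset.mem_range.2 (List.getElem?_eq_some_iff.1 hx).1)
      rw [h3, h4, row]
    constructor
    · rintro ⟨a1, a2, a3, a4⟩
      exact ⟨⟨a1, fun x hx hx' => (key x hx').1 (a2 x hx hx')⟩, a3, a4⟩
    · rintro ⟨⟨a1, a2⟩, a3, a4⟩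
      exact ⟨a1, fun x hx hx' => (key x hx').2 (a2 x hx hx'), a3, a4⟩

theorem exists_good {M a : ℕ → Bool} {q : ℕ} (h : ∀ Z, ¬ Sol q (row M (ci q)) Z) :
    ∃ t, Good M a q t := by
  by_contra hc
  push Not at hc
  refine h (fun x => row M (ci q) x ∧ a x = true) ⟨?_, ?_, fun x hx => hx.1⟩
  · intro τ n hE hb hW
    apply hc (2 * Encodable.encode (τ, n) + 1)
    have e1 : (2 * Encodable.encode (τ, n) + 1).bodd = true := by simp
    have e2 : (2 * Encodable.encode (τ, n) + 1).div2 = Encodable.encode (τ, n) := by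
      rw [Nat.div2_val]; omega
    simp only [Good, goodN, e1, e2, dz_encode]
    exact ⟨hE, hb, hW⟩
  · intro τ n hE hb hW
    apply hc (2 * Encodable.encode (τ, n))
    have e1 : (2 * Encodable.encode (τ, n)).bodd = false := by simp
    have e2 : (2 * Encodable.encode (τ, n)).div2 = Encodable.encode (τ, n) := by
      rw [Nat.div2_val]; omega
    simp only [Good, goodN, e1, e2, dz_encode]
    refine ⟨⟨hE.e, fun x hx hx' => ?_⟩, hb, hW⟩
    obtain ⟨h1, h2⟩ := hE.n x hx hx'
    refine ⟨h1, ?_⟩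
    by_contra h3
    exact h2 ⟨h1, by simpa using h3⟩

def stepB (d : Bool) (t p : ℕ) (β : List Bool) : List Bool :=
  bif d then β ++ [false] else
    (β ++ (List.range (goodN 0 t - β.length)).map fun _ => false) ++
      [par (se t.bodd (Nat.pair p β.length))]

theorem main_B {A : Set ℕ} (hA : TRed A K) : ∃ (M : ℕ → Bool) (B : Set ℕ), TRed B K ∧ ∀ p, ∃ b,
    Sol (Nat.pair p b) (row M (ci (Nat.pair p b))) (row M (Nat.pair p b + 1)) ∨
    (∃ side : Bool, ∃ τ n,
      Ext (sσ side (Nat.pair p b)) τ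
        (fun x => row M (ci (Nat.pair p b)) x ∧ (x ∈ A ↔ side = true)) ∧
      W (se side (Nat.pair p b)) τ n ∧ (n ∈ B ↔ par (se side (Nat.pair p b)) = true)) := by
  have ha := LC_of_TRed hA
  obtain ⟨M, d, hM, hd, hMd⟩ := generic_rows
  have hP : LC fun z : ℕ × ℕ => d z.1 || decide (Good M (fun n => decide (n ∈ A)) z.1 z.2) :=
    LC.comp (f := fun w : Bool × Bool => w.1 || w.2) (LC.of_primrec (by fun_prop))
      (LC.pair (LC.comp hd (LC.of_primrec (by fun_prop))) (LC_Good hM ha))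
  obtain ⟨f, hf, hf'⟩ := LC.choose hP (fun q => by
    cases h : d q
    · obtain ⟨t, ht⟩ := exists_good (a := fun n => decide (n ∈ A)) ((hMd q).2 h)
      exact ⟨t, by simp only [h, Bool.false_or, decide_eq_true_iff]; exact ht⟩
    · exact ⟨0, by simp [h]⟩)
  let step : ℕ → List Bool → List Bool := fun p β =>
    stepB (d (Nat.pair p β.length)) (f (Nat.pair p β.length)) p β
  let β : ℕ → List Bool := fun p => Nat.rec [] step p
  have LCβ : LC β := by
    have h0 : LC fun z : Unit × ℕ × List Bool => Nat.pair z.2.1 z.2.2.length :=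
      LC.of_primrec (by fun_prop)
    have hS : Primrec fun w : Bool × ℕ × Unit × ℕ × List Bool =>
        stepB w.1 w.2.1 w.2.2.2.1 w.2.2.2.2 := by
      unfold stepB goodN; fun_prop
    have h1 : LC fun z : Unit × ℕ × List Bool => step z.2.1 z.2.2 :=
      LC.comp (f := fun w : Bool × ℕ × Unit × ℕ × List Bool =>
        stepB w.1 w.2.1 w.2.2.2.1 w.2.2.2.2) (LC.of_primrec hS)
        (LC.pair (LC.comp hd h0) (LC.pair (LC.comp hf h0) (LC.of_primrec P_id)))
    have h2 := LC.natrec (f := fun _ : Unit => ([] : List Bool)) (LC.of_primrec (by fun_prop)) h1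
    exact LC.comp (f := fun a : Unit × ℕ => (Nat.rec [] (fun n b => step n b) a.2 : List Bool)) h2
      (LC.of_primrec (f := fun s : ℕ => ((), s)) (by fun_prop))
  have βs : ∀ p, β (p + 1) = step p (β p) := fun p => rfl
  have hpre1 : ∀ p, ∃ l, β (p + 1) = β p ++ l ∧ l ≠ [] := by
    intro p
    rw [βs]
    simp only [step, stepB]
    cases d (Nat.pair p (β p).length)
    · exact ⟨_, by rw [cond_false, List.append_assoc], by simp⟩
    · exact ⟨[false], rfl, by simp⟩
  have hlen : ∀ p, p ≤ (β p).length := by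
    intro p
    induction p with
    | zero => simp
    | succ p ih =>
      obtain ⟨l, h1, h2⟩ := hpre1 p
      have := List.length_pos_iff.2 h2
      rw [h1, List.length_append]; omega
  have hstab : ∀ p r, p ≤ r → ∀ n < (β p).length, (β r)[n]? = (β p)[n]? := by
    intro p r hpr n hn
    induction r, hpr using Nat.le_induction with
    | base => rfl
    | succ r hr ih =>
      obtain ⟨l, h1, h2⟩ := hpre1 r
      have : n < (β r).length := by
        by_contra hc
        rw [List.getElem?_eq_none (by omega)] at ih
        rw [List.getElem?_eq_getElem hn] at ih
        cases ih
      rw [h1, List.getElem?_append_left this, ih]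
  let Bb : ℕ → Bool := fun n => ((β (n + 1))[n]?).getD false
  have LCB : LC Bb :=
    LC.comp (f := fun w : List Bool × ℕ => (w.1[w.2]?).getD false) (LC.of_primrec (by fun_prop))
      (LC.pair (LC.comp LCβ (LC.of_primrec (f := fun n : ℕ => n + 1) (by fun_prop)))
        (LC.of_primrec P_id))
  have hB : ∀ p n v, (β p)[n]? = some v → Bb n = v := by
    intro p n v h
    have hn := (List.getElem?_eq_some_iff.1 h).1
    have hn' : n < (β (n + 1)).length := by have := hlen (n + 1); omega
    have e1 := hstab p (max p (n + 1)) (le_max_left _ _) n hn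
    have e2 := hstab (n + 1) (max p (n + 1)) (le_max_right _ _) n hn'
    simp only [Bb]
    rw [← e2, e1, h]; rfl
  refine ⟨M, {n | Bb n = true}, TRed_of_LC (by simpa using LCB), fun p => ?_⟩
  refine ⟨(β p).length, ?_⟩
  obtain ⟨q, hq⟩ : ∃ q, q = Nat.pair p (β p).length := ⟨_, rfl⟩
  rw [← hq]
  have hg := hf' q
  cases hdq : d q
  · right
    rw [hdq, Bool.false_or, decide_eq_true_iff] at hg
    dsimp only at hg
    obtain ⟨h1, h2, h3⟩ := hg
    refine ⟨(f q).bodd, _, _, ⟨h1.e, fun x hx hx' => ⟨(h1.n x hx hx').1, ?_⟩⟩, h3, ?_⟩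
    · rw [← (h1.n x hx hx').2]; simp
    · have e : β (p + 1) = (β p ++ (List.range (goodN 0 (f q) - (β p).length)).map fun _ => false)
          ++ [par (se (f q).bodd q)] := by
        rw [βs]
        simp only [step, stepB, ← hq, hdq, cond_false]
      have h4 : (β p).length ≤ goodN q (f q) := by
        rw [hq, Nat.unpair_pair] at h2; rw [hq]; exact h2
      have h5 : (β (p + 1))[goodN q (f q)]? = some (par (se (f q).bodd q)) := by
        have : goodN q (f q) = (β p ++ (List.range (goodN 0 (f q) - (β p).length)).map
            fun _ => false).length := by
          rw [List.length_append, List.length_map, List.length_range]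
          show goodN 0 (f q) = _
          change (β p).length ≤ goodN 0 (f q) at h4
          omega
        rw [e, this, List.getElem?_concat_length]
      have h6 := hB (p + 1) (goodN q (f q)) _ h5
      show Bb _ = true ↔ _
      rw [h6]
  · left; exact (hMd q).1 hdq

/-! ### the final argument -/

theorem Ext.refl (σ : List Bool) (R : ℕ → Prop) : Ext σ σ R :=
  ⟨fun _ _ => rfl, fun x hx h => by
    have := (List.getElem?_eq_some_iff.1 h).1; omega⟩

theorem Ext.len {σ τ : List Bool} {R : ℕ → Prop} (h : Ext σ τ R) : σ.length ≤ τ.length := by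
  by_contra hc
  have h1 := h.e τ.length (by omega)
  rw [List.getElem?_eq_none (le_refl _), List.getElem?_eq_getElem (by omega)] at h1
  cases h1

theorem Ext.trans {σ τ ρ : List Bool} {R R' : ℕ → Prop} (h : Ext σ τ R) (h' : Ext τ ρ R')
    (hR : ∀ x, R' x → R x) : Ext σ ρ R := by
  have hl := h.len
  refine ⟨fun x hx => by rw [h'.e x (by omega), h.e x hx], fun x hx hx' => ?_⟩
  by_cases hx2 : x < τ.length
  · exact h.n x hx (by rw [← h'.e x hx2, hx'])
  · exact hR x (h'.n x (by omega) hx')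

theorem Ext.mono {σ τ : List Bool} {R R' : ℕ → Prop} (h : Ext σ τ R) (hR : ∀ x, R x → R' x) :
    Ext σ τ R' := ⟨h.e, fun x hx hx' => hR x (h.n x hx hx')⟩

structure Cond (M : ℕ → Bool) (A : Set ℕ) where
  i : ℕ
  σ : Bool → List Bool
  inf : {x | row M i x}.Infinite
  ok : ∀ side x, (σ side)[x]? = some true → (x ∈ A ↔ side = true)

def Cond.Le {M : ℕ → Bool} {A : Set ℕ} (c' c : Cond M A) : Prop :=
  (∀ x, row M c'.i x → row M c.i x) ∧ ∀ side, Ext (c.σ side) (c'.σ side) (row M c.i)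

def Sat {M : ℕ → Bool} {A : Set ℕ} (B : Set ℕ) (e : ℕ) (side : Bool) (c : Cond M A) : Prop :=
  (∃ n, W e (c.σ side) n ∧ (n ∈ B ↔ par e = true)) ∨ ∃ b, Neg e (c.σ side) b (row M c.i)

theorem step_cond {M : ℕ → Bool} {A B : Set ℕ} (h : ∀ p, ∃ b,
    Sol (Nat.pair p b) (row M (ci (Nat.pair p b))) (row M (Nat.pair p b + 1)) ∨
    (∃ side : Bool, ∃ τ n,
      Ext (sσ side (Nat.pair p b)) τ
        (fun x => row M (ci (Nat.pair p b)) x ∧ (x ∈ A ↔ side = true)) ∧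
      W (se side (Nat.pair p b)) τ n ∧ (n ∈ B ↔ par (se side (Nat.pair p b)) = true)))
    (c : Cond M A) (e0 e1 : ℕ) :
    ∃ c' : Cond M A, c'.Le c ∧ (Sat B e0 true c' ∨ Sat B e1 false c') := by
  obtain ⟨b, hb⟩ := h (Nat.pair c.i (Encodable.encode ((c.σ true, c.σ false, e0, e1) : Par)))
  generalize hq : Nat.pair (Nat.pair c.i
    (Encodable.encode ((c.σ true, c.σ false, e0, e1) : Par))) b = q at hb
  have hci : ci q = c.i := by rw [← hq]; simp [ci]
  have hcs : cs q = (c.σ true, c.σ false, e0, e1) := by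
    rw [← hq]; unfold cs; rw [Nat.unpair_pair, Nat.unpair_pair, Encodable.encodek]; rfl
  have hσ : ∀ side, sσ side q = c.σ side := by
    intro side; cases side <;> simp [sσ, hcs]
  rcases hb with ⟨n0, n1, sub⟩ | ⟨side, τ, n, hE, hW, hn⟩
  · rw [hcs] at n0 n1
    rw [hci] at n1 sub
    dsimp only at n0 n1
    by_cases hinf : {x | row M (q + 1) x}.Infinite
    · exact ⟨⟨q + 1, c.σ, hinf, c.ok⟩, ⟨sub, fun side => Ext.refl _ _⟩, Or.inl (Or.inr ⟨_, n0⟩)⟩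
    · rw [Set.not_infinite] at hinf
      obtain ⟨m, hm⟩ := hinf.bddAbove
      have hpad : ∀ x, (c.σ false).length ≤ x →
          (c.σ false ++ List.replicate (m + 1) false)[x]? ≠ some true := by
        intro x hx h
        rw [List.getElem?_append_right hx, List.getElem?_replicate] at h
        split_ifs at h
        simp at h
      have hpad2 : ∀ x < (c.σ false).length,
          (c.σ false ++ List.replicate (m + 1) false)[x]? = (c.σ false)[x]? :=
        fun x hx => List.getElem?_append_left hx
      refine ⟨⟨c.i, fun s => bif s then c.σ true else c.σ false ++ List.replicate (m + 1) false,
        c.inf, ?_⟩, ⟨fun x hx => hx, ?_⟩, Or.inr (Or.inr ⟨q.unpair.2, ?_⟩)⟩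
      · intro side x hx
        cases side
        · by_cases hx2 : x < (c.σ false).length
          · rw [cond_false, hpad2 x hx2] at hx
            exact c.ok false x hx
          · exact absurd hx (hpad x (by omega))
        · exact c.ok true x hx
      · intro side
        cases side
        · exact ⟨hpad2, fun x hx hx' => absurd hx' (hpad x hx)⟩
        · exact Ext.refl _ _
      · intro τ n hE hn
        have hE' : Ext (c.σ false ++ List.replicate (m + 1) false) τ (row M c.i) := hE
        have hlen : (c.σ false ++ List.replicate (m + 1) false).length =
          (c.σ false).length + (m + 1) := by simp
        refine n1 τ n ⟨fun x hx => ?_, fun x hx hx' => ?_⟩ hn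
        · rw [hE'.e x (by omega), hpad2 x hx]
        · by_cases hx2 : x < (c.σ false).length + (m + 1)
          · rw [hE'.e x (by omega)] at hx'
            exact absurd hx' (hpad x hx)
          · refine ⟨hE'.n x (by omega) hx', fun hr => ?_⟩
            have : x ≤ m := hm hr
            omega
  · rw [hσ, hci] at hE
    refine ⟨⟨c.i, fun s => if s = side then τ else c.σ s, c.inf, ?_⟩, ⟨fun x hx => hx, ?_⟩, ?_⟩
    · intro s x hx
      by_cases hs : s = side
      · subst hs
        simp only [if_true] at hx
        by_cases hx2 : x < (c.σ s).length
        · rw [hE.e x hx2] at hx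
          exact c.ok s x hx
        · exact (hE.n x (by omega) hx).2
      · simp only [hs, if_false] at hx
        exact c.ok s x hx
    · intro s
      by_cases hs : s = side
      · subst hs
        simp only [if_true]
        exact hE.mono fun x hx => hx.1
      · simp only [hs, if_false]
        exact Ext.refl _ _
    · have hse : se side q = bif side then e0 else e1 := by
        cases side <;> simp [se, hcs]
      rw [hse] at hW hn
      cases side
      · right; left; exact ⟨n, by simpa using hW, hn⟩
      · left; left; exact ⟨n, by simpa using hW, hn⟩

theorem mkE (c : Code) (v : Bool) : ∃ e, par e = v ∧
    ∀ τ n, W e τ n ↔ (c.eval (Encodable.encode (τ, n))).Dom := by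
  refine ⟨Nat.pair (Encodable.encode c) (bif v then 1 else 0), ?_, fun τ n => ?_⟩
  · cases v <;> simp [par] <;> rfl
  · simp [W]

theorem exists_big (x : ℕ) : ∃ e, ∀ τ n, W e τ n ↔ ∃ y ≥ x, τ[y]? = some true := by
  have hP : Partrec fun p : List Bool × ℕ =>
      ((bif (List.range p.1.length).any (fun y => Nat.ble x y && p.1[y]? == some true)
        then some 0 else none : Option ℕ) : Part ℕ) := by
    refine Computable.ofOption (Primrec.to_comp ?_)
    fun_prop
  obtain ⟨c, hc⟩ := partrec_code hP
  obtain ⟨e, -, he⟩ := mkE c true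
  refine ⟨e, fun τ n => ?_⟩
  rw [he, hc]
  have key : (List.range τ.length).any (fun y => Nat.ble x y && τ[y]? == some true) = true ↔
      ∃ y ≥ x, τ[y]? = some true := by
    simp only [List.any_eq_true, List.mem_range, Bool.and_eq_true, Nat.ble_eq, beq_iff_eq]
    constructor
    · rintro ⟨y, _, h1, h2⟩; exact ⟨y, h1, h2⟩
    · rintro ⟨y, h1, h2⟩; exact ⟨y, (List.getElem?_eq_some_iff.1 h2).1, h1, h2⟩
  rw [← key]
  cases (List.range τ.length).any (fun y => Nat.ble x y && τ[y]? == some true) <;> simp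

theorem final {A : Set ℕ} (hA : TRed A K) : ∃ B : Set ℕ, TRed B K ∧
    ∃ S ∈ Hset A, ¬ ∃ T ∈ Hset B, TRed T S := by
  obtain ⟨M, B, hB, h⟩ := main_B hA
  refine ⟨B, hB, ?_⟩
  have hst := step_cond h
  choose nx hnx hsat using hst
  let c0 : Cond M A := ⟨0, fun _ => [], by simpa [row] using Set.infinite_univ, by simp⟩
  let C : ℕ → Cond M A := fun k => Nat.rec c0 (fun k c => nx c k.unpair.1 k.unpair.2) k
  have Cs : ∀ k, C (k + 1) = nx (C k) k.unpair.1 k.unpair.2 := fun k => rfl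
  have Cle : ∀ j k, j ≤ k → (C k).Le (C j) := by
    intro j k hjk
    induction k, hjk using Nat.le_induction with
    | base => exact ⟨fun x hx => hx, fun s => Ext.refl _ _⟩
    | succ k hk ih =>
      have h1 : (C (k + 1)).Le (C k) := hnx _ _ _
      exact ⟨fun x hx => ih.1 x (h1.1 x hx), fun s => (ih.2 s).trans (h1.2 s) ih.1⟩
  have hside : ∃ side, ∀ e, ∃ k, Sat B e side (C k) := by
    by_cases h0 : ∀ e, ∃ k, Sat B e true (C k)
    · exact ⟨true, h0⟩
    · push Not at h0
      obtain ⟨e0, h0⟩ := h0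
      refine ⟨false, fun e1 => ⟨Nat.pair e0 e1 + 1, ?_⟩⟩
      have := hsat (C (Nat.pair e0 e1)) (Nat.pair e0 e1).unpair.1 (Nat.pair e0 e1).unpair.2
      rw [← Cs, Nat.unpair_pair] at this
      rcases this with h1 | h1
      · exact absurd h1 (h0 (Nat.pair e0 e1 + 1))
      · exact h1
  obtain ⟨side, hS⟩ := hside
  let G : Set ℕ := {x | ∃ k, ((C k).σ side)[x]? = some true}
  have hG1 : ∀ k, ∀ x < ((C k).σ side).length,
      ((C k).σ side)[x]? = some (decide (x ∈ G)) := by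
    intro k x hx
    by_cases hxG : x ∈ G
    · rw [decide_eq_true hxG]
      obtain ⟨j, hj⟩ := hxG
      have hxj := (List.getElem?_eq_some_iff.1 hj).1
      have e1 := ((Cle j (max j k) (le_max_left _ _)).2 side).e x hxj
      have e2 := ((Cle k (max j k) (le_max_right _ _)).2 side).e x hx
      rw [← e2, e1, hj]
    · rw [decide_eq_false hxG, List.getElem?_eq_getElem hx]
      by_contra hc
      refine hxG ⟨k, ?_⟩
      rw [List.getElem?_eq_getElem hx]
      simpa using hc
  have hG2 : ∀ k x, x ∈ G → ((C k).σ side).length ≤ x → row M (C k).i x := by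
    rintro k x ⟨j, hj⟩ hx
    rcases le_total j k with hjk | hjk
    · have hxj := (List.getElem?_eq_some_iff.1 hj).1
      have := ((Cle j k hjk).2 side).len
      omega
    · exact ((Cle k j hjk).2 side).n x hx hj
  have hpre : ∀ k, pre (fun x => decide (x ∈ G)) ((C k).σ side).length = (C k).σ side := by
    intro k
    apply List.ext_getElem?
    intro x
    rw [pre_get]
    split_ifs with hx
    · exact (hG1 k x hx).symm
    · rw [List.getElem?_eq_none (by omega)]
  have hext : ∀ k m, ((C k).σ side).length ≤ m →
      Ext ((C k).σ side) (pre (fun x => decide (x ∈ G)) m) (row M (C k).i) := by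
    intro k m hm
    refine ⟨fun x hx => ?_, fun x hx hx' => ?_⟩
    · rw [pre_get, if_pos (by omega), hG1 k x hx]
    · rw [pre_get_some] at hx'
      exact hG2 k x (by simpa using hx'.2) hx
  have hGinf : G.Infinite := by
    refine Set.infinite_of_forall_exists_gt fun x0 => ?_
    obtain ⟨e, he⟩ := exists_big (x0 + 1)
    obtain ⟨k, ⟨n, hn, -⟩ | ⟨b, hb⟩⟩ := hS e
    · obtain ⟨y, hy, hy'⟩ := (he _ _).1 hn
      exact ⟨y, ⟨k, hy'⟩, hy⟩
    · exfalso
      obtain ⟨y, hy, hy'⟩ := (C k).inf.exists_gt (max (x0 + 1) ((C k).σ side).length)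
      have hy1 := le_max_left (x0 + 1) ((C k).σ side).length
      have hy2 := le_max_right (x0 + 1) ((C k).σ side).length
      refine hb (pre (fun z => if z < ((C k).σ side).length then decide (z ∈ G) else
        decide (z = y)) (y + 1)) b ⟨fun x hx => ?_, fun x hx hx' => ?_⟩ le_rfl ((he _ _).2 ⟨y, ?_, ?_⟩)
      · rw [pre_get, if_pos (by omega), if_pos hx, hG1 k x hx]
      · rw [pre_get_some, if_neg (by omega)] at hx'
        have : x = y := by simpa using hx'.2
        rw [this]; exact hy
      · omega
      · rw [pre_get_some, if_neg (by omega)]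
        simp
  have hGA : G ∈ Hset A := by
    refine ⟨hGinf, ?_⟩
    cases hs : side
    · right
      rintro x ⟨k, hk⟩
      have := (C k).ok side x hk
      rw [hs] at this
      exact fun hx => by simpa using this.1 hx
    · left
      rintro x ⟨k, hk⟩
      exact ((C k).ok side x hk).2 hs
  refine ⟨G, hGA, ?_⟩
  rintro ⟨T, ⟨hTinf, hTB⟩, hTG⟩
  obtain ⟨c, hc⟩ := use_code hTG
  have hv : ∃ v : Bool, ∀ n ∈ T, ¬ (n ∈ B ↔ v = true) := by
    rcases hTB with h1 | h1
    · exact ⟨false, fun n hn h2 => by simpa using h2.1 (h1 hn)⟩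
    · exact ⟨true, fun n hn h2 => h1 hn (h2.2 rfl)⟩
  obtain ⟨v, hv⟩ := hv
  obtain ⟨e, hev, he⟩ := mkE c v
  obtain ⟨k, ⟨n, hn, hnB⟩ | ⟨b, hb⟩⟩ := hS e
  · rw [he, ← hpre k] at hn
    rw [hev] at hnB
    exact hv n ((hc n).2 _ hn) hnB
  · obtain ⟨n, hn, hbn⟩ := hTinf.exists_gt b
    obtain ⟨m, h1, h2⟩ := (((hc n).1 hn).and
      (eventually_ge_atTop ((C k).σ side).length)).exists
    exact hb _ n (hext k m h2) hbn.le ((he _ _).2 h1)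

end NL

/-- there is no largest element among the mass problems `H(A)` for
`Δ⁰₂` sets `A`, under Muchnik reducibility. -/
theorem stmt9 :
    ¬ ∃ A : Set ℕ, TRed A K ∧
      ∀ B : Set ℕ, TRed B K →
        ∀ S ∈ Hset A, ∃ T ∈ Hset B, TRed T S := by
  rintro ⟨A, hA, h⟩
  obtain ⟨B, hB, S, hS, hn⟩ := NL.final hA
  exact hn (h B hB S hS)
end
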